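/- Assume K_1,…,K_N are pairwise distinct. Then for every i ∈ {1,…,N} and every nonzero v_0 ∈ M[m] there exist vectors v_1,…,v_{m_i} ∈ M[m] such that the quasi-exponential e^{K_i u}(v_0 u^{m_i} + v_1 u^{m_i−1} + … + v_{m_i}) is annihilated by D_{K,M}(u,∂) restricted to M[m]-valued functions. Moreover, the ℂ-span of all such quasi-exponentials is the whole kernel: every holomorphic solution of D_{K,M}(u,∂) f = 0 on a simply connected open subset of ℂ∖{z_1,…,z_n} is a ℂ-linear combination of restrictions of such quasi-exponentials. -/

import Mathlib

noncomputable section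

namespace GaudinModel

/-- A vector-valued quasi-exponential: a finite sum of functions `e^{λu} p(u)` with `p` a
vector-valued polynomial. -/
def IsQE {M : Type*} [AddCommGroup M] [Module ℂ M] (f : ℂ → M) : Prop :=
  ∃ (k d : ℕ) (lam : Fin k → ℂ) (v : Fin k → Fin d → M),
    ∀ u : ℂ, f u = ∑ i : Fin k, ∑ j : Fin d,
      (Complex.exp (lam i * u) * u ^ (j : ℕ)) • v i j

variable {N n : ℕ}

/-- Points away from the singular points `z_1, …, z_n`. -/
def GoodG {n : ℕ} (z : Fin n → ℂ) (u : ℂ) : Prop := ∀ j : Fin n, u ≠ z j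

section Setup

variable (V : Fin n → Type*) [∀ i, AddCommGroup (V i)] [∀ i, Module ℂ (V i)]
  (M : Type*) [NormedAddCommGroup M] [NormedSpace ℂ M]
  (E : ∀ i : Fin n, Fin N → Fin N → (V i →ₗ[ℂ] V i))
  (φ : M ≃ₗ[ℂ] PiTensorProduct ℂ V)

/-- The commutation relations of `gl_N`: `[e_{ab}, e_{cd}] = δ_{bc} e_{ad} − δ_{da} e_{cb}`,
for the operators `E i a b` (the action of `e_{ab}` on the `i`-th factor `V i`). -/
def GlRel : Prop :=
  ∀ (i : Fin n) (a b c d : Fin N),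
    E i a b ∘ₗ E i c d - E i c d ∘ₗ E i a b =
      (if b = c then (1 : ℂ) else 0) • E i a d - (if d = a then (1 : ℂ) else 0) • E i c b

/-- Each `V i` is the irreducible finite-dimensional `gl_N`-module with highest weight
`Λ i`: it is generated by a nonzero vector `v` with `e_{ab} v = 0` for `a < b` and
`e_{aa} v = Λ_a v`. -/
def IsHW (Λ : Fin n → Fin N → ℤ) : Prop :=
  ∀ i : Fin n, ∃ v : V i, v ≠ 0 ∧
    (∀ a b : Fin N, a < b → E i a b v = 0) ∧
    (∀ a : Fin N, E i a a v = (Λ i a : ℂ) • v) ∧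
    ∀ W : Submodule ℂ (V i), (∀ a b : Fin N, ∀ x ∈ W, E i a b x ∈ W) → v ∈ W →
      ∀ x : V i, x ∈ W

/-- `e_{ab}` acting in the `j`-th tensor factor of `M ≃ V 1 ⊗ ⋯ ⊗ V n`. -/
def EE (j : Fin n) (a b : Fin N) : Module.End ℂ M :=
  φ.symm.toLinearMap ∘ₗ
    (PiTensorProduct.map
      (Function.update (fun i : Fin n => (LinearMap.id : V i →ₗ[ℂ] V i)) j (E j a b))) ∘ₗ
    φ.toLinearMap

variable (z : Fin n → ℂ) (K : Matrix (Fin N) (Fin N) ℂ)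

/-- `X_{ab}(u,∂) = δ_{ab} ∂ − K_{ab} − ∑_j e_{ba}^{(j)}/(u − z_j)`,
acting on `M`-valued functions. -/
def Xg (a b : Fin N) (f : ℂ → M) : ℂ → M :=
  fun u => (if a = b then deriv f u else 0) - K a b • f u
    - ∑ j : Fin n, (u - z j)⁻¹ • (EE V M E φ j b a) (f u)

/-- The universal differential operator
`D_{K,M}(u,∂) = ∑_{σ ∈ S_N} sgn(σ) X_{1σ(1)}(u,∂) ⋯ X_{Nσ(N)}(u,∂)`. -/
def Dg (f : ℂ → M) : ℂ → M :=
  fun u => ∑ σ : Equiv.Perm (Fin N),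
    ((Equiv.Perm.sign σ : ℤˣ) : ℤ) •
      (((List.ofFn fun a : Fin N => Xg V M E φ z K a (σ a)).foldr (· ∘ ·) id) f u)

/-- The weight subspace `M[m]`. -/
def Wt (m : Fin N → ℤ) : Submodule ℂ M :=
  ⨅ a : Fin N, LinearMap.ker
    ((∑ j : Fin n, EE V M E φ j a a) - (m a : ℂ) • (1 : Module.End ℂ M))

/-- The subspace `sing M[m]` of `gl_N`-singular vectors of weight `m`. -/
def SingWt (m : Fin N → ℤ) : Submodule ℂ M :=
  Wt V M E φ m ⊓ ⨅ a : Fin N, ⨅ b : Fin N, ⨅ _ : a < b,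
    LinearMap.ker (∑ j : Fin n, EE V M E φ j a b)

end Setup

end GaudinModel


namespace GaudinAux
open Finset Polynomial Equiv

section PartA

variable {N : ℕ} {J : Type*} [Fintype J] [DecidableEq J]

/-- resolvent coefficient -/
def rr (z : J → ℂ) (j : J) (S : Finset J) : ℂ := ∏ k ∈ S, (z j - z k)⁻¹

lemma pf_aux (z : J → ℂ) (hz : Function.Injective z) {j k l : J} (hjk : j ≠ k) (hkl : k ≠ l)
    (hjl : j ≠ l) :
    (z j - z k)⁻¹ * (z k - z l)⁻¹ = (z j - z l)⁻¹ * ((z j - z k)⁻¹ + (z k - z l)⁻¹) := by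
  have h1 : z j - z k ≠ 0 := sub_ne_zero.2 (hz.ne hjk)
  have h2 : z k - z l ≠ 0 := sub_ne_zero.2 (hz.ne hkl)
  have h3 : z j - z l ≠ 0 := sub_ne_zero.2 (hz.ne hjl)
  field_simp
  ring

lemma rr_insert (z : J → ℂ) (j k : J) (S : Finset J) (hk : k ∉ S) :
    rr z j (insert k S) = (z j - z k)⁻¹ * rr z j S := by
  unfold rr; rw [prod_insert hk]

lemma erase_insert_sum (z : J → ℂ) (l : J) (S : Finset J) (hl : l ∉ S) (f : J → ℂ) :
    ∑ k ∈ insert l S, f k * rr z k ((insert l S).erase k)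
      = f l * rr z l S + ∑ k ∈ S, f k * ((z k - z l)⁻¹ * rr z k (S.erase k)) := by
  rw [sum_insert hl, erase_insert hl]
  congr 1
  apply sum_congr rfl
  intro k hk
  have hkl : l ≠ k := fun h => hl (h ▸ hk)
  rw [erase_insert_of_ne hkl, rr_insert]
  simp [hl]

lemma pf1 (z : J → ℂ) (hz : Function.Injective z) (S : Finset J) (hS : S.Nonempty) :
    ∀ j, j ∉ S → ∑ k ∈ S, (z j - z k)⁻¹ * rr z k (S.erase k) = rr z j S := by
  induction S using Finset.induction_on with
  | empty => simp at hS
  | insert l S hl ih =>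
    intro j hj
    have hjl : j ≠ l := by rintro rfl; simp at hj
    have hjS : j ∉ S := fun h => hj (mem_insert_of_mem h)
    rw [erase_insert_sum z l S hl, rr_insert z j l S hl]
    rcases S.eq_empty_or_nonempty with rfl | hS'
    · simp [rr]
    have e : ∑ k ∈ S, (z j - z k)⁻¹ * ((z k - z l)⁻¹ * rr z k (S.erase k))
        = (z j - z l)⁻¹ * (∑ k ∈ S, (z j - z k)⁻¹ * rr z k (S.erase k))
          - (z j - z l)⁻¹ * (∑ k ∈ S, (z l - z k)⁻¹ * rr z k (S.erase k)) := by
      rw [mul_sum, mul_sum, ← sum_sub_distrib]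
      apply sum_congr rfl
      intro k hk
      have hjk : j ≠ k := fun h => hjS (h ▸ hk)
      have hkl : k ≠ l := fun h => hl (h ▸ hk)
      have : (z l - z k)⁻¹ = - (z k - z l)⁻¹ := by rw [← inv_neg, neg_sub]
      rw [this, ← mul_assoc, pf_aux z hz hjk hkl hjl]
      ring
    rw [e, ih hS' j hjS, ih hS' l hl]
    ring

lemma pf2 (z : J → ℂ) (hz : Function.Injective z) (S : Finset J) :
    ∀ j, j ∉ S → ∑ k ∈ S, (z j - z k)⁻¹ ^ 2 * rr z k (S.erase k)
      = rr z j S * ∑ k ∈ S, (z j - z k)⁻¹ := by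
  induction S using Finset.induction_on with
  | empty => simp
  | insert l S hl ih =>
    intro j hj
    have hjl : j ≠ l := by rintro rfl; simp at hj
    have hjS : j ∉ S := fun h => hj (mem_insert_of_mem h)
    have h1 := pf1 z hz (insert l S) (insert_nonempty _ _) j hj
    rw [erase_insert_sum z l S hl] at h1 ⊢
    rw [rr_insert z j l S hl] at h1 ⊢
    have e : ∑ k ∈ S, (z j - z k)⁻¹ ^ 2 * ((z k - z l)⁻¹ * rr z k (S.erase k))
        = (z j - z l)⁻¹ * (∑ k ∈ S, (z j - z k)⁻¹ ^ 2 * rr z k (S.erase k))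
          + (z j - z l)⁻¹ * (∑ k ∈ S, (z j - z k)⁻¹ * ((z k - z l)⁻¹ * rr z k (S.erase k))) := by
      rw [mul_sum, mul_sum, ← sum_add_distrib]
      apply sum_congr rfl
      intro k hk
      have hjk : j ≠ k := fun h => hjS (h ▸ hk)
      have hkl : k ≠ l := fun h => hl (h ▸ hk)
      have := pf_aux z hz hjk hkl hjl
      calc _ = (z j - z k)⁻¹ * ((z j - z k)⁻¹ * (z k - z l)⁻¹) * rr z k (S.erase k) := by ring
        _ = _ := by rw [this]; ring
    rw [e, ih j hjS, sum_insert hl]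
    linear_combination (z j - z l)⁻¹ * h1

variable {F : Type*} [AddCommGroup F] [Module ℂ F]

/-- place permutations supported in S -/
def fixS (S : Finset J) : Finset (Perm J) := univ.filter (fun σ => ∀ j, j ∉ S → σ j = j)

lemma mem_fixS {S : Finset J} {σ : Perm J} : σ ∈ fixS S ↔ ∀ j, j ∉ S → σ j = j := by
  simp [fixS]

def asym (S : Finset J) (g : (J → Fin N) → F) (w : J → Fin N) : F :=
  ∑ σ ∈ fixS S, ((Perm.sign σ : ℤˣ) : ℤ) • g (w ∘ σ)

def chiS (K : Fin N → ℂ) (S : Finset J) (w : J → Fin N) : ℂ[X] :=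
  ∏ b ∈ (S.image w)ᶜ, (X - C (K b))

def CS (D : Module.End ℂ F) (K : Fin N → ℂ) (S : Finset J) (g : (J → Fin N) → F)
    (w : J → Fin N) : F := aeval D (chiS K S w) (asym S g w)

lemma swap_apply_notMem {S : Finset J} {j k x : J} (hj : j ∈ S) (hk : k ∈ S) (hx : x ∉ S) :
    swap j k x = x := swap_apply_of_ne_of_ne (fun h => hx (h ▸ hj)) (fun h => hx (h ▸ hk))

lemma asym_swap (S : Finset J) (g : (J → Fin N) → F) (w : J → Fin N) {j k : J}
    (hj : j ∈ S) (hk : k ∈ S) (hjk : j ≠ k) :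
    asym S g (w ∘ swap j k) = - asym S g w := by
  unfold asym
  rw [← sum_neg_distrib]
  refine sum_bij' (fun σ _ => swap j k * σ) (fun σ _ => swap j k * σ) ?_ ?_ ?_ ?_ ?_
  · intro σ hσ
    rw [mem_fixS] at hσ ⊢
    intro x hx
    simp [hσ x hx, swap_apply_notMem hj hk hx]
  · intro σ hσ
    rw [mem_fixS] at hσ ⊢
    intro x hx
    simp [hσ x hx, swap_apply_notMem hj hk hx]
  · intro σ _; simp [← mul_assoc]
  · intro σ _; simp [← mul_assoc]
  · intro σ _
    rw [Perm.sign_mul, Perm.sign_swap hjk]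
    simp [Function.comp_assoc]

lemma image_swap (S : Finset J) (w : J → Fin N) {j k : J} (hj : j ∈ S) (hk : k ∈ S) :
    S.image (w ∘ swap j k) = S.image w := by
  rw [← image_image]
  congr 1
  ext x
  simp only [mem_image]
  constructor
  · rintro ⟨y, hy, rfl⟩
    by_cases h1 : y = j
    · subst h1; simpa
    by_cases h2 : y = k
    · subst h2; simpa
    rwa [swap_apply_of_ne_of_ne h1 h2]
  · intro hx
    refine ⟨swap j k x, ?_, by simp⟩
    by_cases h1 : x = j
    · subst h1; simpa
    by_cases h2 : x = k
    · subst h2; simpa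
    rwa [swap_apply_of_ne_of_ne h1 h2]

lemma CS_swap (D : Module.End ℂ F) (K : Fin N → ℂ) (S : Finset J) (g : (J → Fin N) → F)
    (w : J → Fin N) {j k : J} (hj : j ∈ S) (hk : k ∈ S) (hjk : j ≠ k) :
    CS D K S g (w ∘ swap j k) = - CS D K S g w := by
  unfold CS chiS
  rw [asym_swap S g w hj hk hjk, image_swap S w hj hk, map_neg]

lemma asym_zero (S : Finset J) (g : (J → Fin N) → F) (w : J → Fin N)
    (h : ¬ Set.InjOn w S) : asym S g w = 0 := by
  unfold Set.InjOn at h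
  push Not at h
  obtain ⟨j, hj, k, hk, hw, hjk⟩ := h
  have h1 := asym_swap S g w hj hk hjk
  have h2 : w ∘ swap j k = w := by
    funext x
    simp only [Function.comp]
    by_cases h1 : x = j
    · subst h1; simp [hw]
    by_cases h2 : x = k
    · subst h2; simp [hw]
    rw [swap_apply_of_ne_of_ne h1 h2]
  rw [h2] at h1
  have h3 : (2 : ℂ) • asym S g w = 0 := by
    rw [two_smul]; nth_rewrite 1 [h1]; simp
  simpa using h3

lemma asym_insert (S : Finset J) (g : (J → Fin N) → F) (w : J → Fin N) {j : J} (hj : j ∉ S) :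
    asym (insert j S) g w = asym S g w
      - ∑ k ∈ S, asym (insert j (S.erase k)) g (w ∘ swap j k) := by
  have h1 : asym (insert j S) g w = ∑ k ∈ insert j S, ∑ σ ∈ fixS (insert j S) with σ⁻¹ j = k,
      ((Perm.sign σ : ℤˣ) : ℤ) • g (w ∘ σ) := by
    unfold asym
    rw [sum_fiberwise_of_maps_to]
    intro σ hσ
    rw [mem_fixS] at hσ
    by_contra hc
    have := hσ _ hc
    have h2 : σ (σ⁻¹ j) = j := by simp
    rw [h2] at this
    exact hc (this ▸ mem_insert_self _ _)
  rw [h1, sum_insert hj, sub_eq_add_neg, ← sum_neg_distrib]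
  congr 1
  · unfold asym
    apply sum_congr _ (fun _ _ => rfl)
    ext σ
    simp only [mem_filter, mem_fixS, mem_insert, not_or]
    constructor
    · rintro ⟨h, h'⟩ x hx
      by_cases hxj : x = j
      · subst hxj
        rw [Perm.inv_eq_iff_eq] at h'
        exact h'.symm
      · exact h x ⟨hxj, hx⟩
    · intro h
      refine ⟨fun x hx => h x hx.2, ?_⟩
      rw [Perm.inv_eq_iff_eq, h j hj]
  · apply sum_congr rfl
    intro k hk
    have hkj : j ≠ k := fun h => hj (h ▸ hk)
    unfold asym
    rw [← sum_neg_distrib]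
    refine sum_bij' (fun σ _ => swap j k * σ) (fun σ _ => swap j k * σ) ?_ ?_ ?_ ?_ ?_
    · intro σ hσ
      simp only [mem_filter, mem_fixS, mem_insert, not_or, mem_erase, not_and] at hσ ⊢
      obtain ⟨hσ, hσk⟩ := hσ
      rw [Perm.inv_eq_iff_eq] at hσk
      rintro x ⟨hx, hx'⟩
      by_cases hxk : x = k
      · subst hxk; simp [← hσk]
      · have hxS := hx' hxk
        simp [hσ x ⟨hx, hxS⟩, swap_apply_of_ne_of_ne hx hxk]
    · intro σ hσ
      simp only [mem_filter, mem_fixS, mem_insert, not_or, mem_erase, not_and] at hσ ⊢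
      refine ⟨?_, ?_⟩
      · rintro x ⟨hx, hxS⟩
        have hxk : x ≠ k := fun h => hxS (h ▸ hk)
        simp [hσ x ⟨hx, fun _ => hxS⟩, swap_apply_of_ne_of_ne hx hxk]
      · rw [Perm.inv_eq_iff_eq, Perm.mul_apply, hσ k ⟨hkj.symm, fun h => absurd rfl h⟩]
        simp
    · intro σ _; simp [← mul_assoc]
    · intro σ _; simp [← mul_assoc]
    · intro σ _
      rw [Perm.sign_mul, Perm.sign_swap hkj]
      have : (w ∘ swap j k) ∘ ⇑(swap j k * σ) = w ∘ σ := by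
        funext x; simp
      rw [this]; simp

lemma CS_insert (D : Module.End ℂ F) (K : Fin N → ℂ) (S : Finset J) (g : (J → Fin N) → F)
    (w : J → Fin N) {j : J} (hj : j ∉ S) :
    D (CS D K (insert j S) g w) - K (w j) • CS D K (insert j S) g w =
      CS D K S g w - ∑ k ∈ S, CS D K (insert j (S.erase k)) g (w ∘ swap j k) := by
  have hR : CS D K S g w - ∑ k ∈ S, CS D K (insert j (S.erase k)) g (w ∘ swap j k)
      = aeval D (chiS K S w) (asym (insert j S) g w) := by
    rw [asym_insert S g w hj, map_sub, map_sum]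
    unfold CS
    congr 1
    apply sum_congr rfl
    intro k hk
    congr 2
    unfold chiS
    have : (insert j (S.erase k)).image (w ∘ swap j k) = S.image w := by
      ext x
      simp only [mem_image]
      constructor
      · rintro ⟨y, hy, rfl⟩
        rcases mem_insert.1 hy with rfl | hy
        · exact ⟨k, hk, by simp⟩
        · refine ⟨y, mem_of_mem_erase hy, ?_⟩
          have h1 : y ≠ j := fun h => hj (h ▸ mem_of_mem_erase hy)
          simp [swap_apply_of_ne_of_ne h1 (ne_of_mem_erase hy)]
      · rintro ⟨y, hy, rfl⟩
        by_cases hyk : y = k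
        · subst hyk
          exact ⟨j, mem_insert_self _ _, by simp⟩
        · refine ⟨y, mem_insert_of_mem (mem_erase.2 ⟨hyk, hy⟩), ?_⟩
          have h1 : y ≠ j := fun h => hj (h ▸ hy)
          simp [swap_apply_of_ne_of_ne h1 hyk]
    rw [this]
  rw [hR]
  by_cases hinj : Set.InjOn w (insert j S : Finset J)
  · have hw : w j ∉ S.image w := by
      intro h
      obtain ⟨k, hk, hwk⟩ := mem_image.1 h
      have := hinj (by simp [hk]) (by simp) hwk
      exact hj (this ▸ hk)
    have : chiS K S w = (X - C (K (w j))) * chiS K (insert j S) w := by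
      unfold chiS
      rw [image_insert, ← prod_insert (s := (insert (w j) (S.image w))ᶜ) (a := w j)
        (f := fun b => (X - C (K b))) (by simp)]
      congr 1
      ext x
      simp only [mem_compl, mem_insert]
      by_cases hx : x = w j
      · subst hx; simp only [true_or, iff_true]; exact hw
      · tauto
    rw [this]
    simp [CS, Module.algebraMap_end_apply]
  · simp [CS, asym_zero _ g w hinj]

lemma powerset_reorg (s : Finset J) (f : J → Finset J → F) :
    ∑ k ∈ s, ∑ S ∈ (s.erase k).powerset, f k (insert k S) =
      ∑ T ∈ s.powerset, ∑ k ∈ T, f k T := by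
  rw [sum_sigma', sum_sigma']
  refine sum_bij' (fun p _ => ⟨insert p.1 p.2, p.1⟩) (fun p _ => ⟨p.2, p.1.erase p.2⟩)
    ?_ ?_ ?_ ?_ ?_
  · rintro ⟨k, S⟩ h
    simp only [mem_sigma, mem_powerset] at h ⊢
    refine ⟨insert_subset h.1 (h.2.trans (erase_subset _ _)), mem_insert_self _ _⟩
  · rintro ⟨T, k⟩ h
    simp only [mem_sigma, mem_powerset] at h ⊢
    exact ⟨h.1 h.2, erase_subset_erase _ h.1⟩
  · rintro ⟨k, S⟩ h
    simp only [mem_sigma, mem_powerset] at h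
    have : k ∉ S := fun hk => by simpa using h.2 hk
    simp [erase_insert this]
  · rintro ⟨T, k⟩ h
    simp only [mem_sigma, mem_powerset] at h
    simp [insert_erase h.2]
  · rintro ⟨k, S⟩ h; rfl

/-- signed weighted sum -/
def Aop (D : Module.End ℂ F) (K : Fin N → ℂ) (z : J → ℂ) (j : J) (g : (J → Fin N) → F)
    (w : J → Fin N) : F :=
  ∑ S ∈ (univ.erase j).powerset, ((-1 : ℂ) ^ S.card * rr z j S) • CS D K (insert j S) g w

lemma Aop_other (D : Module.End ℂ F) (K : Fin N → ℂ) (z : J → ℂ) (j k : J) (hkj : k ≠ j)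
    (g : (J → Fin N) → F) (w : J → Fin N) :
    Aop D K z k g w = ∑ S ∈ ((univ.erase j).erase k).powerset,
      (((-1 : ℂ) ^ S.card * rr z k S) • CS D K (insert k S) g w
       - ((-1 : ℂ) ^ S.card * ((z k - z j)⁻¹ * rr z k S)) • CS D K (insert j (insert k S)) g w) := by
  unfold Aop
  have h : (univ.erase k : Finset J) = insert j ((univ.erase j).erase k) := by
    ext x; simp; by_cases hx : x = j
    · subst hx; simp [hkj.symm]
    · simp [hx]
  have hj : j ∉ (univ.erase j : Finset J).erase k := by simp
  rw [h, sum_powerset_insert hj, sum_sub_distrib, sub_eq_add_neg, ← sum_neg_distrib]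
  congr 1
  apply sum_congr rfl
  intro S hS
  rw [mem_powerset] at hS
  have hjS : j ∉ S := fun hh => hj (hS hh)
  rw [card_insert_of_notMem hjS, rr_insert _ _ _ _ hjS, insert_comm k j S, ← neg_smul]
  congr 1
  ring

lemma Aop_eq (D : Module.End ℂ F) (K : Fin N → ℂ) (z : J → ℂ) (hz : Function.Injective z)
    (j : J) (g : (J → Fin N) → F) (w : J → Fin N) :
    D (Aop D K z j g w) - K (w j) • Aop D K z j g w
      - ∑ k ∈ univ.erase j, (z j - z k)⁻¹ • Aop D K z j g (w ∘ swap j k)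
    = CS D K ∅ g w - ∑ k ∈ univ.erase j, (z j - z k)⁻¹ • Aop D K z k g w := by
  set s : Finset J := univ.erase j with hs
  have hjs : ∀ T ∈ s.powerset, j ∉ T := fun T hT hj => by
    have := mem_powerset.1 hT hj; simp [hs] at this
  -- first part
  have h1 : D (Aop D K z j g w) - K (w j) • Aop D K z j g w =
      ∑ S ∈ s.powerset, ((-1 : ℂ) ^ S.card * rr z j S) • CS D K S g w
      - ∑ S ∈ s.powerset, ∑ k ∈ S, ((-1 : ℂ) ^ S.card * rr z j S) •
          CS D K (insert j (S.erase k)) g (w ∘ swap j k) := by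
    unfold Aop
    rw [map_sum, smul_sum, ← sum_sub_distrib, ← sum_sub_distrib]
    apply sum_congr rfl
    intro S hS
    rw [← smul_sum, ← smul_sub, ← CS_insert D K S g w (hjs S hS), map_smul, smul_sub,
      smul_comm (K (w j))]
  -- second part
  have h2 : ∑ k ∈ s, (z j - z k)⁻¹ • Aop D K z j g (w ∘ swap j k) =
      - (∑ S ∈ s.powerset, ∑ k ∈ S, ((-1 : ℂ) ^ S.card * rr z j S) •
          CS D K (insert j (S.erase k)) g (w ∘ swap j k))
      - ∑ S ∈ s.powerset, ∑ k ∈ S, ((z j - z k)⁻¹ * ((-1 : ℂ) ^ S.card * rr z j S)) •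
          CS D K (insert j S) g w := by
    rw [← powerset_reorg, ← powerset_reorg, ← sum_neg_distrib, ← sum_sub_distrib]
    apply sum_congr rfl
    intro k hk
    have hkj : k ≠ j := ne_of_mem_erase hk
    unfold Aop
    rw [← hs, ← insert_erase hk, sum_powerset_insert (notMem_erase _ _), insert_erase hk,
      smul_add, smul_sum, smul_sum, ← sum_neg_distrib, sub_eq_add_neg (∑ S ∈ (s.erase k).powerset, _),
      ← sum_neg_distrib]
    congr 1
    · apply sum_congr rfl
      intro S hS
      have hkS : k ∉ S := fun h => by simpa using mem_powerset.1 hS h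
      rw [erase_insert hkS, card_insert_of_notMem hkS, rr_insert _ _ _ _ hkS, ← neg_smul,
        smul_smul]
      congr 1; ring
    · apply sum_congr rfl
      intro S hS
      have hkS : k ∉ S := fun h => by simpa using mem_powerset.1 hS h
      rw [CS_swap D K (insert j (insert k S)) g w (by simp) (by simp) hkj.symm, smul_neg,
        smul_neg, smul_smul]
  have h3 : ∑ k ∈ s, (z j - z k)⁻¹ • Aop D K z k g w =
      - (∑ S ∈ s.powerset, ∑ k ∈ S, ((-1 : ℂ) ^ S.card * ((z j - z k)⁻¹ * rr z k (S.erase k))) •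
          CS D K S g w)
      - ∑ S ∈ s.powerset, ∑ k ∈ S,
        ((-1 : ℂ) ^ S.card * ((z j - z k)⁻¹ ^ 2 * rr z k (S.erase k))) •
          CS D K (insert j S) g w := by
    rw [← powerset_reorg, ← powerset_reorg, ← sum_neg_distrib, ← sum_sub_distrib]
    apply sum_congr rfl
    intro k hk
    have hkj : k ≠ j := ne_of_mem_erase hk
    rw [Aop_other D K z j k hkj, ← hs, sum_sub_distrib, smul_sub, smul_sum, smul_sum,
      ← sum_neg_distrib]
    congr 1
    · apply sum_congr rfl
      intro S hS
      have hkS : k ∉ S := fun h => by simpa using mem_powerset.1 hS h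
      rw [erase_insert hkS, card_insert_of_notMem hkS, ← neg_smul, smul_smul]
      congr 1; ring
    · apply sum_congr rfl
      intro S hS
      have hkS : k ∉ S := fun h => by simpa using mem_powerset.1 hS h
      rw [erase_insert hkS, card_insert_of_notMem hkS, smul_smul]
      congr 1
      have : (z k - z j)⁻¹ = - (z j - z k)⁻¹ := by rw [← inv_neg, neg_sub]
      rw [this]; ring
  have h4 : ∑ S ∈ s.powerset, ((-1 : ℂ) ^ S.card * rr z j S) • CS D K S g w =
      CS D K ∅ g w + ∑ S ∈ s.powerset, ∑ k ∈ S,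
        ((-1 : ℂ) ^ S.card * ((z j - z k)⁻¹ * rr z k (S.erase k))) • CS D K S g w := by
    rw [← add_sum_erase _ _ (empty_mem_powerset s)]
    conv_rhs => rw [← add_sum_erase _ _ (empty_mem_powerset s)]
    simp only [card_empty, pow_zero, one_mul, sum_empty, zero_add]
    congr 1
    · simp [rr]
    apply sum_congr rfl
    intro S hS
    rw [← sum_smul, ← mul_sum, pf1 z hz S (nonempty_of_ne_empty (ne_of_mem_erase hS)) j
      (hjs S (mem_of_mem_erase hS))]
  have h5 : ∑ S ∈ s.powerset, ∑ k ∈ S, ((z j - z k)⁻¹ * ((-1 : ℂ) ^ S.card * rr z j S)) •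
          CS D K (insert j S) g w = ∑ S ∈ s.powerset, ∑ k ∈ S,
        ((-1 : ℂ) ^ S.card * ((z j - z k)⁻¹ ^ 2 * rr z k (S.erase k))) •
          CS D K (insert j S) g w := by
    apply sum_congr rfl
    intro S hS
    rw [← sum_smul, ← sum_smul, ← mul_sum, pf2 z hz S j (hjs S hS), ← sum_mul]
    congr 1; ring
  rw [h1, h2, h3, h4, h5]
  abel

/-- The operator `∑_S (-1)^{|S|} P_S C_S`. -/
def Dt (D : Module.End ℂ F) (K : Fin N → ℂ) (P : Finset J → F →ₗ[ℂ] F)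
    (g : (J → Fin N) → F) (w : J → Fin N) : F :=
  ∑ S : Finset J, (-1 : ℂ) ^ S.card • P S (CS D K S g w)

variable {F' : Type*} [AddCommGroup F'] [Module ℂ F']

lemma aeval_intertwine (D : Module.End ℂ F) (D' : Module.End ℂ F') (Λ : F →ₗ[ℂ] F')
    (h : ∀ x, Λ (D x) = D' (Λ x)) (p : ℂ[X]) (x : F) :
    Λ (aeval D p x) = aeval D' p (Λ x) := by
  induction p using Polynomial.induction_on' with
  | add p q hp hq => simp [hp, hq]
  | monomial n c =>
    simp only [aeval_monomial, Module.End.mul_apply, Module.algebraMap_end_apply, map_smul]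
    congr 1
    induction n with
    | zero => simp
    | succ n ih => rw [pow_succ', pow_succ', Module.End.mul_apply, Module.End.mul_apply, h, ih]

lemma CS_nat (D : Module.End ℂ F) (D' : Module.End ℂ F') (Λ : F →ₗ[ℂ] F')
    (h : ∀ x, Λ (D x) = D' (Λ x)) (K : Fin N → ℂ) (S : Finset J) (g : (J → Fin N) → F)
    (w : J → Fin N) : CS D' K S (fun w => Λ (g w)) w = Λ (CS D K S g w) := by
  unfold CS
  rw [aeval_intertwine D D' Λ h]
  congr 1
  simp [asym, map_sum]

lemma Dt_nat (D : Module.End ℂ F) (D' : Module.End ℂ F') (Λ : F →ₗ[ℂ] F')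
    (h : ∀ x, Λ (D x) = D' (Λ x)) (K : Fin N → ℂ) (P : Finset J → F →ₗ[ℂ] F)
    (P' : Finset J → F' →ₗ[ℂ] F') (hP : ∀ S x, Λ (P S x) = P' S (Λ x))
    (g : (J → Fin N) → F) (w : J → Fin N) :
    Dt D' K P' (fun w => Λ (g w)) w = Λ (Dt D K P g w) := by
  unfold Dt
  rw [map_sum]
  apply sum_congr rfl
  intro S _
  rw [CS_nat D D' Λ h, map_smul, hP]

end PartA
end GaudinAux


namespace GaudinAux
open Finset Polynomial Equiv

section PartB

section Seq
variable {A : Type*} [CommRing A] [Algebra ℂ A]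

/-- shift: multiplication by `u` -/
def Ush (A : Type*) [CommRing A] : Module.End A (ℤ → A) where
  toFun f := fun s => f (s - 1)
  map_add' f g := rfl
  map_smul' c f := rfl

/-- `d/du + κ` -/
def dl (A : Type*) [CommRing A] [Algebra ℂ A] (κ : ℂ) : Module.End ℂ (ℤ → A) where
  toFun f := fun s => ((s : ℂ) + 1) • f (s + 1) + κ • f s
  map_add' f g := by funext s; simp; abel
  map_smul' c f := by
    funext s
    simp only [Pi.smul_apply, RingHom.id_apply, smul_add]
    rw [smul_comm c, smul_comm c]

@[simp] lemma Ush_apply (f : ℤ → A) (s : ℤ) : Ush A f s = f (s - 1) := rfl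
@[simp] lemma dl_apply (κ : ℂ) (f : ℤ → A) (s : ℤ) :
    dl A κ f s = ((s : ℂ) + 1) • f (s + 1) + κ • f s := rfl

def Sup {X : Type*} [Zero X] (f : ℤ → X) (B : ℤ) : Prop := ∀ s, B < s → f s = 0

lemma Sup.mono {X : Type*} [Zero X] {f : ℤ → X} {B B' : ℤ} (h : Sup f B) (hB : B ≤ B') :
    Sup f B' := fun s hs => h s (lt_of_le_of_lt hB hs)


lemma U_lead {J : Type*} [DecidableEq J] (T : Finset J) (z : J → A) (f : ℤ → A) (B : ℤ)
    (hf : Sup f B) :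
    Sup (aeval (Ush A) (∏ j ∈ T, (X - C (z j))) f) (B + T.card) ∧
      aeval (Ush A) (∏ j ∈ T, (X - C (z j))) f (B + T.card) = f B := by
  induction T using Finset.induction_on with
  | empty => simpa using hf
  | insert j T hj ih =>
    rw [prod_insert hj, map_mul, card_insert_of_notMem hj]
    simp only [Module.End.mul_apply, map_sub, aeval_X, aeval_C, LinearMap.sub_apply,
      Module.algebraMap_end_apply]
    set h := aeval (Ush A) (∏ j ∈ T, (X - C (z j))) f
    refine ⟨fun s hs => ?_, ?_⟩
    · push_cast at hs
      simp only [Pi.sub_apply, Ush_apply, Pi.smul_apply]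
      rw [ih.1 (s - 1) (by omega), ih.1 s (by omega)]; simp
    · push_cast
      simp only [Pi.sub_apply, Ush_apply, Pi.smul_apply]
      rw [ih.1 (B + (T.card + 1)) (by omega), ← ih.2]
      simp only [smul_zero, sub_zero]; congr 1; ring

lemma dl_lead (κ : ℂ) (p : ℂ[X]) (f : ℤ → A) (B : ℤ) (hf : Sup f B) :
    Sup (aeval (dl A κ) p f) B ∧ aeval (dl A κ) p f B = p.eval κ • f B := by
  induction p using Polynomial.induction_on' with
  | add p q hp hq =>
    simp only [map_add, LinearMap.add_apply, eval_add, add_smul, Pi.add_apply]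
    refine ⟨fun s hs => ?_, ?_⟩
    · simp [hp.1 s hs, hq.1 s hs]
    · rw [hp.2, hq.2]
  | monomial n c =>
    simp only [aeval_monomial, Module.End.mul_apply, Module.algebraMap_end_apply, eval_monomial]
    have : Sup ((dl A κ ^ n) f) B ∧ (dl A κ ^ n) f B = κ ^ n • f B := by
      induction n with
      | zero => simpa using hf
      | succ n ih =>
        rw [pow_succ', Module.End.mul_apply]
        refine ⟨fun s hs => ?_, ?_⟩
        · simp [ih.1 s hs, ih.1 (s + 1) (by omega)]
        · simp [ih.1 (B + 1) (by omega), ih.2, pow_succ', mul_smul]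
    refine ⟨fun s hs => ?_, ?_⟩
    · simp [this.1 s hs]
    · simp [this.2, mul_smul]

end Seq

section Rec
variable {X : Type*} [AddCommGroup X] [Module ℂ X]

/-- successive approximations -/
def rseq (O : (ℤ → X) → ℤ → X) (e : ℤ) (m : ℤ) (c : ℂ) (v0 : X) : ℕ → ℤ → X
  | 0 => Pi.single m v0
  | k + 1 => rseq O e m c v0 k + Pi.single (m - k - 1)
      ((c * (((m - k - 1 : ℤ) : ℂ) - m))⁻¹ • (- O (rseq O e m c v0 k) (m - k - 1 + e)))

lemma rec_exists (Xm : Submodule ℂ X) (O : (ℤ → X) → ℤ → X)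
    (hadd : ∀ f g, O (f + g) = O f + O g) (e m : ℤ) (c : ℂ) (hc : c ≠ 0)
    (hval : ∀ f, (∀ s, f s ∈ Xm) → ∀ s, O f s ∈ Xm)
    (hsup : ∀ f B, (∀ s, f s ∈ Xm) → Sup f B → Sup (O f) (B + e) ∧
      O f (B + e) = (c * ((B : ℂ) - m)) • f B)
    (v0 : X) (hv0 : v0 ∈ Xm) :
    ∃ f : ℤ → X, (∀ s, f s ∈ Xm) ∧ Sup f m ∧ f m = v0 ∧ O f = 0 := by
  set q := rseq O e m c v0 with hq
  have hq0 : q 0 = Pi.single m v0 := rfl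
  have hqs : ∀ k, q (k + 1) = q k + Pi.single (m - k - 1)
      ((c * (((m - k - 1 : ℤ) : ℂ) - m))⁻¹ • (- O (q k) (m - k - 1 + e))) := fun k => rfl
  have hsingle : ∀ (B : ℤ) (x : X), x ∈ Xm → ∀ s, (Pi.single B x : ℤ → X) s ∈ Xm := by
    intro B x hx s
    by_cases h : s = B
    · subst h; simpa
    · rw [Pi.single_eq_of_ne h]; exact Xm.zero_mem
  have hsingleS : ∀ (B : ℤ) (x : X), Sup (Pi.single B x : ℤ → X) B := by
    intro B x s hs
    rw [Pi.single_eq_of_ne (ne_of_gt hs)]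
  have hqm : ∀ k, ∀ s, q k s ∈ Xm := by
    intro k
    induction k with
    | zero => rw [hq0]; exact hsingle _ _ hv0
    | succ k ih =>
      intro s
      rw [hqs]
      exact Xm.add_mem (ih s) (hsingle _ _ (Xm.smul_mem _ (Xm.neg_mem (hval _ ih _))) s)
  have hqO : ∀ k : ℕ, Sup (O (q k)) (m + e - k - 1) := by
    intro k
    induction k with
    | zero =>
      intro s hs
      have h := hsup (q 0) m (hqm 0) (by rw [hq0]; exact hsingleS _ _)
      by_cases hs' : s = m + e
      · rw [hs', h.2]; simp
      · push_cast at hs; exact h.1 s (by omega)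
    | succ k ih =>
      intro s hs
      push_cast at hs
      rw [hqs, hadd]
      have hx := Xm.smul_mem (c * (((m - k - 1 : ℤ) : ℂ) - m))⁻¹
        (Xm.neg_mem (hval _ (hqm k) (m - k - 1 + e)))
      have h := hsup _ (m - k - 1) (hsingle (m - k - 1) _ hx) (hsingleS _ _)
      by_cases hs' : s = m - k - 1 + e
      · rw [hs', Pi.add_apply, h.2, Pi.single_eq_same, smul_smul, mul_inv_cancel₀, one_smul,
          add_neg_cancel]
        apply mul_ne_zero hc
        push_cast
        have : ((m : ℂ) - k - 1 - m) = -((k + 1 : ℕ) : ℂ) := by push_cast; ring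
        rw [this]
        exact neg_ne_zero.2 (Nat.cast_ne_zero.2 (Nat.succ_ne_zero k))
      · rw [Pi.add_apply, ih s (by omega), h.1 s (by omega), add_zero]
  have hstab1 : ∀ k : ℕ, ∀ s : ℤ, m - k ≤ s → q (k + 1) s = q k s := by
    intro k s hs
    rw [hqs, Pi.add_apply, Pi.single_eq_of_ne (by omega), add_zero]
  have hstab : ∀ (k l : ℕ) (s : ℤ), m - k ≤ s → q (k + l) s = q k s := by
    intro k l s hs
    induction l with
    | zero => rfl
    | succ l ih => rw [← ih, ← add_assoc]; apply hstab1; push_cast; omega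
  set f : ℤ → X := fun s => q (m - s).toNat s with hf
  have hfq : ∀ (k : ℕ) (s : ℤ), m - k ≤ s → f s = q k s := by
    intro k s hs
    have hle : (m - s).toNat ≤ k := by omega
    obtain ⟨l, rfl⟩ := Nat.exists_eq_add_of_le hle
    rw [hf]
    exact (hstab _ l s (by omega)).symm
  have hfm : ∀ s, f s ∈ Xm := fun s => hqm _ s
  refine ⟨f, hfm, ?_, ?_, ?_⟩
  · intro s hs
    rw [hfq 0 s (by push_cast; omega), hq0]
    exact hsingleS _ _ s hs
  · rw [hfq 0 m (by simp), hq0]; simp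
  · funext s
    obtain ⟨k, hk⟩ : ∃ k : ℕ, m + e - k - 1 < s := ⟨(m + e - s).toNat, by omega⟩
    have hd : f = q k + (f - q k) := by abel
    have h1 : Sup (f - q k) (m - k - 1) := by
      intro t ht
      rw [Pi.sub_apply, hfq k t (by omega), sub_self]
    have h2 := (hsup (f - q k) _ (fun t => Xm.sub_mem (hfm t) (hqm k t)) h1).1
    rw [hd, hadd, Pi.add_apply, hqO k s hk, h2 s (by omega)]
    simp

end Rec

section Rec2
variable {A : Type*} [CommRing A] [Algebra ℂ A]
variable {N : ℕ} {J : Type*} [Fintype J] [DecidableEq J]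

/-- product of the `u - z_j` outside `S` -/
def PS (z : J → A) (S : Finset J) : (ℤ → A) →ₗ[ℂ] (ℤ → A) :=
  (aeval (Ush A) (∏ j ∈ Sᶜ, (X - C (z j)))).restrictScalars ℂ

lemma PS_apply (z : J → A) (S : Finset J) (f : ℤ → A) :
    PS z S f = aeval (Ush A) (∏ j ∈ Sᶜ, (X - C (z j))) f := rfl

/-- number of occurrences of a letter -/
def cont (w : J → Fin N) (b : Fin N) : ℕ := (univ.filter (fun j => w j = b)).card

lemma cont_comp (w : J → Fin N) (σ : Perm J) : cont (w ∘ σ) = cont w := by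
  funext b
  unfold cont
  apply card_bij (fun j _ => σ j)
  · intro j hj; simpa using hj
  · intro j _ k _ h; exact σ.injective h
  · intro k hk; exact ⟨σ⁻¹ k, by simpa using hk, by simp⟩

lemma asym_cont {F : Type*} [AddCommGroup F] [Module ℂ F] (S : Finset J) (m : Fin N → ℕ)
    (g : (J → Fin N) → F) (hg : ∀ w, cont w ≠ m → g w = 0) (w : J → Fin N)
    (hw : cont w ≠ m) : asym S g w = 0 := by
  unfold asym
  apply sum_eq_zero
  intro σ _
  rw [hg _ (by rwa [cont_comp]), smul_zero]

lemma fixS_empty : fixS (∅ : Finset J) = {1} := by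
  ext σ; simp [mem_fixS, Perm.ext_iff]

lemma asym_empty {F : Type*} [AddCommGroup F] [Module ℂ F] (g : (J → Fin N) → F)
    (w : J → Fin N) : asym ∅ g w = g w := by
  simp [asym, fixS_empty]

lemma fixS_singleton (j : J) : fixS ({j} : Finset J) = {1} := by
  ext σ
  simp only [mem_fixS, mem_singleton, Perm.ext_iff, Perm.one_apply]
  refine ⟨fun h x => ?_, fun h x _ => h x⟩
  by_cases hx : x = j
  · subst hx
    by_contra hc
    have := h _ hc
    exact hc (σ.injective this)
  · exact h x hx

lemma asym_singleton {F : Type*} [AddCommGroup F] [Module ℂ F] (j : J) (g : (J → Fin N) → F)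
    (w : J → Fin N) : asym {j} g w = g w := by
  simp [asym, fixS_singleton]

lemma asym_sup (S : Finset J) (g : (J → Fin N) → ℤ → A) (B : ℤ) (hg : ∀ w, Sup (g w) B)
    (w : J → Fin N) : Sup (asym S g w) B := by
  intro s hs
  simp only [asym, Finset.sum_apply, Pi.smul_apply]
  apply sum_eq_zero
  intro σ _
  rw [hg _ s hs, smul_zero]

lemma Dt_lead (K : Fin N → ℂ) (z : J → A) (i : Fin N) (m : Fin N → ℕ)
    (g : (J → Fin N) → ℤ → A) (hm : ∀ w, cont w ≠ m → g w = 0) (B : ℤ)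
    (hg : ∀ w, Sup (g w) B) (w : J → Fin N) :
    Sup (Dt (dl A (K i)) K (PS z) g w) (B + ((Fintype.card J : ℤ) - 1)) ∧
    Dt (dl A (K i)) K (PS z) g w (B + ((Fintype.card J : ℤ) - 1)) =
      ((∏ b ∈ univ.erase i, (K i - K b)) * ((B : ℂ) - ((m i : ℕ) : ℤ))) • g w B := by
  set c : ℂ := ∏ b ∈ univ.erase i, (K i - K b) with hc
  set n := Fintype.card J with hn
  -- empty set
  have h0 : Sup (CS (dl A (K i)) K ∅ g w) (B - 1) ∧
      CS (dl A (K i)) K ∅ g w (B - 1) = (c * B) • g w B := by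
    have hchi : chiS K ∅ w = (X - C (K i)) * ∏ b ∈ univ.erase i, (X - C (K b)) := by
      simp only [chiS, image_empty, compl_empty]
      rw [mul_prod_erase _ (fun b => X - C (K b)) (mem_univ i)]
    unfold CS
    rw [hchi, asym_empty, map_mul, Module.End.mul_apply]
    have h1 := dl_lead (K i) (∏ b ∈ univ.erase i, (X - C (K b))) (g w) B (hg w)
    rw [eval_prod] at h1
    simp only [eval_sub, eval_X, eval_C] at h1
    rw [← hc] at h1
    set h := aeval (dl A (K i)) (∏ b ∈ univ.erase i, (X - C (K b))) (g w)
    have h2 : ∀ s, (aeval (dl A (K i)) (X - C (K i))) h s = ((s : ℂ) + 1) • h (s + 1) := by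
      intro s
      simp [Module.algebraMap_end_apply]
    refine ⟨fun s hs => ?_, ?_⟩
    · rw [h2, h1.1 (s + 1) (by omega), smul_zero]
    · rw [h2, sub_add_cancel, h1.2, smul_smul]
      congr 1; push_cast; ring
  have hsupS : ∀ S : Finset J, Sup (PS z S (CS (dl A (K i)) K S g w)) (B + (Sᶜ).card) := by
    intro S
    exact (U_lead Sᶜ z _ B (dl_lead (K i) _ _ B (asym_sup S g B hg w)).1).1
  have h1 : ∀ j : J, PS z {j} (CS (dl A (K i)) K {j} g w) (B + ((n : ℤ) - 1)) =
      if w j = i then c • g w B else 0 := by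
    intro j
    have hcard : ((({j} : Finset J)ᶜ).card : ℤ) = (n : ℤ) - 1 := by
      rw [card_compl, card_singleton]
      have : 0 < Fintype.card J := Fintype.card_pos_iff.2 ⟨j⟩
      omega
    have h1 := dl_lead (K i) (chiS K {j} w) (asym {j} g w) B (asym_sup _ g B hg w)
    have h2 := (U_lead ({j} : Finset J)ᶜ z _ B h1.1).2
    rw [hcard] at h2
    rw [PS_apply]
    unfold CS
    rw [h2, h1.2, asym_singleton]
    split_ifs with hw
    · congr 1
      simp only [chiS, image_singleton, hw, eval_prod, eval_sub, eval_X, eval_C, hc]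
      congr 1
      ext x; simp
    · have : eval (K i) (chiS K {j} w) = 0 := by
        simp only [chiS, image_singleton, eval_prod, eval_sub, eval_X, eval_C]
        apply prod_eq_zero (i := i) (by simp [Ne.symm hw]) (by simp)
      rw [this, zero_smul]
  have hbig : ∀ S : Finset J, 2 ≤ S.card → ∀ s, B + ((n : ℤ) - 1) ≤ s →
      PS z S (CS (dl A (K i)) K S g w) s = 0 := by
    intro S hS s hs
    apply hsupS S
    rw [card_compl]
    have := card_le_univ S
    omega
  have h00 := U_lead (univ : Finset J) z _ (B - 1) h0.1
  have hzero : ∀ s, B + ((n : ℤ) - 1) ≤ s → PS z ∅ (CS (dl A (K i)) K ∅ g w) s =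
      if s = B + ((n : ℤ) - 1) then (c * B) • g w B else 0 := by
    intro s hs
    rw [PS_apply, compl_empty]
    split_ifs with h
    · have : s = B - 1 + (univ : Finset J).card := by rw [card_univ]; omega
      rw [this, h00.2, h0.2]
    · apply h00.1; rw [card_univ]; omega
  have hformula : ∀ s, B + ((n : ℤ) - 1) ≤ s → Dt (dl A (K i)) K (PS z) g w s =
      (if s = B + ((n : ℤ) - 1) then (c * B) • g w B else 0) -
        ∑ j : J, PS z {j} (CS (dl A (K i)) K {j} g w) s := by
    intro s hs
    unfold Dt
    rw [Finset.sum_apply, ← hzero s hs]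
    have hne : ∀ j : J, (∅ : Finset J) ≠ {j} := fun j => (singleton_ne_empty j).symm
    have hsub : (∑ S : Finset J, ((-1 : ℂ) ^ S.card • PS z S (CS (dl A (K i)) K S g w)) s) =
        ∑ S ∈ insert ∅ (univ.image (fun j : J => ({j} : Finset J))),
          ((-1 : ℂ) ^ S.card • PS z S (CS (dl A (K i)) K S g w)) s := by
      symm
      apply sum_subset (subset_univ _)
      intro S _ hS
      rw [Pi.smul_apply, hbig S _ s hs, smul_zero]
      by_contra hlt
      push Not at hlt
      apply hS
      rcases Nat.lt_succ_iff_lt_or_eq.1 hlt with h | h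
      · have : S = ∅ := by rw [← card_eq_zero]; omega
        simp [this]
      · obtain ⟨j, rfl⟩ := card_eq_one.1 h
        simp
    rw [hsub, sum_insert (by simp), sum_image (fun x _ y _ h => singleton_injective h)]
    simp [sub_eq_add_neg]
  refine ⟨fun s hs => ?_, ?_⟩
  · rw [hformula s hs.le, if_neg (by omega), zero_sub, neg_eq_zero]
    apply sum_eq_zero
    intro j _
    apply hsupS {j}
    rw [card_compl, card_singleton]
    have : 0 < Fintype.card J := Fintype.card_pos_iff.2 ⟨j⟩
    omega
  · rw [hformula _ le_rfl, if_pos rfl, sum_congr rfl (fun j _ => h1 j), ← sum_filter, sum_const]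
    by_cases hw : cont w = m
    · have : (univ.filter (fun j => w j = i)).card = m i := by rw [← hw]; rfl
      rw [this, ← Nat.cast_smul_eq_nsmul ℂ, smul_smul, ← sub_smul]
      congr 1; push_cast; ring
    · rw [hm w hw]; simp

lemma Dt_add {F : Type*} [AddCommGroup F] [Module ℂ F] (D : Module.End ℂ F) (K : Fin N → ℂ)
    (P : Finset J → F →ₗ[ℂ] F) (f g : (J → Fin N) → F) (w : J → Fin N) :
    Dt D K P (f + g) w = Dt D K P f w + Dt D K P g w := by
  simp [Dt, CS, asym, sum_add_distrib]

lemma Dt_cont {F : Type*} [AddCommGroup F] [Module ℂ F] (D : Module.End ℂ F) (K : Fin N → ℂ)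
    (P : Finset J → F →ₗ[ℂ] F) (m : Fin N → ℕ)
    (g : (J → Fin N) → F) (hg : ∀ w, cont w ≠ m → g w = 0) (w : J → Fin N)
    (hw : cont w ≠ m) : Dt D K P g w = 0 := by
  simp [Dt, CS, asym_cont _ m g hg w hw]

lemma Dt_rec (K : Fin N → ℂ) (hK : ∀ i j, i ≠ j → K i ≠ K j) (z : J → A) (i : Fin N)
    (m : Fin N → ℕ) (v0 : (J → Fin N) → A) (hv0 : ∀ w, cont w ≠ m → v0 w = 0) :
    ∃ g : (J → Fin N) → ℤ → A, (∀ w, cont w ≠ m → g w = 0) ∧ (∀ w, Sup (g w) (m i)) ∧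
      (∀ w, g w (m i) = v0 w) ∧ ∀ w, Dt (dl A (K i)) K (PS z) g w = 0 := by
  let Xm : Submodule ℂ ((J → Fin N) → A) :=
    { carrier := {v | ∀ w, cont w ≠ m → v w = 0}
      add_mem' := by
        intro a b ha hb w hw
        simp [ha w hw, hb w hw]
      zero_mem' := by intro w _; rfl
      smul_mem' := by
        intro c x hx w hw
        simp [hx w hw] }
  have hmem : ∀ v, v ∈ Xm ↔ ∀ w, cont w ≠ m → v w = 0 := fun v => Iff.rfl
  obtain ⟨f, hf1, hf2, hf3, hf4⟩ := rec_exists Xm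
    (fun f s w => Dt (dl A (K i)) K (PS z) (fun w s => f s w) w s)
    (by
      intro f g
      funext s w
      have := Dt_add (dl A (K i)) K (PS z) (fun w s => f s w) (fun w s => g s w) w
      exact congrFun this s)
    ((Fintype.card J : ℤ) - 1) (m i) (∏ b ∈ univ.erase i, (K i - K b))
    (by
      rw [prod_ne_zero_iff]
      intro b hb
      exact sub_ne_zero.2 (hK _ _ (ne_of_mem_erase hb).symm))
    (by
      intro f hf s w hw
      have := Dt_cont (dl A (K i)) K (PS z) m (fun w s => f s w)
        (fun w hw => by funext s; exact hf s w hw) w hw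
      exact congrFun this s)
    (by
      intro f B hf hB
      have := Dt_lead K z i m (fun w s => f s w)
        (fun w hw => by funext s; exact hf s w hw) B (fun w s hs => congrFun (hB s hs) w)
      refine ⟨fun s hs => ?_, ?_⟩
      · funext w; exact (this w).1 s hs
      · funext w; exact (this w).2)
    v0 hv0
  refine ⟨fun w s => f s w, fun w hw => by funext s; exact hf1 s w hw,
    fun w s hs => congrFun (hf2 s hs) w, fun w => congrFun hf3 w, fun w => ?_⟩
  funext s
  exact congrFun (congrFun hf4 s) w

end Rec2

end PartB
end GaudinAux


namespace GaudinAux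
open Finset Polynomial Equiv

section PartB2

lemma stab_zero {Y : Type*} [AddCommGroup Y] [Module ℂ Y] [FiniteDimensional ℂ Y]
    (R : Module.End ℂ Y) (η : ℤ → Y) (h : ∀ s : ℤ, R (η s) = ((s : ℂ) + 1) • η (s + 1)) :
    ∀ s : ℤ, s < 0 → η s = 0 := by
  obtain ⟨n, hn⟩ := Filter.eventually_atTop.1 (Module.End.eventually_disjoint_ker_pow_range_pow R)
  have hpow : ∀ (k : ℕ) (t : ℤ), t < 0 → ∃ c : ℂ, c ≠ 0 ∧ (R ^ k) (η (t - k)) = c • η t := by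
    intro k
    induction k with
    | zero => intro t ht; exact ⟨1, one_ne_zero, by simp⟩
    | succ k ih =>
      intro t ht
      obtain ⟨c, hc, hk⟩ := ih t ht
      refine ⟨((t : ℂ) - k) * c, mul_ne_zero ?_ hc, ?_⟩
      · have : ((t : ℂ) - k) = ((t - k : ℤ) : ℂ) := by push_cast; ring
        rw [this]
        exact Int.cast_ne_zero.2 (by omega)
      · rw [pow_succ, Module.End.mul_apply, h]
        have : t - ((k + 1 : ℕ) : ℤ) + 1 = t - k := by push_cast; ring
        rw [this, map_smul, hk, smul_smul]
        congr 1; push_cast; ring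
  have key : ∀ k : ℕ, η (-1 - k) = 0 := by
    intro k
    induction k with
    | zero =>
      have hker : R (η (-1)) = 0 := by rw [h]; simp
      obtain ⟨c, hc, hk⟩ := hpow (n + 1) (-1) (by norm_num)
      have := (Submodule.disjoint_def.1 (hn (n + 1) (by omega))) (c • η (-1))
        (by rw [LinearMap.mem_ker, map_smul, pow_succ, Module.End.mul_apply, hker]; simp)
        ⟨_, hk⟩
      simpa [hc] using this
    | succ k ih =>
      have hker : R (η (-1 - (k + 1 : ℕ))) = 0 := by
        rw [h]
        have : (-1 - ((k + 1 : ℕ) : ℤ) + 1) = -1 - k := by push_cast; ring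
        rw [this, ih, smul_zero]
      obtain ⟨c, hc, hk⟩ := hpow (n + 1) (-1 - (k + 1 : ℕ)) (by omega)
      have := (Submodule.disjoint_def.1 (hn (n + 1) (by omega))) (c • η (-1 - (k + 1 : ℕ)))
        (by rw [LinearMap.mem_ker, map_smul, pow_succ, Module.End.mul_apply, hker]; simp)
        ⟨_, hk⟩
      simpa [hc] using this
  intro s hs
  have := key (-1 - s).toNat
  rwa [show (-1 - ((-1 - s).toNat : ℤ)) = s by omega] at this

/-- bounded above sequences -/
def BA : Submodule ℂ (ℤ → ℂ) where
  carrier := {f | ∃ B, Sup f B}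
  add_mem' := by
    rintro f g ⟨B, hB⟩ ⟨B', hB'⟩
    refine ⟨max B B', fun s hs => ?_⟩
    rw [Pi.add_apply, hB s (lt_of_le_of_lt (le_max_left _ _) hs),
      hB' s (lt_of_le_of_lt (le_max_right _ _) hs), add_zero]
  zero_mem' := ⟨0, fun _ _ => rfl⟩
  smul_mem' := by
    rintro c f ⟨B, hB⟩
    exact ⟨B, fun s hs => by rw [Pi.smul_apply, hB s hs, smul_zero]⟩

lemma BA_inj (z : ℂ) (f : ℤ → ℂ) (hf : f ∈ BA) (h : Ush ℂ f - z • f = 0) : f = 0 := by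
  obtain ⟨B, hB⟩ := hf
  have hs : ∀ s, f (s - 1) = z * f s := by
    intro s
    have := congrFun h s
    simp only [Pi.sub_apply, Ush_apply, Pi.smul_apply, Pi.zero_apply, smul_eq_mul] at this
    exact sub_eq_zero.1 this
  have key : ∀ k : ℕ, f (B + 1 - k) = 0 := by
    intro k
    induction k with
    | zero => exact hB _ (by simp)
    | succ k ih =>
      have := hs (B + 1 - k)
      rw [ih, mul_zero] at this
      rw [← this]; congr 1; push_cast; ring
  funext s
  by_cases hs' : B < s
  · exact hB s hs'
  · have := key (B + 1 - s).toNat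
    rwa [show (B + 1 - ((B + 1 - s).toNat : ℤ)) = s by omega] at this

lemma BA_surj (z : ℂ) (g : ℤ → ℂ) (hg : g ∈ BA) : ∃ f ∈ BA, Ush ℂ f - z • f = g := by
  obtain ⟨B, hB⟩ := hg
  let q : ℕ → ℂ := fun k => Nat.rec (motive := fun _ => ℂ) 0 (fun k x => g (B - k) + z * x) k
  have hq0 : q 0 = 0 := rfl
  have hqs : ∀ k, q (k + 1) = g (B - k) + z * q k := fun k => rfl
  refine ⟨fun s => q (B - s).toNat, ⟨B, fun s hs => ?_⟩, ?_⟩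
  · have : (B - s).toNat = 0 := by omega
    simp only [this, hq0]
  · funext s
    simp only [Pi.sub_apply, Ush_apply, Pi.smul_apply, smul_eq_mul]
    by_cases hs : B < s
    · have h1 : (B - (s - 1)).toNat = 0 := by omega
      have h2 : (B - s).toNat = 0 := by omega
      rw [h1, h2, hq0, hB s hs]; simp
    · have h1 : (B - (s - 1)).toNat = (B - s).toNat + 1 := by omega
      rw [h1, hqs]
      have h2 : B - ((B - s).toNat : ℤ) = s := by omega
      rw [h2]; ring

lemma BA_U (f : ℤ → ℂ) (hf : f ∈ BA) : Ush ℂ f ∈ BA := by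
  obtain ⟨B, hB⟩ := hf
  exact ⟨B + 1, fun s hs => hB (s - 1) (by omega)⟩

lemma BA_dl (κ : ℂ) (f : ℤ → ℂ) (hf : f ∈ BA) : dl ℂ κ f ∈ BA := by
  obtain ⟨B, hB⟩ := hf
  exact ⟨B, fun s hs => by simp [hB s hs, hB (s + 1) (by omega)]⟩

lemma aeval_mem {F : Type*} [AddCommGroup F] [Module ℂ F] (D : Module.End ℂ F)
    (L : Submodule ℂ F) (h : ∀ x ∈ L, D x ∈ L) (p : ℂ[X]) (x : F) (hx : x ∈ L) :
    aeval D p x ∈ L := by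
  induction p using Polynomial.induction_on' with
  | add p q hp hq => rw [map_add]; exact L.add_mem hp hq
  | monomial n c =>
    simp only [aeval_monomial, Module.End.mul_apply, Module.algebraMap_end_apply]
    apply L.smul_mem
    induction n with
    | zero => simpa
    | succ n ih => rw [pow_succ', Module.End.mul_apply]; exact h _ ih

lemma aeval_prod_inj {F I : Type*} [DecidableEq I] [AddCommGroup F] [Module ℂ F]
    (D : Module.End ℂ F) (L : Submodule ℂ F) (h : ∀ x ∈ L, D x ∈ L) (K : I → ℂ)
    (hinj : ∀ b, ∀ x ∈ L, D x - K b • x = 0 → x = 0) (T : Finset I) :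
    ∀ x ∈ L, aeval D (∏ b ∈ T, (X - C (K b))) x = 0 → x = 0 := by
  induction T using Finset.induction_on with
  | empty => intro x _ hx; simpa using hx
  | insert b T hb ih =>
    intro x hx h0
    apply ih x hx
    rw [prod_insert hb, map_mul, Module.End.mul_apply] at h0
    apply hinj b _ (aeval_mem D L h _ x hx)
    simpa [Module.algebraMap_end_apply] using h0

variable {N : ℕ} {J : Type*} [Fintype J] [DecidableEq J]

lemma asym_mem {F : Type*} [AddCommGroup F] [Module ℂ F] (L : Submodule ℂ F) (S : Finset J)
    (g : (J → Fin N) → F) (hg : ∀ w, g w ∈ L) (w : J → Fin N) : asym S g w ∈ L := by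
  unfold asym
  apply L.sum_mem
  intro σ _
  rw [← Int.cast_smul_eq_zsmul ℂ]
  exact L.smul_mem _ (hg _)

lemma CS_mem {F : Type*} [AddCommGroup F] [Module ℂ F] (L : Submodule ℂ F)
    (D : Module.End ℂ F) (hD : ∀ x ∈ L, D x ∈ L) (K : Fin N → ℂ) (S : Finset J)
    (g : (J → Fin N) → F) (hg : ∀ w, g w ∈ L) (w : J → Fin N) : CS D K S g w ∈ L :=
  aeval_mem D L hD _ _ (asym_mem L S g hg w)

lemma lag (z : J → ℂ) (hz : Function.Injective z) (T : Finset J) (hT : T.Nonempty) :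
    ∑ j ∈ T, C (rr z j (T.erase j)) * ∏ k ∈ T.erase j, (X - C (z k)) = 1 := by
  rw [← Lagrange.sum_basis (s := T) (v := z) hz.injOn hT]
  apply sum_congr rfl
  intro j _
  unfold Lagrange.basis Lagrange.basisDivisor rr
  rw [prod_mul_distrib, map_prod]

lemma dl_U (κ : ℂ) (f : ℤ → ℂ) : dl ℂ κ (Ush ℂ f) = Ush ℂ (dl ℂ κ f) + f := by
  funext s
  simp only [dl_apply, Ush_apply, Pi.add_apply, smul_eq_mul]
  rw [show s + 1 - 1 = s by ring, show s - 1 + 1 = s by ring]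
  push_cast; ring

lemma CS_empty {F : Type*} [AddCommGroup F] [Module ℂ F] (D : Module.End ℂ F) (K : Fin N → ℂ)
    (g : (J → Fin N) → F) (w : J → Fin N) :
    CS D K ∅ g w = aeval D (∏ b, (X - C (K b))) (g w) := by
  unfold CS
  rw [asym_empty]
  simp [chiS]

lemma sum_eta (K : Fin N → ℂ) (z : J → ℂ) (hz : Function.Injective z) (i : Fin N)
    (g : (J → Fin N) → ℤ → ℂ)
    (η : J → (J → Fin N) → ℤ → ℂ)
    (hη : ∀ j w, Ush ℂ (η j w) - z j • η j w = Aop (dl ℂ (K i)) K z j g w)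
    (w : J → Fin N) :
    aeval (Ush ℂ) (∏ j, (X - C (z j))) (CS (dl ℂ (K i)) K ∅ g w - ∑ j, η j w)
      = Dt (dl ℂ (K i)) K (PS z) g w := by
  have h1 : ∀ j, aeval (Ush ℂ) (∏ j, (X - C (z j))) (η j w) =
      ∑ S ∈ (univ.erase j).powerset, aeval (Ush ℂ) (∏ k ∈ univ.erase j, (X - C (z k)))
        (((-1 : ℂ) ^ S.card * rr z j S) • CS (dl ℂ (K i)) K (insert j S) g w) := by
    intro j
    rw [← map_sum]
    have : ∑ S ∈ (univ.erase j).powerset,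
        ((-1 : ℂ) ^ S.card * rr z j S) • CS (dl ℂ (K i)) K (insert j S) g w
          = Aop (dl ℂ (K i)) K z j g w := rfl
    rw [this, ← hη, ← mul_prod_erase univ (fun j => X - C (z j)) (mem_univ j), mul_comm, map_mul,
      Module.End.mul_apply]
    congr 1
    simp [Module.algebraMap_end_apply]
  have h2 : ∑ j, aeval (Ush ℂ) (∏ j, (X - C (z j))) (η j w) =
      ∑ T ∈ (univ : Finset J).powerset, ∑ j ∈ T,
        aeval (Ush ℂ) (∏ k ∈ univ.erase j, (X - C (z k)))
        ((-((-1 : ℂ) ^ T.card) * rr z j (T.erase j)) • CS (dl ℂ (K i)) K T g w) := by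
    rw [← powerset_reorg]
    apply sum_congr rfl
    intro j _
    rw [h1]
    apply sum_congr rfl
    intro S hS
    have hj : j ∉ S := fun h => by simpa using mem_powerset.1 hS h
    rw [erase_insert hj, card_insert_of_notMem hj]
    congr 3; ring
  rw [map_sub, map_sum, h2]
  unfold Dt
  rw [powerset_univ, ← add_sum_erase _ _ (mem_univ (∅ : Finset J))]
  conv_rhs => rw [← add_sum_erase _ _ (mem_univ (∅ : Finset J))]
  rw [sum_empty, zero_add, sub_eq_add_neg, ← sum_neg_distrib]
  congr 1
  · simp [PS_apply]
  · apply sum_congr rfl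
    intro T hT
    have hTne : T.Nonempty := nonempty_of_ne_empty (ne_of_mem_erase hT)
    rw [PS_apply]
    set x := CS (dl ℂ (K i)) K T g w
    have h3 : ∀ j ∈ T, aeval (Ush ℂ) (∏ k ∈ univ.erase j, (X - C (z k)))
        ((-((-1 : ℂ) ^ T.card) * rr z j (T.erase j)) • x) =
        - ((-1 : ℂ) ^ T.card • aeval (Ush ℂ) (∏ k ∈ Tᶜ, (X - C (z k)))
          (aeval (Ush ℂ) (C (rr z j (T.erase j)) * ∏ k ∈ T.erase j, (X - C (z k))) x)) := by
      intro j hj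
      have : (univ.erase j : Finset J) = Tᶜ ∪ T.erase j := by
        ext k; simp only [mem_erase, mem_univ, and_true, mem_union, mem_compl]
        by_cases hk : k = j
        · subst hk; simp [hj]
        · simp only [hk, not_false_eq_true, true_and, true_iff, ne_eq]; tauto
      rw [this, prod_union, map_mul, map_mul, Module.End.mul_apply, Module.End.mul_apply, map_smul,
        map_smul, aeval_C, Module.algebraMap_end_apply, map_smul, mul_smul, neg_smul]
      rw [disjoint_left]
      intro k hk hk'
      exact (mem_compl.1 hk) (mem_of_mem_erase hk')
    rw [sum_congr rfl h3, sum_neg_distrib, neg_neg, ← smul_sum, ← map_sum]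
    congr 2
    rw [← LinearMap.sum_apply, ← map_sum, lag z hz T hTne]
    simp

lemma termination (K : Fin N → ℂ) (z : J → ℂ) (hz : Function.Injective z) (i : Fin N)
    (g : (J → Fin N) → ℤ → ℂ) (hg : ∀ w, g w ∈ BA)
    (h0 : ∀ w, Dt (dl ℂ (K i)) K (PS z) g w = 0) :
    ∀ w s, s < 0 → g w s = 0 := by
  have hC : ∀ S w, CS (dl ℂ (K i)) K S g w ∈ BA := fun S w =>
    CS_mem BA _ (BA_dl (K i)) K S g hg w
  have hA : ∀ j w, Aop (dl ℂ (K i)) K z j g w ∈ BA := fun j w =>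
    BA.sum_mem (fun S _ => BA.smul_mem _ (hC _ _))
  choose η hηB hη using fun j w => BA_surj (z j) _ (hA j w)
  have hF : ∀ w, CS (dl ℂ (K i)) K ∅ g w = ∑ j, η j w := by
    intro w
    have h1 := sum_eta K z hz i g η hη w
    rw [h0] at h1
    have := aeval_prod_inj (Ush ℂ) BA BA_U z (fun b x hx h => BA_inj (z b) x hx h) univ _
      (BA.sub_mem (hC ∅ w) (BA.sum_mem (fun j _ => hηB j w))) h1
    exact sub_eq_zero.1 this
  have hode : ∀ j w, dl ℂ (K i) (η j w) = K (w j) • η j w +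
      ∑ k ∈ univ.erase j, (z j - z k)⁻¹ • (η j (w ∘ swap j k) - η k w) := by
    intro j w
    have h1 := Aop_eq (dl ℂ (K i)) K z hz j g w
    rw [hF] at h1
    simp only [← hη] at h1
    rw [← sub_eq_zero]
    apply BA_inj (z j)
    · apply BA.sub_mem (BA_dl _ _ (hηB j w))
      exact BA.add_mem (BA.smul_mem _ (hηB j w)) (BA.sum_mem (fun k _ =>
        BA.smul_mem _ (BA.sub_mem (hηB _ _) (hηB _ _))))
    · have h2 : ∑ k ∈ univ.erase j, (z j - z k)⁻¹ • (Ush ℂ (η k w) - z k • η k w) =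
          ∑ k ∈ univ.erase j, (z j - z k)⁻¹ • (Ush ℂ (η k w) - z j • η k w)
          + ∑ k ∈ univ.erase j, η k w := by
        rw [← sum_add_distrib]
        apply sum_congr rfl
        intro k hk
        have hne : z j - z k ≠ 0 := sub_ne_zero.2 (hz.ne (ne_of_mem_erase hk).symm)
        have : (Ush ℂ (η k w) - z k • η k w) =
          (Ush ℂ (η k w) - z j • η k w) + (z j - z k) • η k w := by
          rw [sub_smul]; abel
        rw [this, smul_add, smul_smul, inv_mul_cancel₀ hne, one_smul]
      rw [h2, map_sub, dl_U, map_smul, ← add_sum_erase univ (fun k => η k w) (mem_univ j)] at h1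
      have h3 : Ush ℂ (dl ℂ (K i) (η j w)) - z j • dl ℂ (K i) (η j w) =
          K (w j) • (Ush ℂ (η j w) - z j • η j w) +
          ∑ k ∈ univ.erase j, (z j - z k)⁻¹ • (Ush ℂ (η j (w ∘ swap j k))
            - z j • η j (w ∘ swap j k))
          - ∑ k ∈ univ.erase j, (z j - z k)⁻¹ • (Ush ℂ (η k w) - z j • η k w) := by
        have h4 := sub_eq_iff_eq_add.1 h1
        have h5 := sub_eq_iff_eq_add.1 h4
        have : Ush ℂ (dl ℂ (K i) (η j w)) - z j • dl ℂ (K i) (η j w) =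
          (Ush ℂ (dl ℂ (K i) (η j w)) + η j w - z j • dl ℂ (K i) (η j w)) - η j w := by abel
        rw [this, h5]
        abel
      set P := dl ℂ (K i) (η j w)
      rw [map_sub, smul_sub, sub_sub_sub_comm, h3, map_add, map_smul, map_sum, smul_add, smul_sum]
      simp only [map_smul, map_sub, smul_sub, sum_sub_distrib]
      simp only [smul_comm (z j)]
      abel
  -- linear ODE with constant coefficients
  let R : Module.End ℂ (J → (J → Fin N) → ℂ) :=
    { toFun := fun y j w => (K (w j) - K i) * y j w +
        ∑ k ∈ univ.erase j, (z j - z k)⁻¹ * (y j (w ∘ swap j k) - y k w)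
      map_add' := by
        intro x y
        funext j w
        simp only [Pi.add_apply]
        rw [show ∀ a b c d : ℂ, a + b + (c + d) = (a + c) + (b + d) by intros; ring,
          ← sum_add_distrib]
        congr 1
        · ring
        · exact sum_congr rfl (fun k _ => by ring)
      map_smul' := by
        intro c x
        funext j w
        simp only [Pi.smul_apply, smul_eq_mul, RingHom.id_apply, mul_add, mul_sum]
        congr 1
        · ring
        · exact sum_congr rfl (fun k _ => by ring) }
  have hR : ∀ s : ℤ, R (fun j w => η j w s) = ((s : ℂ) + 1) • (fun j w => η j w (s + 1)) := by
    intro s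
    funext j w
    have h1 := congrFun (hode j w) s
    simp only [dl_apply, Pi.add_apply, Pi.smul_apply, smul_eq_mul, Finset.sum_apply,
      Pi.sub_apply] at h1
    simp only [R, LinearMap.coe_mk, AddHom.coe_mk, Pi.smul_apply, smul_eq_mul]
    linear_combination -h1
  have hηneg := stab_zero R (fun s j w => η j w s) hR
  have hFneg : ∀ w s, s < 0 → CS (dl ℂ (K i)) K ∅ g w s = 0 := by
    intro w s hs
    rw [hF, Finset.sum_apply]
    apply sum_eq_zero
    intro j _
    exact congrFun (congrFun (hηneg s hs) j) w
  -- negative part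
  let neg : (ℤ → ℂ) →ₗ[ℂ] (ℤ → ℂ) :=
    { toFun := fun f s => if s < 0 then f s else 0
      map_add' := by intro f g; funext s; simp only [Pi.add_apply]; split_ifs <;> simp
      map_smul' := by intro c f; funext s; simp }
  have hneg : ∀ f s, neg f s = if s < 0 then f s else 0 := fun f s => rfl
  have hcomm : ∀ f, neg (dl ℂ (K i) f) = dl ℂ (K i) (neg f) := by
    intro f
    funext s
    simp only [hneg, dl_apply, smul_eq_mul]
    rcases lt_trichotomy s (-1) with h | h | h
    · rw [if_pos (by omega), if_pos (by omega), if_pos (by omega)]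
    · subst h; simp
    · rw [if_neg (by omega), if_neg (by omega), if_neg (by omega)]; simp
  let L : Submodule ℂ (ℤ → ℂ) :=
    { carrier := {f | ∀ s, 0 ≤ s → f s = 0}
      add_mem' := by intro f g hf hg s hs; simp [hf s hs, hg s hs]
      zero_mem' := fun _ _ => rfl
      smul_mem' := by intro c f hf s hs; simp [hf s hs] }
  have hL : ∀ f, f ∈ L ↔ ∀ s, 0 ≤ s → f s = 0 := fun f => Iff.rfl
  intro w s hs
  have h1 : aeval (dl ℂ (K i)) (∏ b, (X - C (K b))) (neg (g w)) = 0 := by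
    rw [← aeval_intertwine (dl ℂ (K i)) (dl ℂ (K i)) neg hcomm, ← CS_empty]
    funext t
    rw [hneg]
    split_ifs with ht
    · exact hFneg w t ht
    · rfl
  have h2 := aeval_prod_inj (dl ℂ (K i)) L (by
      intro x hx t ht
      rw [hL] at hx
      simp [hx t ht, hx (t + 1) (by omega)]) K (by
      intro b x hx hb
      rw [hL] at hx
      have hb' : ∀ t : ℤ, ((t : ℂ) + 1) * x (t + 1) + (K i - K b) * x t = 0 := by
        intro t
        have := congrFun hb t
        simp only [Pi.sub_apply, dl_apply, Pi.smul_apply, smul_eq_mul, Pi.zero_apply] at this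
        linear_combination this
      by_cases hbi : K i - K b = 0
      · funext t
        by_cases ht : t = 0
        · subst ht; exact hx 0 le_rfl
        · have := hb' (t - 1)
          rw [hbi, zero_mul, add_zero, sub_add_cancel] at this
          push_cast at this
          rw [sub_add_cancel] at this
          rcases mul_eq_zero.1 this with h | h
          · exact absurd (Int.cast_eq_zero.1 h) ht
          · exact h
      · have key : ∀ k : ℕ, x (0 - k) = 0 := by
          intro k
          induction k with
          | zero => exact hx _ (by simp)
          | succ k ih =>
            have := hb' (0 - (k + 1 : ℕ))
            rw [show (0 - ((k + 1 : ℕ) : ℤ) + 1) = 0 - k by push_cast; ring, ih, mul_zero,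
              zero_add] at this
            exact (mul_eq_zero.1 this).resolve_left hbi
        funext t
        by_cases ht : 0 ≤ t
        · exact hx t ht
        · have := key (-t).toNat
          rwa [show (0 - ((-t).toNat : ℤ)) = t by omega] at this)
    univ (neg (g w)) (by
      intro t ht
      rw [hneg, if_neg (by omega)]) h1
  have := congrFun h2 s
  rwa [hneg, if_pos hs] at this

end PartB2
end GaudinAux


namespace GaudinAux
open Finset Polynomial Equiv

section PartB3
variable {N : ℕ} {J : Type*} [Fintype J] [DecidableEq J]

/-- pointwise evaluation of the deformation parameter -/
def evL (t : ℂ) : (ℤ → ℂ[X]) →ₗ[ℂ] (ℤ → ℂ) where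
  toFun f := fun s => (f s).eval t
  map_add' f g := by funext s; simp
  map_smul' c f := by funext s; simp

@[simp] lemma evL_apply (t : ℂ) (f : ℤ → ℂ[X]) (s : ℤ) : evL t f s = (f s).eval t := rfl

lemma evL_dl (t κ : ℂ) (f : ℤ → ℂ[X]) : evL t (dl ℂ[X] κ f) = dl ℂ κ (evL t f) := by
  funext s
  simp

lemma evL_prod (t : ℂ) (z : J → ℂ[X]) (T : Finset J) (f : ℤ → ℂ[X]) :
    evL t (aeval (Ush ℂ[X]) (∏ j ∈ T, (X - C (z j))) f) =
      aeval (Ush ℂ) (∏ j ∈ T, (X - C ((z j).eval t))) (evL t f) := by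
  induction T using Finset.induction_on with
  | empty => simp
  | insert j T hj ih =>
    rw [prod_insert hj, prod_insert hj, map_mul, map_mul, Module.End.mul_apply,
      Module.End.mul_apply, ← ih]
    set h := aeval (Ush ℂ[X]) (∏ j ∈ T, (X - C (z j))) f
    funext s
    simp [Module.algebraMap_end_apply]

lemma evL_PS (t : ℂ) (z : J → ℂ[X]) (S : Finset J) (f : ℤ → ℂ[X]) :
    evL t (PS z S f) = PS (fun j => (z j).eval t) S (evL t f) := by
  rw [PS_apply, PS_apply, evL_prod]

lemma seq_solution (K : Fin N → ℂ) (hK : ∀ i j, i ≠ j → K i ≠ K j) (z : J → ℂ) (i : Fin N)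
    (m : Fin N → ℕ) (v0 : (J → Fin N) → ℂ) (hv0 : ∀ w, cont w ≠ m → v0 w = 0) :
    ∃ g : (J → Fin N) → ℤ → ℂ, (∀ w, cont w ≠ m → g w = 0) ∧ (∀ w, Sup (g w) (m i)) ∧
      (∀ w, g w (m i) = v0 w) ∧ (∀ w s, s < 0 → g w s = 0) ∧
      ∀ w, Dt (dl ℂ (K i)) K (PS z) g w = 0 := by
  let α : J → ℂ := fun j => ((Fintype.equivFin J j : ℕ) : ℂ)
  have hα : Function.Injective α := by
    intro j k h
    have h1 : ((Fintype.equivFin J j : ℕ)) = (Fintype.equivFin J k : ℕ) := Nat.cast_injective h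
    exact (Fintype.equivFin J).injective (Fin.ext h1)
  let ze : J → ℂ[X] := fun j => C (z j) + X * C (α j)
  have hze : ∀ t j, (ze j).eval t = z j + t * α j := by intro t j; simp [ze]; ring
  obtain ⟨g, hg1, hg2, hg3, hg4⟩ := Dt_rec K hK ze i m (fun w => C (v0 w))
    (fun w hw => by rw [hv0 w hw, C_0])
  have hDt : ∀ t w, Dt (dl ℂ (K i)) K (PS (fun j => z j + t * α j))
      (fun w => evL t (g w)) w = 0 := by
    intro t w
    rw [Dt_nat (dl ℂ[X] (K i)) (dl ℂ (K i)) (evL t) (evL_dl t (K i)) K (PS ze)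
      (PS (fun j => z j + t * α j)) (fun S x => by rw [evL_PS]; simp only [hze]), hg4 w, map_zero]
  have hneg : ∀ w s, s < 0 → g w s = 0 := by
    intro w s hs
    apply Polynomial.eq_zero_of_infinite_isRoot
    let bad : Set ℂ := ⋃ p : J × J, {-((z p.1 - z p.2) / (α p.1 - α p.2))}
    have hbad : bad.Finite := Set.finite_iUnion (fun p => Set.finite_singleton _)
    apply Set.Infinite.mono _ hbad.infinite_compl
    intro t ht
    have hinj : Function.Injective (fun j => z j + t * α j) := by
      intro j k hjk
      by_contra hne
      apply ht
      simp only [bad, Set.mem_iUnion, Set.mem_singleton_iff]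
      refine ⟨(j, k), ?_⟩
      have h1 : α j - α k ≠ 0 := sub_ne_zero.2 (hα.ne hne)
      simp only at hjk ⊢
      field_simp
      linear_combination hjk
    exact termination K _ hinj i (fun w => evL t (g w))
      (fun w => ⟨m i, fun s hs => by simp [hg2 w s hs]⟩) (hDt t) w s hs
  refine ⟨fun w => evL 0 (g w), ?_, ?_, ?_, ?_, ?_⟩
  · intro w hw; simp [hg1 w hw]
  · intro w s hs; simp [hg2 w s hs]
  · intro w; simp [hg3 w]
  · intro w s hs; simp [hneg w s hs]
  · intro w
    have := hDt 0 w
    simpa using this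

/-- polynomials as sequences -/
def pseq : ℂ[X] →ₗ[ℂ] (ℤ → ℂ) where
  toFun p := fun s => if 0 ≤ s then p.coeff s.toNat else 0
  map_add' p q := by funext s; simp only [coeff_add, Pi.add_apply]; split_ifs <;> simp
  map_smul' c p := by funext s; simp

lemma pseq_apply (p : ℂ[X]) (s : ℤ) : pseq p s = if 0 ≤ s then p.coeff s.toNat else 0 := rfl

lemma pseq_inj (p : ℂ[X]) (h : pseq p = 0) : p = 0 := by
  ext k
  have := congrFun h k
  simpa [pseq_apply] using this

/-- `d/du + κ` on polynomials -/
def pD (κ : ℂ) : Module.End ℂ ℂ[X] := derivative + κ • 1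

lemma pD_apply (κ : ℂ) (p : ℂ[X]) : pD κ p = derivative p + κ • p := rfl

lemma pseq_pD (κ : ℂ) (p : ℂ[X]) : pseq (pD κ p) = dl ℂ κ (pseq p) := by
  funext s
  simp only [pseq_apply, dl_apply, pD_apply, coeff_add, coeff_smul, smul_eq_mul, coeff_derivative]
  rcases lt_trichotomy s (-1) with h | h | h
  · rw [if_neg (by omega), if_neg (by omega), if_neg (by omega)]; simp
  · subst h; simp
  · rw [if_pos (by omega), if_pos (by omega), if_pos (by omega)]
    obtain ⟨k, rfl⟩ := Int.eq_ofNat_of_zero_le (show 0 ≤ s by omega)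
    have : ((k : ℤ) + 1).toNat = k + 1 := by omega
    rw [this]; simp; ring

/-- multiplication by the product of the `u - z_j` outside `S` -/
def pP (z : J → ℂ) (S : Finset J) : ℂ[X] →ₗ[ℂ] ℂ[X] :=
  LinearMap.mulLeft ℂ (∏ j ∈ Sᶜ, (X - C (z j)))

lemma pseq_prod (z : J → ℂ) (T : Finset J) (p : ℂ[X]) :
    pseq ((∏ j ∈ T, (X - C (z j))) * p) =
      aeval (Ush ℂ) (∏ j ∈ T, (X - C (z j))) (pseq p) := by
  induction T using Finset.induction_on with
  | empty => simp
  | insert j T hj ih =>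
    rw [prod_insert hj, mul_assoc, map_mul (aeval (Ush ℂ)), Module.End.mul_apply, ← ih]
    set q := (∏ j ∈ T, (X - C (z j))) * p
    funext s
    simp only [map_sub, aeval_X, aeval_C, LinearMap.sub_apply, Module.algebraMap_end_apply,
      Pi.sub_apply, Ush_apply, Pi.smul_apply, smul_eq_mul, sub_mul, pseq_apply, coeff_C_mul]
    rcases lt_trichotomy s 0 with h | h | h
    · rw [if_neg (by omega), if_neg (by omega), if_neg (by omega)]; simp
    · subst h; simp
    · rw [if_pos (by omega), if_pos (by omega), if_pos (by omega)]
      have : s.toNat = (s - 1).toNat + 1 := by omega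
      rw [this]; simp [sub_mul]

lemma poly_solution (K : Fin N → ℂ) (hK : ∀ i j, i ≠ j → K i ≠ K j) (z : J → ℂ) (i : Fin N)
    (m : Fin N → ℕ) (v0 : (J → Fin N) → ℂ) (hv0 : ∀ w, cont w ≠ m → v0 w = 0) :
    ∃ p : (J → Fin N) → ℂ[X], (∀ w, cont w ≠ m → p w = 0) ∧
      (∀ w t, m i < t → (p w).coeff t = 0) ∧
      (∀ w, (p w).coeff (m i) = v0 w) ∧
      ∀ w, Dt (pD (K i)) K (pP z) p w = 0 := by
  obtain ⟨g, hg1, hg2, hg3, hg4, hg5⟩ := seq_solution K hK z i m v0 hv0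
  let p : (J → Fin N) → ℂ[X] := fun w => ∑ t ∈ range (m i + 1), monomial t (g w t)
  have hc : ∀ w t, (p w).coeff t = if t ≤ m i then g w t else 0 := by
    intro w t
    simp only [p, finsetSum_coeff, coeff_monomial]
    rw [Finset.sum_ite_eq' (range (m i + 1)) t (fun x => g w x)]
    simp
  have hps : ∀ w, pseq (p w) = g w := by
    intro w
    funext s
    rw [pseq_apply]
    by_cases hs : 0 ≤ s
    · rw [if_pos hs, hc]
      obtain ⟨k, rfl⟩ := Int.eq_ofNat_of_zero_le hs
      simp only [Int.toNat_natCast]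
      split_ifs with h
      · rfl
      · exact (hg2 w _ (by omega)).symm
    · rw [if_neg hs]; exact (hg4 w s (by omega)).symm
  refine ⟨p, ?_, ?_, ?_, ?_⟩
  · intro w hw
    apply pseq_inj
    rw [hps, hg1 w hw]
  · intro w t ht
    rw [hc, if_neg (by omega)]
  · intro w
    rw [hc, if_pos le_rfl, hg3]
  · intro w
    apply pseq_inj
    rw [← Dt_nat (pD (K i)) (dl ℂ (K i)) pseq (pseq_pD (K i)) K (pP z) (PS z)
      (fun S x => by rw [PS_apply, ← pseq_prod]; rfl)]
    simp only [hps]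
    exact hg5 w

end PartB3
end GaudinAux


namespace GaudinAux
open Finset Polynomial Equiv

section PartC
variable {N : ℕ} {J : Type*} [Fintype J] [DecidableEq J]
variable {F : Type*} [AddCommGroup F] [Module ℂ F]

/-- entries of the matrix of differential operators, on word-indexed functions -/
def Xw (D : Module.End ℂ F) (b : J → Module.End ℂ F) (K : Fin N → ℂ) (a c : Fin N)
    (g : (J → Fin N) → F) : (J → Fin N) → F := fun w =>
  (if a = c then D (g w) - K a • g w else 0)
    - ∑ j, if w j = c then b j (g (Function.update w j a)) else 0

/-- normal ordered version -/
def XH (D : Module.End ℂ F) (K : Fin N → ℂ) (a c : Fin N)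
    (G : (J → Fin N) → Finset J → F) : (J → Fin N) → Finset J → F := fun w S =>
  (if a = c then D (G w S) - K a • G w S else 0)
    - ∑ j ∈ S, if w j = c then G (Function.update w j a) (S.erase j) else 0

def ghat (g : (J → Fin N) → F) : (J → Fin N) → Finset J → F :=
  fun w S => if S = ∅ then g w else 0

def GG (D : Module.End ℂ F) (K : Fin N → ℂ) (g : (J → Fin N) → F) (c : Fin N → Fin N)
    (L : List (Fin N)) : (J → Fin N) → Finset J → F :=
  L.foldr (fun r G => XH D K r (c r) G) (ghat g)

def XL (D : Module.End ℂ F) (b : J → Module.End ℂ F) (K : Fin N → ℂ) (c : Fin N → Fin N)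
    (L : List (Fin N)) (g : (J → Fin N) → F) : (J → Fin N) → F :=
  L.foldr (fun r G => Xw D b K r (c r) G) g

variable (D : Module.End ℂ F) (K : Fin N → ℂ) (g : (J → Fin N) → F)

lemma GG_cons (c : Fin N → Fin N) (r : Fin N) (L : List (Fin N)) :
    GG D K g c (r :: L) = XH D K r (c r) (GG D K g c L) := rfl

lemma GG_congr (c c' : Fin N → Fin N) (L : List (Fin N)) (h : ∀ r ∈ L, c r = c' r) :
    GG D K g c L = GG D K g c' L := by
  induction L with
  | nil => rfl
  | cons r L ih =>
    rw [GG_cons, GG_cons, ih (fun r hr => h r (List.mem_cons_of_mem _ hr)),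
      h r List.mem_cons_self]

lemma Z0 (c : Fin N → Fin N) (L : List (Fin N)) : ∀ (w : J → Fin N) (S : Finset J) (l : J),
    l ∈ S → (∀ r ∈ L, c r ≠ w l) → GG D K g c L w S = 0 := by
  induction L with
  | nil =>
    intro w S l hl _
    have : S ≠ ∅ := fun h => by simp [h] at hl
    simp [GG, ghat, this]
  | cons r L ih =>
    intro w S l hl h
    rw [GG_cons]
    unfold XH
    rw [ih w S l hl (fun r hr => h r (List.mem_cons_of_mem _ hr))]
    have : ∑ j ∈ S, (if w j = c r then GG D K g c L (Function.update w j r) (S.erase j) else 0)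
        = 0 := by
      apply sum_eq_zero
      intro j hj
      split_ifs with hw
      · have hjl : l ≠ j := fun hh => h r List.mem_cons_self (by rw [hh, hw])
        apply ih _ _ l (mem_erase.2 ⟨hjl, hl⟩)
        intro r' hr'
        rw [Function.update_of_ne hjl]
        exact h r' (List.mem_cons_of_mem _ hr')
      · rfl
    rw [this]; simp

lemma Z1 (k r0 : Fin N) (c c' : Fin N → Fin N) (hk : c' r0 = k)
    (L : List (Fin N)) :
    ∀ (w : J → Fin N) (S : Finset J) (l : J), (∀ r ∈ L, r ≠ r0 → c' r = c r) → L.Nodup → (∀ r ∈ L, ∀ s ∈ L, c r = c s → r = s) →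
    l ∈ S → r0 ∈ L → c r0 = w l → (∀ r ∈ L, r ≠ r0 → c r ≠ k) →
      GG D K g c L w S = GG D K g c' L (Function.update w l k) S := by
  induction L with
  | nil => intro w S l _ _ _ _ h; simp at h
  | cons r L ih =>
    intro w S l hcc hnd hinj hl hr0 hw hkL
    rw [List.nodup_cons] at hnd
    rw [GG_cons, GG_cons]
    unfold XH
    by_cases hr : r = r0
    · subst hr
      have hL' : GG D K g c' L = GG D K g c L :=
        GG_congr D K g _ _ L (fun s hs => hcc s (List.mem_cons_of_mem _ hs) (fun h => hnd.1 (h ▸ hs)))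
      have hcL : ∀ s ∈ L, c s ≠ c r := fun s hs h =>
        hnd.1 ((hinj s (List.mem_cons_of_mem _ hs) r List.mem_cons_self h) ▸ hs)
      have hkL' : ∀ s ∈ L, c s ≠ k := fun s hs =>
        hkL s (List.mem_cons_of_mem _ hs) (fun h => hnd.1 (h ▸ hs))
      rw [hL', hk, Z0 D K g c L w S l hl (fun s hs => by rw [← hw]; exact hcL s hs),
        Z0 D K g c L (Function.update w l k) S l hl (fun s hs => by simpa using hkL' s hs)]
      rw [sum_eq_single_of_mem l hl, sum_eq_single_of_mem l hl]
      · simp [hw]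
      · intro j hj hjl
        split_ifs with h
        · apply Z0 D K g c L _ _ l (mem_erase.2 ⟨hjl.symm, hl⟩)
          intro s hs
          rw [Function.update_of_ne hjl.symm]
          simpa using hkL' s hs
        · rfl
      · intro j hj hjl
        split_ifs with h
        · apply Z0 D K g c L _ _ l (mem_erase.2 ⟨hjl.symm, hl⟩)
          intro s hs
          rw [Function.update_of_ne hjl.symm, ← hw]
          exact hcL s hs
        · rfl
    · have hr0L : r0 ∈ L := by
        rcases List.mem_cons.1 hr0 with h | h
        · exact absurd h.symm hr
        · exact h
      have hinjL : ∀ r ∈ L, ∀ s ∈ L, c r = c s → r = s := fun s hs t ht =>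
        hinj s (List.mem_cons_of_mem _ hs) t (List.mem_cons_of_mem _ ht)
      have hkL' : ∀ r ∈ L, r ≠ r0 → c r ≠ k := fun s hs => hkL s (List.mem_cons_of_mem _ hs)
      have hccL : ∀ r ∈ L, r ≠ r0 → c' r = c r := fun s hs => hcc s (List.mem_cons_of_mem _ hs)
      rw [hcc r List.mem_cons_self hr, ← ih w S l hccL hnd.2 hinjL hl hr0L hw hkL']
      congr 1
      apply sum_congr rfl
      intro j hj
      have hne : c r ≠ w l := by
        rw [← hw]
        exact fun h => hr (hinj r List.mem_cons_self r0 hr0 h)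
      have hne2 : c r ≠ k := hkL r List.mem_cons_self hr
      by_cases hjl : j = l
      · subst hjl
        rw [if_neg hne.symm, Function.update_self, if_neg hne2.symm]
      · rw [Function.update_of_ne hjl]
        split_ifs with h
        · rw [Function.update_comm (Ne.symm hjl)]
          have hlj : l ≠ j := fun h => hjl h.symm
          apply ih _ _ l hccL hnd.2 hinjL (mem_erase.2 ⟨hlj, hl⟩) hr0L _ hkL'
          rw [Function.update_of_ne hlj, hw]
        · rfl

variable (b : J → Module.End ℂ F) (Q : Finset J → Module.End ℂ F)

def evG (G : (J → Fin N) → Finset J → F) : (J → Fin N) → F := fun w => ∑ S, Q S (G w S)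

lemma Xw_evG (hQ1 : ∀ S x, D (Q S x) = Q S (D x) - ∑ l ∈ S, b l (Q S x))
    (hQ2 : ∀ S j x, j ∉ S → b j (Q S x) = Q (insert j S) x)
    (a c : Fin N) (G : (J → Fin N) → Finset J → F) :
    Xw D b K a c (evG Q G) = evG Q (XH D K a c G) -
      ∑ S : Finset J, ∑ l ∈ S, fun w =>
        b l (Q S ((if a = c then G w S else 0)
          + if w l = c then G (Function.update w l a) S else 0)) := by
  funext w
  have h1 : (if a = c then D (evG Q G w) - K a • evG Q G w else 0) =
      ∑ S, Q S (if a = c then D (G w S) - K a • G w S else 0)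
      - ∑ S : Finset J, ∑ l ∈ S, b l (Q S (if a = c then G w S else 0)) := by
    split_ifs with h
    · simp only [evG, map_sum, smul_sum, map_sub, map_smul, hQ1, sum_sub_distrib]
      abel
    · simp
  have h2 : (∑ j, if w j = c then b j (evG Q G (Function.update w j a)) else 0) =
      ∑ S, Q S (∑ j ∈ S, if w j = c then G (Function.update w j a) (S.erase j) else 0)
      + ∑ S : Finset J, ∑ l ∈ S, b l (Q S (if w l = c then G (Function.update w l a) S else 0)) := by
    have h3 : ∑ S, Q S (∑ j ∈ S, if w j = c then G (Function.update w j a) (S.erase j) else 0) =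
        ∑ j, ∑ S ∈ (univ.erase j).powerset,
          if w j = c then b j (Q S (G (Function.update w j a) S)) else 0 := by
      simp only [map_sum]
      rw [← powerset_univ, ← powerset_reorg]
      apply sum_congr rfl
      intro j _
      apply sum_congr rfl
      intro S hS
      have hj : j ∉ S := fun h => by simpa using mem_powerset.1 hS h
      rw [erase_insert hj, hQ2 _ _ _ hj]
      split_ifs <;> simp
    have h4 : ∑ S : Finset J, ∑ l ∈ S,
          b l (Q S (if w l = c then G (Function.update w l a) S else 0)) =
        ∑ j, ∑ S ∈ (univ.erase j).powerset,
          if w j = c then b j (Q (insert j S) (G (Function.update w j a) (insert j S))) else 0 := by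
      rw [← powerset_univ, ← powerset_reorg]
      apply sum_congr rfl
      intro j _
      apply sum_congr rfl
      intro S hS
      split_ifs <;> simp
    rw [h3, h4, ← sum_add_distrib]
    apply sum_congr rfl
    intro j _
    split_ifs with h
    · simp only [evG, map_sum]
      rw [← powerset_univ, ← insert_erase (mem_univ j), sum_powerset_insert (notMem_erase _ _)]
      rw [insert_erase (mem_univ j)]
    · simp
  unfold Xw
  rw [h1, h2]
  simp only [Pi.sub_apply, Finset.sum_apply, evG, XH, map_sub, map_add, sum_add_distrib,
    sum_sub_distrib]
  abel

lemma Xw_add (a c : Fin N) (f h : (J → Fin N) → F) :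
    Xw D b K a c (f + h) = Xw D b K a c f + Xw D b K a c h := by
  funext w
  simp only [Xw, Pi.add_apply, map_add, smul_add]
  have : (∑ j, if w j = c then b j (f (Function.update w j a)) + b j (h (Function.update w j a))
      else 0) = (∑ j, if w j = c then b j (f (Function.update w j a)) else 0)
      + ∑ j, if w j = c then b j (h (Function.update w j a)) else 0 := by
    rw [← sum_add_distrib]
    exact sum_congr rfl (fun j _ => by split_ifs <;> simp)
  rw [this]
  split_ifs <;> abel

/-- additive version of `XL` -/
def XLh (c : Fin N → Fin N) (L : List (Fin N)) : ((J → Fin N) → F) →+ ((J → Fin N) → F) :=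
  AddMonoidHom.mk' (XL D b K c L) (by
    intro f h
    induction L with
    | nil => rfl
    | cons r L ih =>
      change Xw D b K r (c r) (XL D b K c L (f + h)) = _
      rw [ih, Xw_add]; rfl)

lemma XLh_apply (c : Fin N → Fin N) (L : List (Fin N)) (f : (J → Fin N) → F) :
    XLh D K b c L f = XL D b K c L f := rfl

lemma XL_congr (c c' : Fin N → Fin N) (L : List (Fin N)) (h : ∀ r ∈ L, c r = c' r)
    (f : (J → Fin N) → F) : XL D b K c L f = XL D b K c' L f := by
  induction L with
  | nil => rfl
  | cons r L ih =>
    change Xw D b K r (c r) (XL D b K c L f) = Xw D b K r (c' r) (XL D b K c' L f)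
    rw [ih (fun r hr => h r (List.mem_cons_of_mem _ hr)), h r List.mem_cons_self]

def HH (L1 L2 : List (Fin N)) : (J → Fin N) → F :=
  ∑ σ : Perm (Fin N), ((Perm.sign σ : ℤˣ) : ℤ) • XL D b K σ L1 (evG Q (GG D K g σ L2))

/-- cancellation of the error terms -/
lemma err_cancel (k : Fin N) (L1 L2 : List (Fin N)) (hnd : (L1 ++ k :: L2).Nodup) (S : Finset J)
    (l : J) (hl : l ∈ S) :
    ∑ σ : Perm (Fin N), ((Perm.sign σ : ℤˣ) : ℤ) • XLh D K b σ L1 (fun w =>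
        b l (Q S ((if k = σ k then GG D K g σ L2 w S else 0)
          + if w l = σ k then GG D K g σ L2 (Function.update w l k) S else 0))) = 0 := by
  rw [List.nodup_append'] at hnd
  obtain ⟨hnd1, hnd2, hdisj⟩ := hnd
  rw [List.nodup_cons] at hnd2
  have hkL1 : k ∉ L1 := fun h => hdisj h List.mem_cons_self
  have hL12 : ∀ r ∈ L2, r ∉ L1 := fun r hr h => hdisj h (List.mem_cons_of_mem _ hr)
  let f1 : Fin N → Perm (Fin N) → (J → Fin N) → F := fun c σ w =>
    if w l = c then b l (Q S (GG D K g σ L2 w S)) else 0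
  let f2 : Fin N → Perm (Fin N) → (J → Fin N) → F := fun c σ w =>
    if w l = c then b l (Q S (GG D K g σ L2 (Function.update w l k) S)) else 0
  have hsplit : ∀ σ : Perm (Fin N), (fun w : J → Fin N =>
        b l (Q S ((if k = σ k then GG D K g σ L2 w S else 0)
          + if w l = σ k then GG D K g σ L2 (Function.update w l k) S else 0))) =
      ∑ c : Fin N, ((if k = σ k then f1 c σ else 0) + if c = σ k then f2 c σ else 0) := by
    intro σ
    funext w
    rw [Finset.sum_apply]
    simp only [Pi.add_apply, map_add, sum_add_distrib]
    congr 1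
    · by_cases h : k = σ k
      · rw [if_pos h]
        simp only [if_pos h]
        simp [f1]
      · simp [h]
    · rw [Finset.sum_eq_single (σ k)]
      · simp only [if_true, f2]
        split_ifs <;> simp
      · intro c _ hc
        simp [hc]
      · simp
  have hgoal : ∀ c : Fin N, ∑ σ : Perm (Fin N), ((Perm.sign σ : ℤˣ) : ℤ) • XLh D K b σ L1
      ((if k = σ k then f1 c σ else 0) + if c = σ k then f2 c σ else 0) = 0 := by
    intro c
    have hA : ∀ σ : Perm (Fin N), XLh D K b σ L1 (if k = σ k then f1 c σ else 0) =
        if k = σ k ∧ σ⁻¹ c ∈ L2 then XLh D K b σ L1 (f1 c σ) else 0 := by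
      intro σ
      by_cases h : k = σ k
      · rw [if_pos h]
        by_cases h2 : σ⁻¹ c ∈ L2
        · rw [if_pos ⟨h, h2⟩]
        · rw [if_neg (fun hh => h2 hh.2)]
          have : f1 c σ = 0 := by
            funext w
            simp only [f1, Pi.zero_apply]
            split_ifs with hw
            · rw [Z0 D K g σ L2 w S l hl, map_zero, map_zero]
              intro r hr hr'
              apply h2
              rw [← hw, ← hr']
              simpa using hr
            · rfl
          rw [this, map_zero]
      · rw [if_neg h, if_neg (fun hh => h hh.1), map_zero]
    have hB : ∀ σ : Perm (Fin N), XLh D K b σ L1 (if c = σ k then f2 c σ else 0) =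
        if c = σ k ∧ σ⁻¹ k ∈ L2 then XLh D K b σ L1 (f2 c σ) else 0 := by
      intro σ
      by_cases h : c = σ k
      · rw [if_pos h]
        by_cases h2 : σ⁻¹ k ∈ L2
        · rw [if_pos ⟨h, h2⟩]
        · rw [if_neg (fun hh => h2 hh.2)]
          have : f2 c σ = 0 := by
            funext w
            simp only [f2, Pi.zero_apply]
            split_ifs with hw
            · rw [Z0 D K g σ L2 _ S l hl, map_zero, map_zero]
              intro r hr hr'
              apply h2
              rw [Function.update_self] at hr'
              rw [← hr']
              simpa using hr
            · rfl
          rw [this, map_zero]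
      · rw [if_neg h, if_neg (fun hh => h hh.1), map_zero]
    simp only [map_add, hA, hB, smul_add, sum_add_distrib, smul_ite, smul_zero]
    rw [← sum_filter, ← sum_filter, ← eq_neg_iff_add_eq_zero, ← sum_neg_distrib]
    refine sum_bij' (fun σ _ => σ * swap k (σ⁻¹ c)) (fun σ _ => σ * swap k (σ⁻¹ k)) ?_ ?_ ?_ ?_ ?_
    · intro σ hσ
      simp only [mem_filter, mem_univ, true_and] at hσ ⊢
      refine ⟨by simp, ?_⟩
      have : Equiv.symm σ k = k := by rw [Equiv.symm_apply_eq]; exact hσ.1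
      simpa [mul_inv_rev, this] using hσ.2
    · intro σ hσ
      simp only [mem_filter, mem_univ, true_and] at hσ ⊢
      refine ⟨by simp, ?_⟩
      have : Equiv.symm σ c = k := by rw [Equiv.symm_apply_eq]; exact hσ.1
      simpa [mul_inv_rev, this] using hσ.2
    · intro σ hσ
      simp only [mem_filter, mem_univ, true_and] at hσ
      have : Equiv.symm σ k = k := by rw [Equiv.symm_apply_eq]; exact hσ.1
      simp [mul_inv_rev, this, mul_assoc]
    · intro σ hσ
      simp only [mem_filter, mem_univ, true_and] at hσ
      have : Equiv.symm σ c = k := by rw [Equiv.symm_apply_eq]; exact hσ.1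
      simp [mul_inv_rev, this, mul_assoc]
    · intro σ hσ
      simp only [mem_filter, mem_univ, true_and] at hσ
      set r := σ⁻¹ c with hr
      have hσr : σ r = c := by simp [hr]
      have hrk : k ≠ r := fun h => hnd2.1 (h ▸ hσ.2)
      rw [Perm.sign_mul, Perm.sign_swap hrk]
      have e1 : f1 c σ = f2 c (σ * swap k r) := by
        funext w
        simp only [f1, f2]
        split_ifs with hw
        · congr 2
          apply Z1 D K g k r σ
          · simp [← hσ.1]
          · intro s hsL hs
            have hsk : s ≠ k := fun h => hnd2.1 (h ▸ hsL)
            simp [swap_apply_of_ne_of_ne hsk hs]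
          · exact hnd2.2
          · exact fun s _ t _ h => σ.injective h
          · exact hl
          · exact hσ.2
          · rw [hσr, hw]
          · intro s hs hsr h
            rw [hσ.1] at h
            exact hnd2.1 (σ.injective h ▸ hs)
        · rfl
      rw [e1, XLh_apply, XLh_apply, XL_congr D K b σ (σ * swap k r : Perm (Fin N)) L1]
      · simp
      · intro s hs
        have h1 : s ≠ k := fun h => hkL1 (h ▸ hs)
        have h2 : s ≠ r := fun h => hL12 r hσ.2 (h ▸ hs)
        simp [swap_apply_of_ne_of_ne h1 h2]
  simp only [hsplit, map_sum, smul_sum]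
  rw [sum_comm]
  exact sum_eq_zero (fun c _ => hgoal c)

lemma HH_step (hQ1 : ∀ S x, D (Q S x) = Q S (D x) - ∑ l ∈ S, b l (Q S x))
    (hQ2 : ∀ S j x, j ∉ S → b j (Q S x) = Q (insert j S) x)
    (k : Fin N) (L1 L2 : List (Fin N)) (hnd : (L1 ++ k :: L2).Nodup) :
    HH D K g b Q (L1 ++ [k]) L2 = HH D K g b Q L1 (k :: L2) := by
  have h1 : ∀ σ : Perm (Fin N), XL D b K σ (L1 ++ [k]) (evG Q (GG D K g σ L2)) =
      XLh D K b σ L1 (evG Q (GG D K g σ (k :: L2))) - ∑ S : Finset J, ∑ l ∈ S,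
        XLh D K b σ L1 (fun w => b l (Q S ((if k = σ k then GG D K g σ L2 w S else 0)
          + if w l = σ k then GG D K g σ L2 (Function.update w l k) S else 0))) := by
    intro σ
    have : XL D b K σ (L1 ++ [k]) (evG Q (GG D K g σ L2)) =
      XLh D K b σ L1 (Xw D b K k (σ k) (evG Q (GG D K g σ L2))) := by
      rw [XLh_apply]; unfold XL; rw [List.foldr_append]; rfl
    rw [this, Xw_evG D K b Q hQ1 hQ2, map_sub, map_sum]
    simp only [map_sum]
    rfl
  unfold HH
  simp only [h1, smul_sub, sum_sub_distrib, smul_sum]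
  rw [sum_comm]
  have : ∑ S : Finset J, ∑ σ : Perm (Fin N), ∑ l ∈ S, ((Perm.sign σ : ℤˣ) : ℤ) •
        XLh D K b σ L1 (fun w => b l (Q S ((if k = σ k then GG D K g σ L2 w S else 0)
          + if w l = σ k then GG D K g σ L2 (Function.update w l k) S else 0))) = 0 := by
    apply sum_eq_zero
    intro S _
    rw [sum_comm]
    exact sum_eq_zero (fun l hl => err_cancel D K g b Q k L1 L2 hnd S l hl)
  rw [this, sub_zero]
  rfl

lemma HH_all (hQ1 : ∀ S x, D (Q S x) = Q S (D x) - ∑ l ∈ S, b l (Q S x))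
    (hQ2 : ∀ S j x, j ∉ S → b j (Q S x) = Q (insert j S) x)
    (L1 : List (Fin N)) : ∀ L2 : List (Fin N), (L1 ++ L2).Nodup →
    HH D K g b Q L1 L2 = HH D K g b Q [] (L1 ++ L2) := by
  induction L1 using List.reverseRecOn with
  | nil => intro L2 _; rfl
  | append_singleton L k ih =>
    intro L2 h
    rw [List.append_assoc] at h ⊢
    rw [HH_step D K g b Q hQ1 hQ2 k L L2 h]
    exact ih (k :: L2) h

end PartC
end GaudinAux


namespace GaudinAux
open Finset Polynomial Equiv

section PartC2
variable {N : ℕ} {J : Type*} [Fintype J] [DecidableEq J]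
variable {F : Type*} [AddCommGroup F] [Module ℂ F]
variable (D : Module.End ℂ F) (K : Fin N → ℂ) (g : (J → Fin N) → F)

lemma Z2 (σ : Perm (Fin N)) (L : List (Fin N)) : ∀ (w : J → Fin N) (S : Finset J), L.Nodup →
    ¬ Set.InjOn w S → GG D K g σ L w S = 0 := by
  induction L with
  | nil =>
    intro w S _ h
    have : S ≠ ∅ := fun hS => h (by simp [hS])
    simp [GG, ghat, this]
  | cons r L ih =>
    intro w S hnd h
    rw [List.nodup_cons] at hnd
    rw [GG_cons]
    unfold XH
    rw [ih w S hnd.2 h]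
    have : ∑ j ∈ S, (if w j = σ r then GG D K g σ L (Function.update w j r) (S.erase j) else 0)
        = 0 := by
      apply sum_eq_zero
      intro j hj
      split_ifs with hw
      · by_cases hl : ∃ l ∈ S, l ≠ j ∧ w l = w j
        · obtain ⟨l, hl, hlj, hwl⟩ := hl
          apply Z0 D K g σ L _ _ l (mem_erase.2 ⟨hlj, hl⟩)
          intro s hs hh
          rw [Function.update_of_ne hlj, hwl, hw] at hh
          exact hnd.1 (σ.injective hh ▸ hs)
        · apply ih _ _ hnd.2
          intro hinj
          apply h
          intro x hx y hy hxy
          by_cases hxj : x = j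
          · subst hxj
            by_contra hne
            exact hl ⟨y, hy, fun h => hne h.symm, hxy.symm⟩
          · by_cases hyj : y = j
            · subst hyj
              exact absurd ⟨x, hx, hxj, hxy⟩ hl
            · apply hinj
              · exact mem_coe.2 (mem_erase.2 ⟨hxj, hx⟩)
              · exact mem_coe.2 (mem_erase.2 ⟨hyj, hy⟩)
              · rw [Function.update_of_ne hxj, Function.update_of_ne hyj, hxy]
      · rfl
    rw [this]; simp

lemma Z3 (σ : Perm (Fin N)) (r : Fin N) (hr : σ r ≠ r) (L : List (Fin N)) :
    ∀ (w : J → Fin N) (S : Finset J), r ∈ L → σ r ∉ S.image w → GG D K g σ L w S = 0 := by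
  induction L with
  | nil => intro w S h; simp at h
  | cons s L ih =>
    intro w S h hS
    rw [GG_cons]
    unfold XH
    rcases List.mem_cons.1 h with h | h
    · subst h
      rw [if_neg (fun h => hr h.symm)]
      rw [sum_eq_zero, sub_zero]
      intro j hj
      rw [if_neg]
      intro hh
      exact hS (hh ▸ mem_image_of_mem w hj)
    · rw [ih w S h hS, sum_eq_zero]
      · simp
      · intro j hj
        split_ifs with hw
        · apply ih _ _ h
          intro hh
          apply hS
          obtain ⟨l, hl, hlr⟩ := mem_image.1 hh
          rw [Function.update_of_ne (mem_erase.1 hl).1] at hlr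
          exact mem_image.2 ⟨l, (mem_erase.1 hl).2, hlr⟩
        · rfl

lemma GG_formula (σ : Perm (Fin N)) (L : List (Fin N)) : ∀ (w : J → Fin N) (S : Finset J),
    L.Nodup → Set.InjOn w S → (∀ j ∈ S, σ.symm (w j) ∈ L) →
    (∀ r ∈ L, σ r ∉ S.image w → σ r = r) →
    GG D K g σ L w S = (-1 : ℂ) ^ S.card • aeval D (∏ r ∈ L.toFinset with σ r ∉ S.image w,
      (X - C (K r))) (g (fun j => if j ∈ S then σ.symm (w j) else w j)) := by
  induction L with
  | nil =>
    intro w S _ _ h _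
    have : S = ∅ := by
      rw [eq_empty_iff_forall_notMem]
      intro j hj
      simpa using h j hj
    subst this
    simp [GG, ghat]
  | cons r L ih =>
    intro w S hnd hinj hS hfix
    rw [List.nodup_cons] at hnd
    rw [GG_cons]
    unfold XH
    rw [List.toFinset_cons, filter_insert]
    by_cases hr : σ r ∈ S.image w
    · obtain ⟨j0, hj0, hw0⟩ := mem_image.1 hr
      rw [if_neg (not_not.2 hr)]
      rw [Z0 D K g σ L w S j0 hj0 (fun s hs hh => by
        rw [hw0] at hh
        exact hnd.1 (σ.injective hh ▸ hs))]
      rw [sum_eq_single_of_mem j0 hj0]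
      · rw [if_pos hw0, ih]
        · have h1 : ∀ s ∈ L, (σ s ∉ (S.erase j0).image (Function.update w j0 r) ↔
              σ s ∉ S.image w) := by
            intro s hs
            rw [not_iff_not]
            simp only [mem_image]
            constructor
            · rintro ⟨l, hl, hlr⟩
              rw [Function.update_of_ne (mem_erase.1 hl).1] at hlr
              exact ⟨l, (mem_erase.1 hl).2, hlr⟩
            · rintro ⟨l, hl, hlr⟩
              have hne : l ≠ j0 := by
                intro h
                subst h
                rw [hw0] at hlr
                exact hnd.1 (σ.injective hlr ▸ hs)
              exact ⟨l, mem_erase.2 ⟨hne, hl⟩, by rw [Function.update_of_ne hne, hlr]⟩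
          have h2 : (L.toFinset.filter fun s =>
              σ s ∉ (S.erase j0).image (Function.update w j0 r)) =
              L.toFinset.filter fun s => σ s ∉ S.image w := by
            apply filter_congr
            intro s hs
            exact h1 s (List.mem_toFinset.1 hs)
          have h3 : (fun j => if j ∈ S.erase j0 then σ.symm (Function.update w j0 r j)
              else Function.update w j0 r j) = fun j => if j ∈ S then σ.symm (w j) else w j := by
            funext j
            by_cases hj : j = j0
            · subst hj
              simp [hj0, hw0]
            · simp [hj]
          rw [h2, h3]
          have h4 : S.card = (S.erase j0).card + 1 := by
            rw [card_erase_of_mem hj0]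
            have := card_pos.2 ⟨j0, hj0⟩
            omega
          rw [h4, pow_succ]
          simp
        · exact hnd.2
        · intro x hx y hy hxy
          have hx' := mem_erase.1 (mem_coe.1 hx)
          have hy' := mem_erase.1 (mem_coe.1 hy)
          rw [Function.update_of_ne hx'.1, Function.update_of_ne hy'.1] at hxy
          exact hinj hx'.2 hy'.2 hxy
        · intro j hj
          have hj' := mem_erase.1 hj
          rw [Function.update_of_ne hj'.1]
          rcases List.mem_cons.1 (hS j hj'.2) with h | h
          · rw [Equiv.symm_apply_eq, ← hw0] at h
            exact absurd (hinj hj'.2 hj0 h) hj'.1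
          · exact h
        · intro s hs hh
          apply hfix s (List.mem_cons_of_mem _ hs)
          intro hh2
          apply hh
          obtain ⟨l, hl, hlr⟩ := mem_image.1 hh2
          have hne : l ≠ j0 := by
            intro h
            subst h
            rw [hw0] at hlr
            exact hnd.1 (σ.injective hlr ▸ hs)
          exact mem_image.2 ⟨l, mem_erase.2 ⟨hne, hl⟩, by rw [Function.update_of_ne hne, hlr]⟩
      · intro j hj hjj
        rw [if_neg]
        intro h
        exact hjj (hinj hj hj0 (h.trans hw0.symm))
    · have hrr := hfix r List.mem_cons_self hr
      rw [if_pos hr, if_pos hrr.symm, sum_eq_zero, sub_zero, prod_insert]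
      · rw [ih w S hnd.2 hinj]
        · simp only [map_mul, Module.End.mul_apply, map_smul, map_sub, aeval_X, aeval_C,
            LinearMap.sub_apply, Module.algebraMap_end_apply, smul_sub]
          rw [smul_comm]
        · intro j hj
          rcases List.mem_cons.1 (hS j hj) with h | h
          · rw [Equiv.symm_apply_eq] at h
            exact absurd (h ▸ mem_image_of_mem w hj) hr
          · exact h
        · exact fun s hs => hfix s (List.mem_cons_of_mem _ hs)
      · intro h
        exact hnd.1 (List.mem_toFinset.1 (mem_filter.1 h).1)
      · intro j hj
        rw [if_neg]
        intro h
        exact hr (h ▸ mem_image_of_mem w hj)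

/-- sums over permutations fixing the complement of a subset -/
lemma sum_extend {α β A : Type*} [Fintype α] [DecidableEq α] [Fintype β] [DecidableEq β]
    [AddCommMonoid A] (p : β → Prop) [DecidablePred p] (f : α ≃ Subtype p) (T : Perm β → A)
    (s : Finset (Perm β)) (hs : ∀ σ, σ ∈ s ↔ ∀ x, ¬ p x → σ x = x) :
    ∑ σ ∈ s, T σ = ∑ τ : Perm α, T (τ.extendDomain f) := by
  symm
  apply sum_bij (fun τ _ => τ.extendDomain f)
  · intro τ _
    rw [hs]
    intro x hx
    exact Perm.extendDomain_apply_not_subtype τ f hx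
  · intro a _ b _ h
    exact Perm.extendDomainHom_injective f h
  · intro σ hσ
    rw [hs] at hσ
    have h : ∀ x, p (σ x) ↔ p x := by
      intro x
      by_cases hx : p x
      · simp only [hx, iff_true]
        by_contra hn
        have := hσ _ hn
        exact hn (by rw [σ.injective this]; exact hx)
      · rw [hσ x hx]
    refine ⟨f.symm.permCongr (σ.subtypePerm h), mem_univ _, ?_⟩
    ext x
    by_cases hx : p x
    · rw [Perm.extendDomain_apply_subtype _ _ hx]
      simp [Equiv.permCongr_apply]
    · rw [Perm.extendDomain_apply_not_subtype _ _ hx, hσ x hx]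
  · intro _ _; rfl

lemma asym_letters (w : J → Fin N) (S : Finset J) (hinj : Set.InjOn w S) :
    ∑ σ : Perm (Fin N) with ∀ r, r ∉ S.image w → σ r = r, ((Perm.sign σ : ℤˣ) : ℤ) •
      g (fun j => if j ∈ S then σ.symm (w j) else w j) = asym S g w := by
  unfold asym
  have hb : Function.Bijective (fun j : {j // j ∈ S} =>
      (⟨w j, mem_image_of_mem w j.2⟩ : {r // r ∈ S.image w})) := by
    constructor
    · intro x y hxy
      exact Subtype.ext (hinj x.2 y.2 (congrArg Subtype.val hxy))
    · rintro ⟨r, hr⟩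
      obtain ⟨j, hj, rfl⟩ := mem_image.1 hr
      exact ⟨⟨j, hj⟩, rfl⟩
  let e : {j // j ∈ S} ≃ {r // r ∈ S.image w} := Equiv.ofBijective _ hb
  rw [sum_extend (fun r => r ∈ S.image w) e _ _ (by simp),
    sum_extend (fun j => j ∈ S) (Equiv.refl {j // j ∈ S}) _ (fixS S) (fun σ => mem_fixS)]
  rw [← Equiv.sum_comp (Equiv.inv (Perm {j // j ∈ S}))]
  apply sum_congr rfl
  intro τ _
  simp only [Equiv.inv_apply, Perm.sign_extendDomain, Perm.sign_inv]
  congr 2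
  funext j
  by_cases hj : j ∈ S
  · rw [if_pos hj]
    rw [Equiv.symm_apply_eq]
    simp only [Function.comp_apply]
    have h1 : (τ.extendDomain (Equiv.refl {j // j ∈ S})) j = τ ⟨j, hj⟩ := by
      rw [Perm.extendDomain_apply_subtype _ _ hj]; rfl
    rw [h1]
    have h2 := Perm.extendDomain_apply_image τ⁻¹ e (τ ⟨j, hj⟩)
    have h3 : ((e (τ ⟨j, hj⟩) : {r // r ∈ S.image w}) : Fin N) = w (τ ⟨j, hj⟩) := rfl
    rw [h3] at h2
    rw [h2]
    simp [e]
  · rw [if_neg hj]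
    simp only [Function.comp_apply]
    rw [Perm.extendDomain_apply_not_subtype _ _ hj]

variable (b : J → Module.End ℂ F) (Q : Finset J → Module.End ℂ F)

lemma sum_GG (w : J → Fin N) (S : Finset J) :
    ∑ σ : Perm (Fin N), ((Perm.sign σ : ℤˣ) : ℤ) • GG D K g σ (List.finRange N) w S =
      (-1 : ℂ) ^ S.card • CS D K S g w := by
  by_cases hinj : Set.InjOn w S
  · have h1 : ∀ σ : Perm (Fin N), GG D K g σ (List.finRange N) w S =
        if ∀ r, r ∉ S.image w → σ r = r then (-1 : ℂ) ^ S.card • aeval D (chiS K S w)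
          (g (fun j => if j ∈ S then σ.symm (w j) else w j)) else 0 := by
      intro σ
      split_ifs with h
      · rw [GG_formula D K g σ _ w S (List.nodup_finRange N) hinj (by simp)]
        · have : (List.finRange N).toFinset.filter (fun r => σ r ∉ S.image w) = (S.image w)ᶜ := by
            ext r
            simp only [mem_filter, List.mem_toFinset, List.mem_finRange, true_and, mem_compl]
            constructor
            · intro hr hr2
              exact hr ((σ.injective (h _ hr)).symm ▸ hr2)
            · intro hr
              rw [h r hr]; exact hr
          rw [this]; rfl
        · intro r _ hr
          exact σ.injective (h _ hr)
      · push Not at h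
        obtain ⟨y, hy, hyy⟩ := h
        apply Z3 D K g σ (σ.symm y) _ _ _ _ (by simp) (by simpa using hy)
        intro h
        rw [Equiv.apply_symm_apply, Equiv.eq_symm_apply] at h
        exact hyy h
    simp only [h1, smul_ite, smul_zero]
    rw [← sum_filter]
    unfold CS
    rw [← asym_letters g w S hinj, map_sum, smul_sum]
    apply sum_congr rfl
    intro σ _
    rw [map_zsmul, smul_comm]
  · rw [sum_eq_zero]
    · simp [CS, asym_zero S g w hinj]
    · intro σ _
      rw [Z2 D K g σ _ w S (List.nodup_finRange N) hinj, smul_zero]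

theorem normal_order (hQ0 : ∀ x, Q ∅ x = x)
    (hQ1 : ∀ S x, D (Q S x) = Q S (D x) - ∑ l ∈ S, b l (Q S x))
    (hQ2 : ∀ S j x, j ∉ S → b j (Q S x) = Q (insert j S) x) (w : J → Fin N) :
    ∑ σ : Perm (Fin N), ((Perm.sign σ : ℤˣ) : ℤ) • XL D b K σ (List.finRange N) g w =
      ∑ S : Finset J, (-1 : ℂ) ^ S.card • Q S (CS D K S g w) := by
  have h := HH_all D K g b Q hQ1 hQ2 (List.finRange N) [] (by simpa using List.nodup_finRange N)
  have h0 : ∀ c : Fin N → Fin N, evG Q (GG D K g c []) = g := by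
    intro c
    funext w
    simp only [evG, GG, List.foldr_nil, ghat]
    rw [sum_eq_single ∅]
    · simp [hQ0]
    · intro S _ hS
      simp [hS]
    · simp
  rw [List.append_nil] at h
  have h' := congrFun h w
  simp only [HH, h0, Finset.sum_apply, Pi.smul_apply] at h'
  rw [h']
  simp only [XL, List.foldr_nil, evG, smul_sum]
  rw [sum_comm]
  apply sum_congr rfl
  intro S _
  rw [← map_smul, ← sum_GG, map_sum]
  apply sum_congr rfl
  intro σ _
  rw [map_zsmul]

end PartC2
end GaudinAux


namespace GaudinAux
open Finset Polynomial Equiv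

section PartD1
variable {N : ℕ} {Y : Type*} [AddCommGroup Y] [Module ℂ Y]

/-- `gl_N` relations, elementwise -/
def GRel (e : Fin N → Fin N → Module.End ℂ Y) : Prop :=
  ∀ a b c d x, e a b (e c d x) =
    e c d (e a b x) + (if b = c then e a d x else 0) - (if d = a then e c b x else 0)

variable (e : Fin N → Fin N → Module.End ℂ Y)

def Cas : Module.End ℂ Y := ∑ a, ∑ b, e a b * e b a

lemma Cas_apply (x : Y) : Cas e x = ∑ a, ∑ b, e a b (e b a x) := by
  simp [Cas, LinearMap.sum_apply]

lemma Cas_comm (he : GRel e) (c d : Fin N) (x : Y) : e c d (Cas e x) = Cas e (e c d x) := by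
  rw [Cas_apply, Cas_apply]
  simp only [map_sum]
  have h : ∀ a b, e c d (e a b (e b a x)) = e a b (e b a (e c d x)) +
      ((if d = a then e c b (e b a x) else 0) - (if b = c then e a d (e b a x) else 0)
      + (if d = b then e a b (e c a x) else 0) - (if a = c then e a b (e b d x) else 0)) := by
    intro a b
    rw [he c d a b, he c d b a]
    simp only [map_sub, map_add]
    split_ifs <;> (try simp only [map_zero]) <;> abel
  simp only [h, sum_add_distrib, sum_sub_distrib]
  have h1 : ∑ a, ∑ b, (if d = a then e c b (e b a x) else 0) = ∑ b, e c b (e b d x) := by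
    rw [sum_comm]; simp
  have h2 : ∑ a, ∑ b, (if b = c then e a d (e b a x) else 0) = ∑ a, e a d (e c a x) := by
    simp
  have h3 : ∑ a, ∑ b, (if d = b then e a b (e c a x) else 0) = ∑ a, e a d (e c a x) := by
    simp
  have h4 : ∑ a, ∑ b, (if a = c then e a b (e b d x) else 0) = ∑ b, e c b (e b d x) := by
    rw [sum_comm]; simp
  rw [h1, h2, h3, h4]
  abel

def casV {R : Type*} [CommRing R] (μ : Fin N → R) : R :=
  ∑ a, ∑ b, if a = b then μ a * μ a else if a < b then μ a - μ b else 0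

lemma Cas_sing (he : GRel e) (x : Y) (μ : Fin N → ℂ) (h1 : ∀ a b, a < b → e a b x = 0)
    (h2 : ∀ a, e a a x = μ a • x) : Cas e x = casV μ • x := by
  rw [Cas_apply, casV, sum_smul]
  apply sum_congr rfl
  intro a _
  rw [sum_smul]
  apply sum_congr rfl
  intro b _
  rcases lt_trichotomy a b with h | h | h
  · rw [if_neg h.ne, if_pos h, he, h1 a b h]
    simp [h2, sub_smul]
  · subst h
    simp [h2, mul_smul]
  · rw [if_neg h.ne', if_neg (by exact fun h' => absurd h (not_lt.2 h'.le)), h1 b a h]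
    simp

/-- weight spaces -/
def WW (ν : Fin N → ℂ) : Submodule ℂ Y := ⨅ a, (e a a).eigenspace (ν a)

lemma mem_WW (ν : Fin N → ℂ) (x : Y) : x ∈ WW e ν ↔ ∀ a, e a a x = ν a • x := by
  simp [WW, Submodule.mem_iInf, Module.End.mem_eigenspace_iff]

lemma diag_comm (he : GRel e) (a b : Fin N) : Commute (e a a) (e b b) := by
  ext x
  simp only [Module.End.mul_apply]
  rw [he]
  by_cases h : a = b
  · subst h; simp
  · simp [h, Ne.symm h]

lemma WW_indep (he : GRel e) : iSupIndep (fun ν : Fin N → ℂ => WW e ν) := by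
  have := Module.End.independent_iInf_maxGenEigenspace_of_forall_mapsTo
    (fun a : Fin N => e a a) (fun i j φ =>
      Module.End.mapsTo_maxGenEigenspace_of_comm (diag_comm e he j i) φ)
  refine this.mono ?_
  intro ν
  exact iInf_mono (fun a => Module.End.eigenspace_le_maxGenEigenspace)

/-- positive weights -/
def PosW (β : Fin N → ℤ) : Prop := ∀ t : Fin N → ℤ, StrictAnti t → 0 < ∑ a, β a * t a

lemma PosW_root (a b : Fin N) (h : b < a) : PosW (Pi.single b 1 - Pi.single a 1) := by
  intro t ht
  have : ∑ c, (Pi.single b (1 : ℤ) - Pi.single a 1 : Fin N → ℤ) c * t c = t b - t a := by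
    simp [sub_mul, sum_sub_distrib, Pi.single_apply]
  rw [this]
  have := ht h
  omega

lemma PosW_add (β β' : Fin N → ℤ) (h : PosW β) (h' : PosW β') : PosW (β + β') := by
  intro t ht
  have := h t ht
  have := h' t ht
  simp only [Pi.add_apply, add_mul, sum_add_distrib]
  omega

lemma casV_lt (Λ β : Fin N → ℤ) (h : PosW β) (hΛ : ∀ a b : Fin N, a ≤ b → Λ b ≤ Λ a)
    (hμ : ∀ a b : Fin N, a < b → Λ b - β b ≤ Λ a - β a) : casV (Λ - β) < casV Λ := by
  have key : casV Λ - casV (Λ - β) =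
      ∑ a, β a * (Λ a + (Λ a - β a) + ((#(Ioi a) : ℤ) - #(Iio a))) := by
    unfold casV
    have hd : ∀ ν : Fin N → ℤ, ∑ a, ∑ b, (if a = b then ν a * ν a else if a < b then ν a - ν b
        else 0) = ∑ a, (ν a * ν a + ν a * ((#(Ioi a) : ℤ) - #(Iio a))) := by
      intro ν
      have e1 : ∀ a b : Fin N, (if a = b then ν a * ν a else if a < b then ν a - ν b else 0) =
          (if a = b then ν a * ν a else 0) + (if a < b then ν a else 0)
            - (if a < b then ν b else 0) := by
        intro a b
        split_ifs with h1 h2 <;> first | (subst h1; simp at *) | simp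
      simp only [e1, sum_add_distrib, sum_sub_distrib]
      have e2 : ∑ a : Fin N, ∑ b, (if a < b then ν b else 0) = ∑ a, ν a * #(Iio a) := by
        rw [sum_comm]
        apply sum_congr rfl
        intro b _
        rw [← sum_filter]
        simp only [sum_const, nsmul_eq_mul]
        rw [mul_comm]
        congr 3
        ext a; simp
      have e3 : ∑ a : Fin N, ∑ b, (if a < b then ν a else 0) = ∑ a, ν a * #(Ioi a) := by
        apply sum_congr rfl
        intro b _
        rw [← sum_filter]
        simp only [sum_const, nsmul_eq_mul]
        rw [mul_comm]
        congr 3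
        ext a; simp
      rw [e2, e3]
      simp only [sum_ite_eq, mem_univ, if_true, mul_sub, sum_sub_distrib]
      ring
    rw [hd, hd, ← sum_sub_distrib]
    apply sum_congr rfl
    intro a _
    simp only [Pi.sub_apply]
    ring
  have := h (fun a => Λ a + (Λ a - β a) + ((#(Ioi a) : ℤ) - #(Iio a))) (by
    intro a b hab
    have h1 := hΛ a b hab.le
    have h2 := hμ a b hab
    have h3 : #(Ioi b) < #(Ioi a) := by
      rw [Fin.card_Ioi, Fin.card_Ioi]; have := b.2; have : a.1 < b.1 := hab; omega
    have h4 : #(Iio a) < #(Iio b) := by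
      rw [Fin.card_Iio, Fin.card_Iio]; exact hab
    simp only
    omega)
  rw [← key] at this
  omega

/-- submodule generated by lowering operators -/
def Gam (γ : Y) : Submodule ℂ Y :=
  sInf {W | (∀ a b : Fin N, b < a → ∀ x ∈ W, e a b x ∈ W) ∧ γ ∈ W}

lemma Gam_mem (γ : Y) : γ ∈ Gam e γ := by
  rw [Gam, Submodule.mem_sInf]
  exact fun p hp => hp.2

lemma Gam_low (γ : Y) (a b : Fin N) (h : b < a) (x : Y) (hx : x ∈ Gam e γ) :
    e a b x ∈ Gam e γ := by
  rw [Gam, Submodule.mem_sInf] at hx ⊢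
  exact fun p hp => hp.1 a b h x (hx p hp)

lemma Gam_le (γ : Y) (W : Submodule ℂ Y) (h : ∀ a b : Fin N, b < a → ∀ x ∈ W, e a b x ∈ W)
    (hγ : γ ∈ W) : Gam e γ ≤ W := sInf_le ⟨h, hγ⟩

lemma Gam_inv (he : GRel e) (γ : Y) (Λ : Fin N → ℂ) (h1 : ∀ a b, a < b → e a b γ = 0)
    (h2 : ∀ a, e a a γ = Λ a • γ) (c d : Fin N) (x : Y) (hx : x ∈ Gam e γ) :
    e c d x ∈ Gam e γ := by
  let B : Submodule ℂ Y := Gam e γ ⊓ ⨅ c, ⨅ d, (Gam e γ).comap (e c d)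
  have hB : ∀ x, x ∈ B ↔ x ∈ Gam e γ ∧ ∀ c d, e c d x ∈ Gam e γ := by
    intro x
    simp [B, Submodule.mem_iInf]
  have : Gam e γ ≤ B := by
    apply Gam_le
    · intro a b hab x hx
      rw [hB] at hx ⊢
      refine ⟨Gam_low e γ a b hab x hx.1, ?_⟩
      intro c d
      rw [he]
      refine Submodule.sub_mem _ (Submodule.add_mem _ ?_ ?_) ?_
      · exact Gam_low e γ a b hab _ (hx.2 c d)
      · split_ifs
        · exact hx.2 _ _
        · exact Submodule.zero_mem _
      · split_ifs
        · exact hx.2 _ _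
        · exact Submodule.zero_mem _
    · rw [hB]
      refine ⟨Gam_mem e γ, ?_⟩
      intro c d
      rcases lt_trichotomy c d with h | h | h
      · rw [h1 c d h]; exact Submodule.zero_mem _
      · subst h; rw [h2]; exact Submodule.smul_mem _ _ (Gam_mem e γ)
      · exact Gam_low e γ c d h _ (Gam_mem e γ)
  exact ((hB x).1 (this hx)).2 c d

lemma WW_low (he : GRel e) (ν : Fin N → ℂ) (a b : Fin N) (x : Y) (hx : x ∈ WW e ν) :
    e a b x ∈ WW e (ν + Pi.single a 1 - Pi.single b 1) := by
  rw [mem_WW] at hx ⊢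
  intro c
  rw [he, hx c]
  simp only [Pi.add_apply, Pi.sub_apply, Pi.single_apply]
  by_cases h1 : c = a <;> by_cases h2 : b = c
  · subst h1; subst h2; simp
  · subst h1; simp [h2, Ne.symm h2, add_smul]
  · subst h2; simp [h1, sub_smul]
  · simp [h1, h2, Ne.symm h2]

lemma Gam_weights (he : GRel e) (γ : Y) (Λ : Fin N → ℤ) (h1 : ∀ a b, a < b → e a b γ = 0)
    (h2 : ∀ a, e a a γ = (Λ a : ℂ) • γ) :
    Gam e γ ≤ (ℂ ∙ γ) ⊔ ⨆ β : {β : Fin N → ℤ // PosW β},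
      WW e (fun a => ((Λ a - β.1 a : ℤ) : ℂ)) := by
  have hγ : γ ∈ WW e (fun a => (Λ a : ℂ)) := by rw [mem_WW]; exact h2
  apply Gam_le
  · intro a b hab
    suffices h : (ℂ ∙ γ) ⊔ (⨆ β : {β : Fin N → ℤ // PosW β},
      WW e (fun a => ((Λ a - β.1 a : ℤ) : ℂ))) ≤ Submodule.comap (e a b) ((ℂ ∙ γ) ⊔
        ⨆ β : {β : Fin N → ℤ // PosW β}, WW e (fun a => ((Λ a - β.1 a : ℤ) : ℂ))) from
      fun x hx => h hx
    apply sup_le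
    · rw [Submodule.span_singleton_le_iff_mem, Submodule.mem_comap]
      apply Submodule.mem_sup_right
      apply Submodule.mem_iSup_of_mem ⟨_, PosW_root a b hab⟩
      have := WW_low e he _ a b γ hγ
      convert this using 2
      funext c
      simp [Pi.single_apply]
      split_ifs <;> simp
    · apply iSup_le
      intro β x hx
      rw [Submodule.mem_comap]
      apply Submodule.mem_sup_right
      apply Submodule.mem_iSup_of_mem ⟨_, PosW_add _ _ β.2 (PosW_root a b hab)⟩
      have := WW_low e he _ a b x hx
      convert this using 2
      funext c
      simp [Pi.single_apply]
      split_ifs <;> simp <;> ring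
  · exact Submodule.mem_sup_left (Submodule.mem_span_singleton_self γ)

lemma weight_vec (he : GRel e) (γ : Y) (Λ : Fin N → ℤ) (h1 : ∀ a b, a < b → e a b γ = 0)
    (h2 : ∀ a, e a a γ = (Λ a : ℂ) • γ) (x : Y) (hx : x ∈ Gam e γ) (hx0 : x ≠ 0)
    (μ : Fin N → ℂ) (hμ : ∀ a, e a a x = μ a • x) :
    (∃ β, PosW β ∧ ∀ a, μ a = ((Λ a - β a : ℤ) : ℂ)) ∨ ∃ t : ℂ, x = t • γ := by
  by_cases hc : ∃ β, PosW β ∧ ∀ a, μ a = ((Λ a - β a : ℤ) : ℂ)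
  · exact Or.inl hc
  right
  have hxW : x ∈ WW e μ := by rw [mem_WW]; exact hμ
  have hγ : γ ∈ WW e (fun a => (Λ a : ℂ)) := by rw [mem_WW]; exact h2
  obtain ⟨y, hy, s, hs, hys⟩ := Submodule.mem_sup.1 (Gam_weights e he γ Λ h1 h2 hx)
  obtain ⟨t, rfl⟩ := Submodule.mem_span_singleton.1 hy
  have hdis := WW_indep e he μ
  have hs' : s ∈ ⨆ ν, ⨆ (_ : ν ≠ μ), WW e ν := by
    refine (iSup_le ?_ : (⨆ β : {β : Fin N → ℤ // PosW β},
      WW e (fun a => ((Λ a - β.1 a : ℤ) : ℂ))) ≤ _) hs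
    intro β
    refine le_iSup₂_of_le (fun a => ((Λ a - β.1 a : ℤ) : ℂ)) ?_ le_rfl
    intro h
    exact hc ⟨β.1, β.2, fun a => (congrFun h a).symm⟩
  by_cases hL : (fun a => (Λ a : ℂ)) = μ
  · refine ⟨t, ?_⟩
    rw [hL] at hγ
    have h3 : x - t • γ ∈ WW e μ := Submodule.sub_mem _ hxW (Submodule.smul_mem _ _ hγ)
    have h4 : x - t • γ = s := by rw [← hys]; abel
    have := Submodule.disjoint_def.1 hdis _ h3 (h4 ▸ hs')
    exact sub_eq_zero.1 this
  · exfalso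
    apply hx0
    refine Submodule.disjoint_def.1 hdis _ hxW ?_
    rw [← hys]
    refine Submodule.add_mem _ (Submodule.smul_mem _ _ ?_) hs'
    exact (le_iSup₂_of_le (f := fun ν (_ : ν ≠ μ) => WW e ν) (fun a => (Λ a : ℂ)) hL le_rfl) hγ

variable [FiniteDimensional ℂ Y]

lemma sl2_dom (he : GRel e) (x : Y) (hx0 : x ≠ 0) (μ : Fin N → ℂ)
    (h1 : ∀ a b, a < b → e a b x = 0) (hμ : ∀ a, e a a x = μ a • x) (a b : Fin N) (hab : a < b) :
    ∃ n : ℕ, μ a - μ b = n := by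
  by_cases h0 : e a a - e b b = 0
  · refine ⟨0, ?_⟩
    have : (e a a - e b b) x = 0 := by rw [h0]; rfl
    rw [LinearMap.sub_apply, hμ, hμ, ← sub_smul] at this
    simpa [hx0] using this
  · have hne : a ≠ b := hab.ne
    letI : LieRing (Module.End ℂ Y) := LieRing.ofAssociativeRing
    have t : IsSl2Triple (e a a - e b b) (e a b) (e b a) := by
      refine ⟨h0, ?_, ?_, ?_⟩
      · ext y
        simp only [LieRing.of_associative_ring_bracket, LinearMap.sub_apply, Module.End.mul_apply]
        rw [he a b b a]; simp; abel
      · ext y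
        simp only [LieRing.of_associative_ring_bracket, LinearMap.sub_apply, Module.End.mul_apply,
          map_sub]
        rw [he a a a b, he b b a b]
        simp [hne, hne.symm, two_smul]
        abel
      · ext y
        simp only [LieRing.of_associative_ring_bracket, LinearMap.sub_apply, Module.End.mul_apply,
          map_sub]
        rw [he a a b a, he b b b a]
        simp [hne, hne.symm, two_smul]
        abel
    have hp : t.HasPrimitiveVectorWith x (μ a - μ b) := by
      refine ⟨hx0, ?_, ?_⟩
      · change (e a a - e b b) x = _
        rw [LinearMap.sub_apply, hμ, hμ, sub_smul]
      · exact h1 a b hab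
    exact hp.exists_nat

/-- simultaneous eigenvectors -/
lemma joint_eig (he : GRel e) (P : Submodule ℂ Y) (hP : P ≠ ⊥)
    (hinv : ∀ a, ∀ x ∈ P, e a a x ∈ P) :
    ∃ μ : Fin N → ℂ, ∃ x ∈ P, x ≠ 0 ∧ ∀ a, e a a x = μ a • x := by
  have key : ∀ s : Finset (Fin N), ∃ μ : Fin N → ℂ,
      P ⊓ (⨅ a ∈ s, (e a a).eigenspace (μ a)) ≠ ⊥ := by
    intro s
    induction s using Finset.induction_on with
    | empty => exact ⟨0, by simpa using hP⟩
    | insert c s hc ih =>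
      obtain ⟨μ, hμ⟩ := ih
      set R := P ⊓ (⨅ a ∈ s, (e a a).eigenspace (μ a)) with hR
      have hmem : ∀ x, x ∈ R ↔ x ∈ P ∧ ∀ a ∈ s, e a a x = μ a • x := by
        intro x
        simp [hR, Submodule.mem_iInf, Module.End.mem_eigenspace_iff]
      have hRinv : ∀ x ∈ R, e c c x ∈ R := by
        intro x hx
        rw [hmem] at hx ⊢
        refine ⟨hinv c x hx.1, fun a ha => ?_⟩
        have := congrArg (fun f : Module.End ℂ Y => f x) (diag_comm e he a c).eq
        simp only [Module.End.mul_apply] at this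
        rw [this, hx.2 a ha, map_smul]
      have : Nontrivial R := Submodule.nontrivial_iff_ne_bot.2 hμ
      obtain ⟨ν, hν⟩ := Module.End.exists_eigenvalue ((e c c).restrict hRinv)
      obtain ⟨x, hx⟩ := hν.exists_hasEigenvector
      have hxe : e c c (x : Y) = ν • (x : Y) := congrArg Subtype.val hx.apply_eq_smul
      refine ⟨Function.update μ c ν, ?_⟩
      rw [Submodule.ne_bot_iff]
      refine ⟨x, ?_, fun h => hx.2 (Subtype.ext h)⟩
      have hxR := (hmem x).1 x.2
      simp only [Submodule.mem_inf, Submodule.mem_iInf, Module.End.mem_eigenspace_iff]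
      refine ⟨hxR.1, fun a ha => ?_⟩
      by_cases hac : a = c
      · subst hac; simpa using hxe
      · rw [Function.update_of_ne hac]
        exact hxR.2 a ((mem_insert.1 ha).resolve_left hac)
  obtain ⟨μ, hμ⟩ := key univ
  obtain ⟨x, hx, hx0⟩ := (Submodule.ne_bot_iff _).1 hμ
  simp only [Submodule.mem_inf, Submodule.mem_iInf, Module.End.mem_eigenspace_iff] at hx
  exact ⟨μ, x, hx.1, hx0, fun a => hx.2 a (mem_univ a)⟩

def rhoO : Module.End ℂ Y := ∑ c : Fin N, (-(c.1 : ℂ)) • e c c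

lemma rho_comm (he : GRel e) (a b : Fin N) (x : Y) :
    rhoO e (e a b x) = e a b (rhoO e x) + ((b.1 : ℂ) - a.1) • e a b x := by
  simp only [rhoO, LinearMap.sum_apply, LinearMap.smul_apply, map_sum, map_smul]
  have : ∀ c, e c c (e a b x) = e a b (e c c x) + (if c = a then e a b x else 0)
      - (if c = b then e a b x else 0) := by
    intro c
    rw [he]
    by_cases h1 : c = a <;> by_cases h2 : c = b
    · subst h1; subst h2; simp
    · subst h1; simp [h2, Ne.symm h2]
    · subst h2; simp [h1]
    · simp [h1, h2, Ne.symm h2]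
  simp only [this, smul_sub, smul_add, sum_add_distrib, sum_sub_distrib, smul_ite, smul_zero,
    sum_ite_eq', mem_univ, if_true, sub_smul, neg_smul]
  abel

lemma exists_sing (he : GRel e) (L : Submodule ℂ Y) (hL : L ≠ ⊥)
    (hinv : ∀ a b, ∀ x ∈ L, e a b x ∈ L) :
    ∃ μ : Fin N → ℂ, ∃ x ∈ L, x ≠ 0 ∧ (∀ a b, a < b → e a b x = 0) ∧ ∀ a, e a a x = μ a • x := by
  have hr : ∀ x ∈ L, rhoO e x ∈ L := by
    intro x hx
    simp only [rhoO, LinearMap.sum_apply, LinearMap.smul_apply]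
    exact Submodule.sum_mem _ (fun c _ => Submodule.smul_mem _ _ (hinv c c x hx))
  have : Nontrivial L := Submodule.nontrivial_iff_ne_bot.2 hL
  let R : Module.End ℂ L := (rhoO e).restrict hr
  obtain ⟨l0, hl0⟩ := Module.End.exists_eigenvalue R
  have hfin := Module.End.finite_hasEigenvalue R
  obtain ⟨l, hl, hmax⟩ := Finset.exists_max_image hfin.toFinset Complex.re
    ⟨l0, by simpa using hl0⟩
  have hl' : R.HasEigenvalue l := by simpa using hl
  let P : Submodule ℂ Y := L ⊓ (rhoO e).eigenspace l
  have hPm : ∀ x, x ∈ P ↔ x ∈ L ∧ rhoO e x = l • x := by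
    intro x; simp [P, Module.End.mem_eigenspace_iff]
  have hsing : ∀ x ∈ P, ∀ a b, a < b → e a b x = 0 := by
    intro x hx a b hab
    rw [hPm] at hx
    by_contra hne
    have hev : R.HasEigenvalue (l + ((b.1 : ℂ) - a.1)) := by
      apply Module.End.hasEigenvalue_of_hasEigenvector (x := ⟨e a b x, hinv a b x hx.1⟩)
      refine ⟨?_, fun h => hne (congrArg Subtype.val h)⟩
      rw [Module.End.mem_eigenspace_iff]
      apply Subtype.ext
      change rhoO e (e a b x) = (l + ((b.1 : ℂ) - a.1)) • e a b x
      rw [rho_comm e he, hx.2, map_smul, add_smul]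
    have := hmax _ (by simpa using hev)
    simp at this
    have h2 : a.1 < b.1 := hab
    omega
  have hP : P ≠ ⊥ := by
    obtain ⟨x, hx⟩ := hl'.exists_hasEigenvector
    rw [Submodule.ne_bot_iff]
    exact ⟨x, (hPm _).2 ⟨x.2, congrArg Subtype.val hx.apply_eq_smul⟩,
      fun h => hx.2 (Subtype.ext h)⟩
  obtain ⟨μ, x, hx, hx0, hxe⟩ := joint_eig e he P hP (by
    intro a x hx
    rw [hPm] at hx ⊢
    refine ⟨hinv a a x hx.1, ?_⟩
    rw [rho_comm e he, hx.2, map_smul]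
    simp)
  exact ⟨μ, x, ((hPm x).1 hx).1, hx0, hsing x hx, hxe⟩

/-- irreducibility of finite-dimensional highest weight modules -/
theorem irred (he : GRel e) (γ : Y) (Λ : Fin N → ℤ) (hΛ : ∀ a b : Fin N, a ≤ b → Λ b ≤ Λ a)
    (h1 : ∀ a b, a < b → e a b γ = 0) (h2 : ∀ a, e a a γ = (Λ a : ℂ) • γ)
    (L : Submodule ℂ Y) (hL : L ≠ ⊥) (hinv : ∀ a b, ∀ x ∈ L, e a b x ∈ L)
    (hLG : L ≤ Gam e γ) : γ ∈ L := by
  obtain ⟨μ, x, hxL, hx0, hxs, hxe⟩ := exists_sing e he L hL hinv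
  have hcas : Gam e γ ≤ LinearMap.ker (Cas e - casV (fun a => (Λ a : ℂ)) • 1) := by
    apply Gam_le
    · intro a b _ y hy
      rw [LinearMap.mem_ker, LinearMap.sub_apply, sub_eq_zero] at hy ⊢
      rw [← Cas_comm e he, hy]
      simp
    · rw [LinearMap.mem_ker, LinearMap.sub_apply, sub_eq_zero, Cas_sing e he γ _ h1 h2]
      simp
  rcases weight_vec e he γ Λ h1 h2 x (hLG hxL) hx0 μ hxe with ⟨β, hβ, hμ⟩ | ⟨t, ht⟩
  · exfalso
    have h3 := hcas (hLG hxL)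
    rw [LinearMap.mem_ker, LinearMap.sub_apply, sub_eq_zero, Cas_sing e he x μ hxs hxe] at h3
    have h4 : casV μ = casV (fun a => (Λ a : ℂ)) := by
      simpa using smul_left_injective ℂ hx0 h3
    have h5 : ((casV (Λ - β) : ℤ) : ℂ) = ((casV Λ : ℤ) : ℂ) := by
      have e1 : ∀ ν : Fin N → ℤ, ((casV ν : ℤ) : ℂ) = casV (fun a => (ν a : ℂ)) := by
        intro ν
        simp only [casV]
        push_cast
        rfl
      rw [e1, e1, ← h4]
      congr 1
      funext a
      rw [hμ a]; simp
    have h6 := casV_lt Λ β hβ hΛ (by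
      intro a b hab
      obtain ⟨n, hn⟩ := sl2_dom e he x hx0 μ hxs hxe a b hab
      rw [hμ, hμ] at hn
      have : (Λ a - β a) - (Λ b - β b) = (n : ℤ) := by exact_mod_cast hn
      omega)
    have h7 : casV (Λ - β) = casV Λ := by exact_mod_cast h5
    omega
  · have ht0 : t ≠ 0 := by
      rintro rfl
      exact hx0 (by rw [ht, zero_smul])
    have : γ = t⁻¹ • x := by rw [ht, smul_smul, inv_mul_cancel₀ ht0, one_smul]
    rw [this]
    exact Submodule.smul_mem _ _ hxL

end PartD1
end GaudinAux


namespace GaudinAux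
open Finset Polynomial Equiv

section PartD2
variable {N : ℕ} {J : Type*} [Fintype J] [DecidableEq J]

/-- one-site operators on word functions -/
def eS (j : J) (a b : Fin N) : Module.End ℂ ((J → Fin N) → ℂ) where
  toFun g := fun w => if w j = a then g (Function.update w j b) else 0
  map_add' f g := by funext w; simp only [Pi.add_apply]; split_ifs <;> simp
  map_smul' c g := by
    funext w; simp only [Pi.smul_apply, RingHom.id_apply]; split_ifs <;> simp

lemma eS_apply (j : J) (a b : Fin N) (g : (J → Fin N) → ℂ) (w : J → Fin N) :
    eS j a b g w = if w j = a then g (Function.update w j b) else 0 := rfl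

lemma eS_comm (j k : J) (a b c d : Fin N) (g : (J → Fin N) → ℂ) :
    eS j a b (eS k c d g) = eS k c d (eS j a b g) + (if j = k then
      (if b = c then eS j a d g else 0) - (if d = a then eS j c b g else 0) else 0) := by
  by_cases h : j = k
  · subst h
    rw [if_pos rfl]
    have : ∀ a b c d : Fin N, eS j a b (eS j c d g) = if b = c then eS j a d g else 0 := by
      intro a b c d
      funext w
      simp only [eS_apply]
      by_cases h2 : b = c
      · subst h2
        simp [eS_apply]
      · simp [h2]
    rw [this, this]
    split_ifs <;> simp
  · rw [if_neg h, add_zero]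
    funext w
    simp only [eS_apply]
    rw [Function.update_of_ne (Ne.symm h), Function.update_of_ne h, Function.update_comm h]
    split_ifs <;> rfl

def eW (a b : Fin N) : Module.End ℂ ((J → Fin N) → ℂ) := ∑ j, eS j a b

lemma eW_apply (a b : Fin N) (g : (J → Fin N) → ℂ) : eW a b g = ∑ j, eS j a b g := by
  simp [eW, LinearMap.sum_apply]

lemma eW_rel : GRel (eW (N := N) (J := J)) := by
  intro a b c d g
  simp only [eW_apply, map_sum]
  rw [sum_comm]
  rw [sum_congr rfl (fun j _ => sum_congr rfl (fun k _ => eS_comm j k a b c d g))]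
  simp only [sum_add_distrib]
  rw [add_sub_assoc]
  congr 1
  simp only [sum_ite_eq, mem_univ, if_true, sum_sub_distrib]
  split_ifs <;> simp

lemma sum_flip {A : Type*} [AddCommMonoid A] (H : (J → Fin N) → (J → Fin N) → A) (j : J)
    (a b : Fin N) :
    ∑ w : J → Fin N, (if w j = a then H (Function.update w j b) w else 0) =
      ∑ w : J → Fin N, if w j = b then H w (Function.update w j a) else 0 := by
  rw [← sum_filter, ← sum_filter]
  refine sum_bij' (fun w _ => Function.update w j b) (fun w _ => Function.update w j a)
    ?_ ?_ ?_ ?_ ?_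
  · intro w hw; simp
  · intro w hw; simp
  · intro w hw
    simp only [mem_filter, mem_univ, true_and] at hw
    simp [← hw]
  · intro w hw
    simp only [mem_filter, mem_univ, true_and] at hw
    simp [← hw]
  · intro w hw
    simp only [mem_filter, mem_univ, true_and] at hw
    simp [← hw]

lemma compl_inv (A : Submodule ℂ ((J → Fin N) → ℂ))
    (hA : ∀ a b, ∀ x ∈ A, eW a b x ∈ A) :
    ∃ C : Submodule ℂ ((J → Fin N) → ℂ), IsCompl A C ∧ ∀ a b, ∀ x ∈ C, eW a b x ∈ C := by
  let L : EuclideanSpace ℂ (J → Fin N) ≃ₗ[ℂ] ((J → Fin N) → ℂ) := WithLp.linearEquiv 2 ℂ _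
  let A' : Submodule ℂ (EuclideanSpace ℂ (J → Fin N)) := A.comap L.toLinearMap
  have hc : IsCompl A' A'ᗮ := Submodule.isCompl_orthogonal _
  refine ⟨A'ᗮ.comap L.symm.toLinearMap, ?_, ?_⟩
  · have h := (Submodule.orderIsoMapComap L.symm).symm.isCompl_iff.1 hc
    have hAA : A = (Submodule.orderIsoMapComap L.symm).symm A' := by
      refine Submodule.ext fun x => ?_
      change x ∈ A ↔ L (L.symm x) ∈ A
      rw [LinearEquiv.apply_symm_apply]
    rw [hAA]
    exact h
  · intro a b x hx
    rw [Submodule.mem_comap, Submodule.mem_orthogonal] at hx ⊢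
    intro y hy
    have h1 := hx (L.symm (eW b a (L y))) (by
      change L (L.symm (eW b a (L y))) ∈ A
      rw [LinearEquiv.apply_symm_apply]
      exact hA b a _ hy)
    have h2 : ∀ y x : (J → Fin N) → ℂ, inner ℂ (L.symm y) (L.symm x) =
        ∑ w, x w * (starRingEnd ℂ) (y w) := by
      intro y x
      rw [PiLp.inner_apply]
      rfl
    have h3 : y = L.symm (L y) := (LinearEquiv.symm_apply_apply L y).symm
    rw [h3]
    change inner ℂ (L.symm (L y)) (L.symm (eW a b x)) = 0
    change inner ℂ (L.symm (eW b a (L y))) (L.symm x) = 0 at h1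
    rw [h2] at h1 ⊢
    rw [← h1]
    simp only [eW_apply, Finset.sum_apply, map_sum, sum_mul, mul_sum]
    rw [sum_comm]
    conv_rhs => rw [sum_comm]
    apply sum_congr rfl
    intro j _
    have := sum_flip (fun w w' => x w * (starRingEnd ℂ) (L y w')) j a b
    simp only [eS_apply]
    convert this using 1
    · apply sum_congr rfl
      intro w _
      split_ifs <;> simp
    · apply sum_congr rfl
      intro w _
      split_ifs <;> simp

end PartD2

section PartD3
variable {N : ℕ}

/-- boxes of the Young diagram -/
abbrev Jt (Λ : Fin N → ℤ) : Type := Σ a : Fin N, Fin (Λ a).toNat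

variable (Λ : Fin N → ℤ)

def Col : Finset (Perm (Jt Λ)) := univ.filter fun τ => ∀ p, (τ p).2.val = p.2.val

def AA (w' : Jt Λ → Fin N) : (Jt Λ → Fin N) → ℂ := fun w =>
  ∑ τ ∈ Col Λ, if w = w' ∘ τ then (((Perm.sign τ : ℤˣ) : ℤ) : ℂ) else 0

lemma eW_AA (a b : Fin N) (w' : Jt Λ → Fin N) :
    eW a b (AA Λ w') = ∑ k, if w' k = b then AA Λ (Function.update w' k a) else 0 := by
  funext w
  rw [eW_apply, Finset.sum_apply, Finset.sum_apply]
  simp only [eS_apply]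
  have h1 : ∀ j, (if w j = a then AA Λ w' (Function.update w j b) else 0) =
      ∑ τ ∈ Col Λ, if w j = a ∧ Function.update w j b = w' ∘ τ then
        (((Perm.sign τ : ℤˣ) : ℤ) : ℂ) else 0 := by
    intro j
    by_cases h : w j = a
    · simp [h, AA]
    · simp [h]
  have h2 : ∀ k, (if w' k = b then AA Λ (Function.update w' k a) else 0) w =
      ∑ τ ∈ Col Λ, if w' k = b ∧ w = Function.update w' k a ∘ τ then
        (((Perm.sign τ : ℤˣ) : ℤ) : ℂ) else 0 := by
    intro j
    by_cases h : w' j = b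
    · simp [h, AA]
    · simp [h]
  simp only [h1, h2]
  rw [sum_comm]
  conv_rhs => rw [sum_comm]
  apply sum_congr rfl
  intro τ _
  conv_rhs => rw [← Equiv.sum_comp τ]
  apply sum_congr rfl
  intro j _
  congr 1
  rw [eq_iff_iff]
  constructor
  · rintro ⟨h, h'⟩
    have hb : w' (τ j) = b := by
      have := congrFun h' j
      simpa using this.symm
    refine ⟨hb, ?_⟩
    funext k
    by_cases hk : k = j
    · subst hk; simp [h]
    · have := congrFun h' k
      rw [Function.update_of_ne hk] at this
      simp only [Function.comp_apply] at this ⊢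
      rw [Function.update_of_ne (fun h => hk (τ.injective h)), this]
  · rintro ⟨h, h'⟩
    refine ⟨by rw [h']; simp, ?_⟩
    funext k
    by_cases hk : k = j
    · subst hk; simp [h]
    · rw [Function.update_of_ne hk, h']
      simp only [Function.comp_apply]
      rw [Function.update_of_ne (fun h => hk (τ.injective h))]

lemma AA_zero (w' : Jt Λ → Fin N) (p q : Jt Λ) (hpq : p ≠ q) (hc : p.2.val = q.2.val)
    (hw : w' p = w' q) : AA Λ w' = 0 := by
  have hs : w' ∘ swap p q = w' := by
    funext k
    simp only [Function.comp_apply]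
    by_cases h1 : k = p
    · subst h1; simp [hw]
    · by_cases h2 : k = q
      · subst h2; simp [hw]
      · rw [swap_apply_of_ne_of_ne h1 h2]
  have hcs : ∀ k, (swap p q k).2.val = k.2.val := by
    intro k
    by_cases h1 : k = p
    · subst h1; rw [swap_apply_left]; exact hc.symm
    · by_cases h2 : k = q
      · subst h2; rw [swap_apply_right]; exact hc
      · rw [swap_apply_of_ne_of_ne h1 h2]
  funext w
  simp only [AA, Pi.zero_apply]
  have : ∀ τ : Perm (Jt Λ), w' ∘ (swap p q * τ : Perm (Jt Λ)) = w' ∘ τ := by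
    intro τ
    rw [Perm.coe_mul, ← Function.comp_assoc, hs]
  apply sum_involution (fun τ _ => swap p q * τ)
  · intro τ hτ
    rw [this, Perm.sign_mul, Perm.sign_swap hpq]
    split_ifs <;> simp
  · intro τ hτ _ h
    have : swap p q = 1 := by
      have := congrArg (fun σ => σ * τ⁻¹) h
      simpa using this
    exact hpq (by simpa [Equiv.swap_eq_one_iff] using this)
  · intro τ hτ
    simp only [Col, mem_filter, mem_univ, true_and] at hτ ⊢
    intro k
    rw [Perm.mul_apply, hcs, hτ]
  · intro τ hτ
    simp [← mul_assoc]

def w00 : Jt Λ → Fin N := fun p => p.1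

lemma AA_w00 : AA Λ (w00 Λ) (w00 Λ) = 1 := by
  rw [AA, sum_eq_single 1]
  · simp
  · intro τ hτ h1
    rw [if_neg]
    intro h
    apply h1
    simp only [Col, mem_filter, mem_univ, true_and] at hτ
    ext p : 1
    have h2 : p.1 = (τ p).1 := congrFun h p
    have h3 := hτ p
    simp only [Perm.one_apply]
    generalize τ p = q at h2 h3
    obtain ⟨a, x⟩ := p
    obtain ⟨b, y⟩ := q
    simp only at h2 h3
    subst h2
    rw [Fin.ext h3]
  · intro h
    exfalso; apply h
    simp [Col]

lemma AA_raise (hΛ : ∀ a b : Fin N, a ≤ b → Λ b ≤ Λ a) (a b : Fin N) (hab : a < b) :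
    eW a b (AA Λ (w00 Λ)) = 0 := by
  rw [eW_AA]
  apply sum_eq_zero
  rintro ⟨c, x⟩ _
  split_ifs with h
  · have hcb : c = b := h
    subst hcb
    have hx : x.1 < (Λ a).toNat := lt_of_lt_of_le x.2 (Int.toNat_le_toNat (hΛ a c hab.le))
    have hne : (⟨c, x⟩ : Jt Λ) ≠ ⟨a, ⟨x.1, hx⟩⟩ := by
      intro h
      exact hab.ne (congrArg Sigma.fst h).symm
    apply AA_zero Λ _ ⟨c, x⟩ ⟨a, ⟨x.1, hx⟩⟩ hne rfl
    rw [Function.update_self, Function.update_of_ne hne.symm]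
    rfl
  · rfl

lemma AA_weight (hΛ0 : ∀ a, 0 ≤ Λ a) (a : Fin N) :
    eW a a (AA Λ (w00 Λ)) = (Λ a : ℂ) • AA Λ (w00 Λ) := by
  rw [eW_AA]
  have : ∀ k : Jt Λ, (if w00 Λ k = a then AA Λ (Function.update (w00 Λ) k a) else 0) =
      if k.1 = a then AA Λ (w00 Λ) else 0 := by
    intro k
    by_cases h : k.1 = a
    · rw [if_pos h, if_pos (show w00 Λ k = a from h)]
      congr 1
      have : a = w00 Λ k := h.symm
      rw [this, Function.update_eq_self]
    · rw [if_neg h, if_neg (show ¬ w00 Λ k = a from h)]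
  simp only [this]
  rw [Fintype.sum_sigma]
  rw [sum_eq_single a]
  · simp only [if_true, sum_const, card_univ, Fintype.card_fin]
    rw [← Nat.cast_smul_eq_nsmul ℂ]
    congr 1
    have := Int.toNat_of_nonneg (hΛ0 a)
    exact_mod_cast congrArg (fun x : ℤ => (x : ℂ)) this
  · intro c _ hc
    simp [hc]
  · simp

variable {V : Type*} [AddCommGroup V] [Module ℂ V] [FiniteDimensional ℂ V]

/-- existence of a surjective intertwiner from words -/
theorem intertwiner (e : Fin N → Fin N → Module.End ℂ V) (he : GRel e)
    (hΛ : ∀ a b : Fin N, a ≤ b → Λ b ≤ Λ a) (hΛ0 : ∀ a, 0 ≤ Λ a) (v : V)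
    (h1 : ∀ a b, a < b → e a b v = 0) (h2 : ∀ a, e a a v = (Λ a : ℂ) • v)
    (hgen : ∀ W : Submodule ℂ V, (∀ a b : Fin N, ∀ x ∈ W, e a b x ∈ W) → v ∈ W → ∀ x, x ∈ W) :
    ∃ π : ((Jt Λ → Fin N) → ℂ) →ₗ[ℂ] V, Function.Surjective π ∧
      ∀ a b f, π (eW a b f) = e a b (π f) := by
  let e' : Fin N → Fin N → Module.End ℂ (V × ((Jt Λ → Fin N) → ℂ)) :=
    fun a b => (e a b).prodMap (eW a b)
  have he' : GRel e' := by
    intro a b c d x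
    have := he a b c d x.1
    have := eW_rel a b c d x.2
    apply Prod.ext
    · change e a b (e c d x.1) = _
      rw [he a b c d x.1]
      simp only [e', Prod.fst_sub, Prod.fst_add]
      split_ifs <;> rfl
    · change eW a b (eW c d x.2) = _
      rw [eW_rel a b c d x.2]
      simp only [e', Prod.snd_sub, Prod.snd_add]
      split_ifs <;> rfl
  set om := AA Λ (w00 Λ) with hom
  let γ : V × ((Jt Λ → Fin N) → ℂ) := (v, om)
  have g1 : ∀ a b, a < b → e' a b γ = 0 := by
    intro a b hab
    change (e a b v, eW a b om) = 0
    rw [h1 a b hab, hom, AA_raise Λ hΛ a b hab]; rfl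
  have g2 : ∀ a, e' a a γ = (Λ a : ℂ) • γ := by
    intro a
    change (e a a v, eW a a om) = _
    rw [h2 a, hom, AA_weight Λ hΛ0 a]; rfl
  set Γ := Gam e' γ with hΓ
  have hΓinv : ∀ a b, ∀ x ∈ Γ, e' a b x ∈ Γ := fun a b x hx =>
    Gam_inv e' he' γ _ g1 g2 a b x hx
  have hΓ0 : ∀ x : V, (x, (0 : (Jt Λ → Fin N) → ℂ)) ∈ Γ → x = 0 := by
    intro x hx
    by_contra hne
    let L := Γ ⊓ LinearMap.ker (LinearMap.snd ℂ V ((Jt Λ → Fin N) → ℂ))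
    have hγL : γ ∈ L := by
      apply irred e' he' γ Λ hΛ g1 g2 L
      · rw [Submodule.ne_bot_iff]
        exact ⟨(x, 0), ⟨hx, rfl⟩, fun h => hne (congrArg Prod.fst h)⟩
      · intro a b y hy
        refine ⟨hΓinv a b y hy.1, ?_⟩
        have hy2 : y.2 = 0 := hy.2
        change eW a b y.2 = 0
        rw [hy2, map_zero]
      · exact inf_le_left
    have h0 : om = 0 := hγL.2
    have := AA_w00 Λ
    rw [← hom, h0] at this
    simp at this
  let A := Γ.map (LinearMap.snd ℂ V ((Jt Λ → Fin N) → ℂ))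
  obtain ⟨C, hC, hCinv⟩ := compl_inv A (by
    rintro a b _ ⟨y, hy, rfl⟩
    exact ⟨e' a b y, hΓinv a b y hy, rfl⟩)
  let G : Submodule ℂ (V × ((Jt Λ → Fin N) → ℂ)) := Γ ⊔ C.map (LinearMap.inr ℂ V _)
  have hGm : ∀ y, y ∈ G ↔ ∃ x ∈ Γ, ∃ c ∈ C, y = (x.1, x.2 + c) := by
    intro y
    rw [Submodule.mem_sup]
    constructor
    · rintro ⟨x, hx, _, ⟨c, hc, rfl⟩, rfl⟩
      exact ⟨x, hx, c, hc, by ext <;> simp⟩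
    · rintro ⟨x, hx, c, hc, rfl⟩
      exact ⟨x, hx, _, ⟨c, hc, rfl⟩, by ext <;> simp⟩
  have hGinv : ∀ a b, ∀ x ∈ G, e' a b x ∈ G := by
    intro a b y hy
    obtain ⟨x, hx, c, hc, rfl⟩ := (hGm y).1 hy
    rw [hGm]
    refine ⟨e' a b x, hΓinv a b x hx, eW a b c, hCinv a b c hc, ?_⟩
    change (e a b x.1, eW a b (x.2 + c)) = _
    rw [map_add]; rfl
  let p : G →ₗ[ℂ] ((Jt Λ → Fin N) → ℂ) := LinearMap.snd ℂ V _ ∘ₗ G.subtype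
  have hp : Function.Bijective p := by
    constructor
    · rw [injective_iff_map_eq_zero]
      rintro ⟨y, hy⟩ h0
      have h0' : y.2 = 0 := h0
      obtain ⟨x, hx, c, hc, rfl⟩ := (hGm y).1 hy
      simp only at h0'
      have hxA : x.2 ∈ A := ⟨x, hx, rfl⟩
      have hxC : x.2 ∈ C := by
        rw [eq_neg_of_add_eq_zero_left h0']; exact C.neg_mem hc
      have hx2 : x.2 = 0 := Submodule.disjoint_def.1 hC.disjoint _ hxA hxC
      have hc0 : c = 0 := by rw [hx2, zero_add] at h0'; exact h0'
      have hx1 : x.1 = 0 := hΓ0 _ (by rw [← hx2]; exact hx)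
      apply Subtype.ext
      simp [hx1, hx2, hc0]
    · intro f
      have hf : f ∈ A ⊔ C := by rw [hC.sup_eq_top]; trivial
      obtain ⟨_, ⟨x, hx, rfl⟩, c, hc, rfl⟩ := Submodule.mem_sup.1 hf
      exact ⟨⟨(x.1, x.2 + c), (hGm _).2 ⟨x, hx, c, hc, rfl⟩⟩, rfl⟩
  let P := LinearEquiv.ofBijective p hp
  let π : ((Jt Λ → Fin N) → ℂ) →ₗ[ℂ] V := LinearMap.fst ℂ V _ ∘ₗ G.subtype ∘ₗ P.symm.toLinearMap
  have hπ : ∀ y, y ∈ G → π y.2 = y.1 := by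
    intro y hy
    have : P ⟨y, hy⟩ = y.2 := rfl
    change (P.symm y.2 : V × ((Jt Λ → Fin N) → ℂ)).1 = y.1
    rw [← this, LinearEquiv.symm_apply_apply]
  have hπ2 : ∀ f, (π f, f) ∈ G := by
    intro f
    have : (π f, f) = ((P.symm f : G) : V × ((Jt Λ → Fin N) → ℂ)) := by
      apply Prod.ext
      · rfl
      · exact (LinearEquiv.apply_symm_apply P f).symm
    rw [this]
    exact (P.symm f).2
  have hintw : ∀ a b f, π (eW a b f) = e a b (π f) := fun a b f =>
    hπ _ (hGinv a b _ (hπ2 f))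
  refine ⟨π, ?_, hintw⟩
  intro x
  refine hgen (LinearMap.range π) ?_ ?_ x
  · rintro a b _ ⟨f, rfl⟩
    exact ⟨_, hintw a b f⟩
  · exact ⟨om, hπ γ ((hGm γ).2 ⟨γ, Gam_mem e' γ, 0, C.zero_mem, by simp [γ]⟩)⟩

end PartD3
end GaudinAux


namespace GaudinAux
open Finset Polynomial Equiv GaudinModel

section PartD4
variable {N : ℕ} {J : Type*} [Fintype J] [DecidableEq J]

lemma eS_single (j : J) (a b : Fin N) (x : J → Fin N) :
    eS j a b (Pi.single x (1 : ℂ)) =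
      if x j = b then Pi.single (Function.update x j a) (1 : ℂ) else 0 := by
  funext w
  rw [eS_apply]
  by_cases h1 : w j = a
  · rw [if_pos h1]
    by_cases h2 : x j = b
    · rw [if_pos h2]
      simp only [Pi.single_apply]
      congr 1
      rw [eq_iff_iff]
      constructor
      · rintro rfl
        simp [← h1]
      · rintro rfl
        simp [← h2]
    · rw [if_neg h2, Pi.single_apply, if_neg]
      · rfl
      · rintro rfl
        exact h2 (by simp)
  · rw [if_neg h1]
    split_ifs with h2
    · rw [Pi.single_apply, if_neg]
      rintro rfl
      exact h1 (by simp)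
    · rfl

lemma eW_diag (a : Fin N) (f : (J → Fin N) → ℂ) (w : J → Fin N) :
    eW a a f w = (cont w a : ℂ) * f w := by
  rw [eW_apply, Finset.sum_apply]
  have : ∀ j, eS j a a f w = if w j = a then f w else 0 := by
    intro j
    rw [eS_apply]
    split_ifs with h
    · rw [← h, Function.update_eq_self]
    · rfl
  simp only [this]
  rw [← sum_filter, sum_const, nsmul_eq_mul]
  rfl

lemma aeval_smul_one {A : Type*} [AddCommGroup A] [Module ℂ A] (c : ℂ) (Q : ℂ[X]) (x : A) :
    aeval (c • (1 : Module.End ℂ A)) Q x = Q.eval c • x := by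
  have : c • (1 : Module.End ℂ A) = algebraMap ℂ (Module.End ℂ A) c := by
    rw [Algebra.algebraMap_eq_smul_one]
  rw [this, aeval_algebraMap_apply]
  simp

lemma cont_le (w : J → Fin N) (a : Fin N) : cont w a ≤ Fintype.card J := by
  unfold cont
  exact (card_le_univ _)

lemma weight_lift {M : Type*} [AddCommGroup M] [Module ℂ M]
    (π : ((J → Fin N) → ℂ) →ₗ[ℂ] M) (hs : Function.Surjective π)
    (T : Fin N → Module.End ℂ M) (hT : ∀ a f, T a (π f) = π (eW a a f)) (m : Fin N → ℕ) (v : M)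
    (hv : ∀ a, T a v = (m a : ℂ) • v) :
    ∃ f : (J → Fin N) → ℂ, (∀ w, cont w ≠ m → f w = 0) ∧ π f = v := by
  have key : ∀ s : Finset (Fin N), ∃ f : (J → Fin N) → ℂ,
      (∀ w, (∃ a ∈ s, cont w a ≠ m a) → f w = 0) ∧ π f = v := by
    intro s
    induction s using Finset.induction_on with
    | empty =>
      obtain ⟨f, hf⟩ := hs v
      exact ⟨f, by simp, hf⟩
    | insert a s ha ih =>
      obtain ⟨f, hf, hfv⟩ := ih
      let Q : ℂ[X] := ∏ k ∈ (range (Fintype.card J + 1)).erase (m a), (X - C (k : ℂ))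
      have hQ : Q.eval (m a : ℂ) ≠ 0 := by
        rw [eval_prod, prod_ne_zero_iff]
        intro k hk
        rw [eval_sub, eval_X, eval_C, sub_ne_zero]
        intro h
        exact (mem_erase.1 hk).1 (by exact_mod_cast h.symm)
      have hQ0 : ∀ w : J → Fin N, cont w a ≠ m a → Q.eval (cont w a : ℂ) = 0 := by
        intro w hw
        rw [eval_prod]
        apply prod_eq_zero (i := cont w a)
        · rw [mem_erase, mem_range]
          exact ⟨hw, Nat.lt_succ_of_le (cont_le w a)⟩
        · simp
      have hf' : ∀ w, aeval (eW a a) Q f w = Q.eval (cont w a : ℂ) * f w := by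
        intro w
        have h1 := aeval_intertwine (eW a a) ((cont w a : ℂ) • (1 : Module.End ℂ ℂ))
          (LinearMap.proj w : ((J → Fin N) → ℂ) →ₗ[ℂ] ℂ)
          (by intro x; simp [eW_diag]) Q f
        rw [aeval_smul_one] at h1
        simpa using h1
      have hv' : aeval (T a) Q v = Q.eval (m a : ℂ) • v := by
        have h1 := aeval_intertwine ((m a : ℂ) • (1 : Module.End ℂ ℂ)) (T a)
          (LinearMap.toSpanSingleton ℂ M v)
          (by intro x; simp [hv, smul_smul, mul_comm]) Q 1
        rw [aeval_smul_one] at h1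
        simpa using h1.symm
      have hπ : π (aeval (eW a a) Q f) = aeval (T a) Q (π f) :=
        aeval_intertwine (eW a a) (T a) π (fun x => (hT a x).symm) Q f
      refine ⟨(Q.eval (m a : ℂ))⁻¹ • aeval (eW a a) Q f, ?_, ?_⟩
      · rintro w ⟨b, hb, hw⟩
        rw [Pi.smul_apply, hf']
        rcases Finset.mem_insert.1 hb with rfl | hb
        · rw [hQ0 w hw]; simp
        · rw [hf w ⟨b, hb, hw⟩]; simp
      · rw [map_smul, hπ, hfv, hv', smul_smul, inv_mul_cancel₀ hQ, one_smul]
  obtain ⟨f, hf, hfv⟩ := key univ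
  refine ⟨f, fun w hw => hf w ?_, hfv⟩
  by_contra h
  push Not at h
  exact hw (funext fun a => h a (mem_univ a))

end PartD4

section PartD5
variable {N n : ℕ} (V : Fin n → Type*) [∀ i, AddCommGroup (V i)] [∀ i, Module ℂ (V i)]
    (M : Type*) [NormedAddCommGroup M] [NormedSpace ℂ M]
    (E : ∀ i : Fin n, Fin N → Fin N → (V i →ₗ[ℂ] V i))
    (φ : M ≃ₗ[ℂ] PiTensorProduct ℂ V)

theorem tensor_intertwiner (I : Fin n → Type) [∀ i, Fintype (I i)] [∀ i, DecidableEq (I i)]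
    (q : ∀ i, ((I i → Fin N) → ℂ) →ₗ[ℂ] V i)
    (hq : ∀ i, Function.Surjective (q i))
    (hq2 : ∀ i a b f, q i (eW a b f) = E i a b (q i f)) :
    ∃ π : (((Σ i, I i) → Fin N) → ℂ) →ₗ[ℂ] M, Function.Surjective π ∧
      ∀ j a b f, EE V M E φ j a b (π f) = π (∑ p : I j, eS (⟨j, p⟩ : Σ i, I i) a b f) := by
  let d : ∀ i, (I i → Fin N) → V i := fun i x => q i (Pi.single x 1)
  have hd : ∀ i a b x, E i a b (d i x) =
      ∑ p, if x p = b then d i (Function.update x p a) else 0 := by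
    intro i a b x
    rw [← hq2, eW_apply, map_sum]
    apply sum_congr rfl
    intro p _
    rw [eS_single]
    split_ifs
    · rfl
    · simp
  let td : ((Σ i, I i) → Fin N) → (∀ i, V i) := fun w i => d i (fun p => w ⟨i, p⟩)
  let tp : ((Σ i, I i) → Fin N) → M := fun w => φ.symm (PiTensorProduct.tprod ℂ (td w))
  have htp : ∀ j a b w, EE V M E φ j a b (tp w) =
      ∑ p : I j, if w ⟨j, p⟩ = b then tp (Function.update w ⟨j, p⟩ a) else 0 := by
    intro j a b w
    have h1 : EE V M E φ j a b (tp w) = φ.symm (PiTensorProduct.map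
      (Function.update (fun i : Fin n => (LinearMap.id : V i →ₗ[ℂ] V i)) j (E j a b))
        (PiTensorProduct.tprod ℂ (td w))) := by
      simp [EE, tp]
    rw [h1, PiTensorProduct.map_tprod]
    have h2 : (fun i => (Function.update (fun i : Fin n => (LinearMap.id : V i →ₗ[ℂ] V i)) j
        (E j a b)) i (td w i)) = Function.update (td w) j (E j a b (td w j)) := by
      funext i
      by_cases h : i = j
      · subst h; simp
      · simp [h]
    rw [h2]
    have h3 : E j a b (td w j) = ∑ p, if w ⟨j, p⟩ = b then
        d j (Function.update (fun p => w ⟨j, p⟩) p a) else 0 := hd j a b _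
    rw [h3, MultilinearMap.map_update_sum, map_sum]
    apply sum_congr rfl
    intro p _
    split_ifs with h
    · simp only [tp]
      congr 2
      funext i
      by_cases h : i = j
      · subst h
        simp only [Function.update_self, td]
        congr 1
        funext p'
        by_cases hp : p' = p
        · subst hp; simp
        · rw [Function.update_of_ne hp, Function.update_of_ne]
          intro h
          exact hp (by simpa using h)
      · rw [Function.update_of_ne h]
        simp only [td]
        congr 1
        funext p'
        rw [Function.update_of_ne]
        intro h'
        exact h (congrArg Sigma.fst h')
    · rw [MultilinearMap.map_update_zero, map_zero]
  let π : (((Σ i, I i) → Fin N) → ℂ) →ₗ[ℂ] M := Fintype.linearCombination ℂ tp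
  have hπ : ∀ f, π f = ∑ w, f w • tp w := fun f => Fintype.linearCombination_apply ℂ tp f
  refine ⟨π, ?_, ?_⟩
  · have hr : LinearMap.range (φ.toLinearMap ∘ₗ π) = ⊤ := by
      rw [eq_top_iff, ← PiTensorProduct.span_tprod_eq_top, Submodule.span_le]
      rintro _ ⟨x, rfl⟩
      choose g hg using fun i => hq i (x i)
      have hx : x = fun i => ∑ y, g i y • d i y := by
        funext i
        rw [← hg i]
        conv_lhs => rw [pi_eq_sum_univ' (g i)]
        rw [map_sum]
        apply sum_congr rfl
        intro y _
        rw [map_smul]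
      rw [hx, MultilinearMap.map_sum]
      apply Submodule.sum_mem
      intro r _
      rw [MultilinearMap.map_smul_univ]
      apply Submodule.smul_mem
      refine ⟨Pi.single (fun p => r p.1 p.2) 1, ?_⟩
      change φ (π _) = _
      rw [hπ, sum_eq_single (fun p => r p.1 p.2)]
      · simp [tp, td]
      · intro w _ hw
        rw [Pi.single_apply, if_neg hw, zero_smul]
      · simp
    intro x
    have : φ x ∈ LinearMap.range (φ.toLinearMap ∘ₗ π) := by rw [hr]; trivial
    obtain ⟨f, hf⟩ := this
    exact ⟨f, φ.injective hf⟩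
  · intro j a b f
    rw [hπ, map_sum, map_sum]
    simp only [map_smul, htp, smul_sum]
    rw [sum_comm]
    apply sum_congr rfl
    intro p _
    rw [hπ]
    have := sum_flip (fun w w' => f w • tp w') (⟨j, p⟩ : Σ i, I i) a b
    simp only [eS_apply, ite_smul, zero_smul, smul_ite, smul_zero]
    exact this.symm

theorem total_intertwiner [∀ i, FiniteDimensional ℂ (V i)] (Λ : Fin n → Fin N → ℤ)
    (hdom : ∀ i, ∀ a b : Fin N, a ≤ b → Λ i b ≤ Λ i a)
    (hpoly : ∀ i a, 0 ≤ Λ i a) (hrel : GlRel V E) (hhw : IsHW V E Λ) :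
    ∃ π : (((Σ i, Jt (Λ i)) → Fin N) → ℂ) →ₗ[ℂ] M, Function.Surjective π ∧
      ∀ j a b f, EE V M E φ j a b (π f) =
        π (∑ p : Jt (Λ j), eS (⟨j, p⟩ : Σ i, Jt (Λ i)) a b f) := by
  have : ∀ i, ∃ π : ((Jt (Λ i) → Fin N) → ℂ) →ₗ[ℂ] V i, Function.Surjective π ∧
      ∀ a b f, π (eW a b f) = E i a b (π f) := by
    intro i
    obtain ⟨v, hv, h1, h2, h3⟩ := hhw i
    refine intertwiner (Λ i) (E i) ?_ (hdom i) (hpoly i) v h1 h2 h3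
    intro a b c d x
    have := congrArg (fun T => T x) (hrel i a b c d)
    simp only [LinearMap.sub_apply, LinearMap.comp_apply, LinearMap.smul_apply, ite_smul,
      one_smul, zero_smul] at this
    have e1 : (if b = c then E i a d else 0) x = if b = c then E i a d x else 0 := by
      split_ifs <;> rfl
    have e2 : (if d = a then E i c b else 0) x = if d = a then E i c b x else 0 := by
      split_ifs <;> rfl
    rw [e1, e2] at this
    rw [add_sub_assoc, ← this]
    abel
  choose q hq hq2 using this
  exact tensor_intertwiner V M E φ (fun i => Jt (Λ i)) q hq hq2

end PartD5
end GaudinAux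


namespace GaudinAux
open Finset Polynomial Equiv GaudinModel

section PartE1
variable {U : Set ℂ}

/-- holomorphic functions on `U`, extended by zero -/
def FU (U : Set ℂ) : Submodule ℂ (ℂ → ℂ) where
  carrier := {f | DifferentiableOn ℂ f U ∧ ∀ u, u ∉ U → f u = 0}
  add_mem' := by
    rintro f g ⟨hf, hf'⟩ ⟨hg, hg'⟩
    exact ⟨hf.add hg, fun u hu => by simp [hf' u hu, hg' u hu]⟩
  zero_mem' := ⟨differentiableOn_const 0, fun _ _ => rfl⟩
  smul_mem' := by
    rintro c f ⟨hf, hf'⟩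
    exact ⟨hf.const_smul c, fun u hu => by simp [hf' u hu]⟩

lemma FU_ext {f g : FU U} (h : ∀ u ∈ U, f.1 u = g.1 u) : f = g := by
  apply Subtype.ext
  funext u
  by_cases hu : u ∈ U
  · exact h u hu
  · rw [f.2.2 u hu, g.2.2 u hu]

lemma FU_hasDeriv (hU : IsOpen U) (f : FU U) {u : ℂ} (hu : u ∈ U) :
    HasDerivAt f.1 (deriv f.1 u) u :=
  (f.2.1.differentiableAt (hU.mem_nhds hu)).hasDerivAt

open Classical in
/-- cut off a function that is holomorphic on `U` -/
def cut (a : ℂ → ℂ) (ha : DifferentiableOn ℂ a U) : FU U :=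
  ⟨fun u => if u ∈ U then a u else 0,
    ha.congr (fun u hu => by simp [hu]), fun u hu => by simp [hu]⟩

lemma cut_apply (a : ℂ → ℂ) (ha : DifferentiableOn ℂ a U) {u : ℂ} (hu : u ∈ U) :
    (cut a ha).1 u = a u := by simp [cut, hu]

/-- the derivative -/
def dU (hU : IsOpen U) : Module.End ℂ (FU U) where
  toFun f := cut (deriv f.1) (f.2.1.deriv hU)
  map_add' f g := by
    apply FU_ext
    intro u hu
    change _ = (cut _ _).1 u + (cut _ _).1 u
    rw [cut_apply _ _ hu, cut_apply _ _ hu, cut_apply _ _ hu]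
    exact ((FU_hasDeriv hU f hu).add (FU_hasDeriv hU g hu)).deriv
  map_smul' c f := by
    apply FU_ext
    intro u hu
    change _ = c • (cut _ _).1 u
    rw [cut_apply _ _ hu, cut_apply _ _ hu]
    exact ((FU_hasDeriv hU f hu).const_smul c).deriv

lemma dU_apply (hU : IsOpen U) (f : FU U) {u : ℂ} (hu : u ∈ U) :
    (dU hU f).1 u = deriv f.1 u := cut_apply _ (f.2.1.deriv hU) hu

/-- multiplication -/
def mU {a : ℂ → ℂ} (ha : DifferentiableOn ℂ a U) : Module.End ℂ (FU U) where
  toFun f := ⟨fun u => a u * f.1 u, ha.mul f.2.1, fun u hu => by simp [f.2.2 u hu]⟩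
  map_add' f g := by
    apply FU_ext; intro u hu
    exact mul_add _ _ _
  map_smul' c f := by
    apply FU_ext; intro u hu
    change a u * (c * f.1 u) = c * (a u * f.1 u)
    ring

lemma mU_apply {a : ℂ → ℂ} (ha : DifferentiableOn ℂ a U) (f : FU U) (u : ℂ) :
    (mU ha f).1 u = a u * f.1 u := rfl

lemma dinv {c : ℂ} (hc : c ∉ U) : DifferentiableOn ℂ (fun u => (u - c)⁻¹) U := by
  intro u hu
  apply DifferentiableAt.differentiableWithinAt
  apply DifferentiableAt.inv (by fun_prop)
  rw [sub_ne_zero]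
  rintro rfl
  exact hc hu

variable {J : Type*} [Fintype J] [DecidableEq J]

/-- multiplication by inverse linear function -/
def bU {z : J → ℂ} (hz : ∀ j, z j ∉ U) (j : J) : Module.End ℂ (FU U) := mU (dinv (hz j))

def QU {z : J → ℂ} (hz : ∀ j, z j ∉ U) (S : Finset J) : Module.End ℂ (FU U) :=
  mU (a := fun u => ∏ j ∈ S, (u - z j)⁻¹) (DifferentiableOn.fun_finsetProd fun j _ => dinv (hz j))

lemma bU_apply {z : J → ℂ} (hz : ∀ j, z j ∉ U) (j : J) (f : FU U) (u : ℂ) :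
    (bU hz j f).1 u = (u - z j)⁻¹ * f.1 u := rfl

lemma QU_apply {z : J → ℂ} (hz : ∀ j, z j ∉ U) (S : Finset J) (f : FU U) (u : ℂ) :
    (QU hz S f).1 u = (∏ j ∈ S, (u - z j)⁻¹) * f.1 u := rfl

lemma dU_bU (hU : IsOpen U) {z : J → ℂ} (hz : ∀ j, z j ∉ U) (j : J) (f : FU U) :
    dU hU (bU hz j f) = bU hz j (dU hU f) - bU hz j (bU hz j f) := by
  apply FU_ext
  intro u hu
  rw [dU_apply hU _ hu]
  change _ = (bU hz j (dU hU f)).1 u - (bU hz j (bU hz j f)).1 u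
  rw [bU_apply, bU_apply, bU_apply, dU_apply hU _ hu]
  have hne : u - z j ≠ 0 := by
    rw [sub_ne_zero]; rintro h; exact hz j (h ▸ hu)
  have h1 : HasDerivAt (fun u => (u - z j)⁻¹) (-1 / (u - z j) ^ 2) u :=
    ((hasDerivAt_id u).sub_const (z j)).inv hne
  have h2 := (h1.mul (FU_hasDeriv hU f hu)).deriv
  refine Eq.trans h2 ?_
  field_simp
  ring

lemma QU_insert {z : J → ℂ} (hz : ∀ j, z j ∉ U) (S : Finset J) (j : J) (f : FU U) (hj : j ∉ S) :
    bU hz j (QU hz S f) = QU hz (insert j S) f := by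
  apply FU_ext
  intro u hu
  rw [bU_apply, QU_apply, QU_apply, prod_insert hj, mul_assoc]

lemma bU_comm {z : J → ℂ} (hz : ∀ j, z j ∉ U) (i j : J) (f : FU U) :
    bU hz i (bU hz j f) = bU hz j (bU hz i f) := by
  apply FU_ext
  intro u hu
  simp only [bU_apply]
  ring

lemma QU_empty {z : J → ℂ} (hz : ∀ j, z j ∉ U) (f : FU U) : QU hz ∅ f = f := by
  apply FU_ext
  intro u hu
  simp [QU_apply]

lemma dU_QU (hU : IsOpen U) {z : J → ℂ} (hz : ∀ j, z j ∉ U) (S : Finset J) (f : FU U) :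
    dU hU (QU hz S f) = QU hz S (dU hU f) - ∑ l ∈ S, bU hz l (QU hz S f) := by
  induction S using Finset.induction_on with
  | empty => simp [QU_empty]
  | insert j S hj ih =>
    rw [← QU_insert hz S j f hj, ← QU_insert hz S j _ hj, dU_bU, ih, map_sub, map_sum,
      sum_insert hj]
    simp only [bU_comm hz j]
    abel

end PartE1

section PartE2
variable {N n : ℕ} (V : Fin n → Type*) [∀ i, AddCommGroup (V i)] [∀ i, Module ℂ (V i)]
    (M : Type*) [NormedAddCommGroup M] [NormedSpace ℂ M]
    (E : ∀ i : Fin n, Fin N → Fin N → (V i →ₗ[ℂ] V i))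
    (φ : M ≃ₗ[ℂ] PiTensorProduct ℂ V)
    (I : Fin n → Type) [∀ i, Fintype (I i)] [∀ i, DecidableEq (I i)]
    (π : (((Σ i, I i) → Fin N) → ℂ) →ₗ[ℂ] M)
    (z : Fin n → ℂ) (K : Fin N → ℂ)
    {U : Set ℂ} (hU : IsOpen U) (hz : ∀ j, z j ∉ U)

/-- realization of a word-indexed family -/
def Pr (g : ((Σ i, I i) → Fin N) → FU U) : ℂ → M := fun u => π (fun w => (g w).1 u)

lemma Pr_deriv (hU : IsOpen U) (g : ((Σ i, I i) → Fin N) → FU U) {u : ℂ} (hu : u ∈ U) :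
    HasDerivAt (Pr M I π g) (π fun w => deriv (g w).1 u) u := by
  have h1 : HasDerivAt (fun u => fun w => (g w).1 u) (fun w => deriv (g w).1 u) u :=
    hasDerivAt_pi.2 fun w => FU_hasDeriv hU (g w) hu
  exact (LinearMap.toContinuousLinearMap π).hasFDerivAt.comp_hasDerivAt u h1

lemma Xg_transfer
    (hπ : ∀ j a b f, EE V M E φ j a b (π f) = π (∑ p : I j, eS (⟨j, p⟩ : Σ i, I i) a b f))
    (a c : Fin N) (h : ℂ → M) (g : ((Σ i, I i) → Fin N) → FU U)
    (hg : ∀ u ∈ U, h u = Pr M I π g u) :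
    ∀ u ∈ U, Xg V M E φ z (Matrix.diagonal K) a c h u =
      Pr M I π (Xw (dU hU) (bU (z := fun p : Σ i, I i => z p.1) fun p => hz p.1) K a c g) u := by
  intro u hu
  have hd : deriv h u = π fun w => deriv (g w).1 u := by
    have : h =ᶠ[nhds u] Pr M I π g := by
      filter_upwards [hU.mem_nhds hu] with x hx using hg x hx
    rw [this.deriv_eq]
    exact (Pr_deriv M I π hU g hu).deriv
  simp only [Xg]
  rw [hd, hg u hu]
  simp only [Pr, hπ]
  have hR : (fun w => (Xw (dU hU) (bU (z := fun p : Σ i, I i => z p.1) fun p => hz p.1) K a c g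
      w).1 u) = (if a = c then (fun w => deriv (g w).1 u) - K a • (fun w => (g w).1 u) else 0) -
        ∑ j, (u - z j)⁻¹ • ∑ p : I j, eS (⟨j, p⟩ : Σ i, I i) c a (fun w => (g w).1 u) := by
    funext w
    simp only [Xw]
    change (if a = c then dU hU (g w) - K a • g w else 0 : FU U).1 u - _ = _
    rw [Pi.sub_apply]
    congr 1
    · split_ifs
      · change (dU hU (g w)).1 u - K a * (g w).1 u = _
        rw [dU_apply hU _ hu]; rfl
      · rfl
    · rw [Fintype.sum_sigma, Submodule.coe_sum, Finset.sum_apply, Finset.sum_apply]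
      apply sum_congr rfl
      intro j _
      rw [Submodule.coe_sum, Finset.sum_apply, Pi.smul_apply, Finset.sum_apply, smul_sum]
      apply sum_congr rfl
      intro p _
      rw [eS_apply]
      split_ifs
      · rfl
      · simp
  rw [hR, map_sub, map_sum]
  simp only [map_smul]
  congr 1
  by_cases hac : a = c
  · subst hac
    simp [Matrix.diagonal_apply_eq]
  · simp [hac]

lemma XL_transfer
    (hπ : ∀ j a b f, EE V M E φ j a b (π f) = π (∑ p : I j, eS (⟨j, p⟩ : Σ i, I i) a b f))
    (c : Fin N → Fin N) (L : List (Fin N)) (h : ℂ → M)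
    (g : ((Σ i, I i) → Fin N) → FU U) (hg : ∀ u ∈ U, h u = Pr M I π g u) :
    ∀ u ∈ U, ((L.map fun a => Xg V M E φ z (Matrix.diagonal K) a (c a)).foldr (· ∘ ·) id) h u =
      Pr M I π (XL (dU hU) (bU (z := fun p : Σ i, I i => z p.1) fun p => hz p.1) K c L g) u := by
  induction L with
  | nil => exact hg
  | cons r L ih =>
    intro u hu
    exact Xg_transfer V M E φ I π z K hU hz hπ r (c r) _ _ ih u hu

theorem Dg_transfer
    (hπ : ∀ j a b f, EE V M E φ j a b (π f) = π (∑ p : I j, eS (⟨j, p⟩ : Σ i, I i) a b f))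
    (h : ℂ → M)
    (g : ((Σ i, I i) → Fin N) → FU U) (hg : ∀ u ∈ U, h u = Pr M I π g u) :
    ∀ u ∈ U, Dg V M E φ z (Matrix.diagonal K) h u =
      π fun w => (Dt (dU hU) K (QU (z := fun p : Σ i, I i => z p.1) fun p => hz p.1) g w).1 u := by
  intro u hu
  have hn := normal_order (dU hU) K g (bU (z := fun p : Σ i, I i => z p.1) fun p => hz p.1)
    (QU (z := fun p : Σ i, I i => z p.1) fun p => hz p.1) (QU_empty _) (dU_QU hU _)
    (fun S j x hj => QU_insert _ S j x hj)
  unfold Dt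
  simp only [← hn, Dg]
  have : ∀ σ : Perm (Fin N), ((List.ofFn fun a : Fin N => Xg V M E φ z (Matrix.diagonal K) a
      (σ a)).foldr (· ∘ ·) id) h u = π fun w =>
        (XL (dU hU) (bU (z := fun p : Σ i, I i => z p.1) fun p => hz p.1) K σ
          (List.finRange N) g w).1 u := by
    intro σ
    rw [List.ofFn_eq_map]
    exact XL_transfer V M E φ I π z K hU hz hπ σ _ h g hg u hu
  simp only [this]
  simp only [← map_zsmul]
  rw [← map_sum]
  congr 1
  funext w
  rw [Submodule.coe_sum, Finset.sum_apply, Finset.sum_apply]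
  rfl

end PartE2
end GaudinAux


namespace GaudinAux
open Finset Polynomial Equiv GaudinModel

section PartE3
variable {U : Set ℂ}

lemma qe_diff (κ : ℂ) (p : ℂ[X]) :
    DifferentiableOn ℂ (fun u => Complex.exp (κ * u) * p.eval u) U := by
  apply Differentiable.differentiableOn
  have := p.differentiable
  fun_prop

/-- scalar quasi-exponentials -/
def Psi (U : Set ℂ) (κ : ℂ) : ℂ[X] →ₗ[ℂ] FU U where
  toFun p := cut (fun u => Complex.exp (κ * u) * p.eval u) (qe_diff κ p)
  map_add' p q := by
    apply FU_ext
    intro u hu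
    change _ = (cut _ _).1 u + (cut _ _).1 u
    rw [cut_apply _ _ hu, cut_apply _ _ hu, cut_apply _ _ hu, eval_add, mul_add]
  map_smul' c p := by
    apply FU_ext
    intro u hu
    change _ = c * (cut _ _).1 u
    rw [cut_apply _ _ hu, cut_apply _ _ hu, eval_smul, smul_eq_mul]
    ring

lemma Psi_apply (κ : ℂ) (p : ℂ[X]) {u : ℂ} (hu : u ∈ U) :
    (Psi U κ p).1 u = Complex.exp (κ * u) * p.eval u := cut_apply _ (qe_diff κ p) hu

lemma Psi_pD (hU : IsOpen U) (κ : ℂ) (p : ℂ[X]) : Psi U κ (pD κ p) = dU hU (Psi U κ p) := by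
  apply FU_ext
  intro u hu
  rw [dU_apply hU _ hu, Psi_apply _ _ hu]
  have h0 : (Psi U κ p).1 =ᶠ[nhds u] fun u => Complex.exp (κ * u) * p.eval u := by
    filter_upwards [hU.mem_nhds hu] with x hx using Psi_apply _ _ hx
  rw [h0.deriv_eq]
  have h1 : HasDerivAt (fun u : ℂ => Complex.exp (κ * u)) (Complex.exp (κ * u) * (κ * 1)) u :=
    ((hasDerivAt_id u).const_mul κ).cexp
  have h2 := (h1.mul (p.hasDerivAt u)).deriv
  refine Eq.symm (Eq.trans h2 ?_)
  rw [pD_apply, eval_add, eval_smul, smul_eq_mul]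
  ring

variable {N : ℕ} {J : Type*} [Fintype J] [DecidableEq J]

lemma poly_diff (p : ℂ[X]) : DifferentiableOn ℂ (fun u => p.eval u) U :=
  p.differentiable.differentiableOn

lemma Psi_pP (κ : ℂ) (z : J → ℂ) (S : Finset J) (p : ℂ[X]) :
    Psi U κ (pP z S p) = mU (poly_diff (∏ j ∈ Sᶜ, (X - C (z j)))) (Psi U κ p) := by
  apply FU_ext
  intro u hu
  rw [mU_apply, Psi_apply _ _ hu, Psi_apply _ _ hu]
  simp only [pP, LinearMap.mulLeft_apply, eval_mul]
  ring

lemma Dt_QU (hU : IsOpen U) {z : J → ℂ} (hz : ∀ j, z j ∉ U) (K : Fin N → ℂ)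
    (g : (J → Fin N) → FU U) (w : J → Fin N)
    (h0 : Dt (dU hU) K (fun S => mU (poly_diff (∏ j ∈ Sᶜ, (X - C (z j))))) g w = 0) :
    Dt (dU hU) K (QU hz) g w = 0 := by
  apply FU_ext
  intro u hu
  have hne : (∏ j, (u - z j)) ≠ 0 := by
    rw [prod_ne_zero_iff]
    intro j _
    rw [sub_ne_zero]
    rintro h
    exact hz j (h ▸ hu)
  have h1 : mU (poly_diff (∏ j, (X - C (z j)))) (Dt (dU hU) K (QU hz) g w) = 0 := by
    rw [← h0]
    unfold Dt
    rw [map_sum]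
    apply sum_congr rfl
    intro S _
    rw [map_smul]
    congr 1
    apply FU_ext
    intro u hu
    rw [mU_apply, mU_apply, QU_apply, ← mul_assoc]
    congr 1
    simp only [eval_prod, eval_sub, eval_X, eval_C]
    rw [← prod_compl_mul_prod S, mul_assoc, ← prod_mul_distrib]
    rw [prod_eq_one (s := S), mul_one]
    intro j _
    apply mul_inv_cancel₀
    rw [sub_ne_zero]
    rintro h
    exact hz j (h ▸ hu)
  have h2 := congrArg (fun f : FU U => f.1 u) h1
  simp only [mU_apply, eval_prod, eval_sub, eval_X, eval_C] at h2
  exact (mul_eq_zero.1 h2).resolve_left hne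

lemma Dt_Psi (hU : IsOpen U) {z : J → ℂ} (hz : ∀ j, z j ∉ U) (K : Fin N → ℂ) (κ : ℂ)
    (p : (J → Fin N) → ℂ[X]) (hp : ∀ w, Dt (pD κ) K (pP z) p w = 0) (w : J → Fin N) :
    Dt (dU hU) K (QU hz) (fun w => Psi U κ (p w)) w = 0 := by
  apply Dt_QU
  rw [Dt_nat (pD κ) (dU hU) (Psi U κ) (Psi_pD hU κ) K (pP z) _ (fun S x => Psi_pP κ z S x), hp,
    map_zero]

end PartE3

section PartE4
variable {N n : ℕ} (V : Fin n → Type*) [∀ i, AddCommGroup (V i)] [∀ i, Module ℂ (V i)]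
    (M : Type*) [NormedAddCommGroup M] [NormedSpace ℂ M]
    (E : ∀ i : Fin n, Fin N → Fin N → (V i →ₗ[ℂ] V i))
    (φ : M ≃ₗ[ℂ] PiTensorProduct ℂ V)
    (I : Fin n → Type) [∀ i, Fintype (I i)] [∀ i, DecidableEq (I i)]
    (π : (((Σ i, I i) → Fin N) → ℂ) →ₗ[ℂ] M)
    (z : Fin n → ℂ) (K : Fin N → ℂ)

lemma mem_Wt (m : Fin N → ℕ) (x : M) : x ∈ Wt V M E φ (fun b => (m b : ℤ)) ↔
    ∀ a, (∑ j, EE V M E φ j a a) x = (m a : ℂ) • x := by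
  simp [Wt, Submodule.mem_iInf, LinearMap.mem_ker, sub_eq_zero]

lemma sum_EE (hπ : ∀ j a b f, EE V M E φ j a b (π f) =
      π (∑ p : I j, eS (⟨j, p⟩ : Σ i, I i) a b f)) (a b : Fin N) (f) :
    (∑ j, EE V M E φ j a b) (π f) = π (eW a b f) := by
  rw [LinearMap.sum_apply, eW_apply, Fintype.sum_sigma, map_sum]
  exact sum_congr rfl fun j _ => hπ j a b f

lemma Wt_of_cont (hπ : ∀ j a b f, EE V M E φ j a b (π f) =
      π (∑ p : I j, eS (⟨j, p⟩ : Σ i, I i) a b f)) (m : Fin N → ℕ) (f)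
    (hf : ∀ w, cont w ≠ m → f w = 0) : π f ∈ Wt V M E φ (fun b => (m b : ℤ)) := by
  rw [mem_Wt]
  intro a
  rw [sum_EE V M E φ I π hπ, ← map_smul]
  congr 1
  funext w
  rw [eW_diag, Pi.smul_apply, smul_eq_mul]
  by_cases h : cont w = m
  · rw [h]
  · rw [hf w h]; simp

theorem qe_exists (hs : Function.Surjective π) (hπ : ∀ j a b f, EE V M E φ j a b (π f) =
      π (∑ p : I j, eS (⟨j, p⟩ : Σ i, I i) a b f)) (hK : ∀ i j, i ≠ j → K i ≠ K j)
    (m : Fin N → ℕ) (i : Fin N) (v0 : M) (hv0 : v0 ∈ Wt V M E φ (fun b => (m b : ℤ))) :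
    ∃ v : ℕ → M, (∀ t, v t ∈ Wt V M E φ (fun b => (m b : ℤ))) ∧ v 0 = v0 ∧
      ∀ u : ℂ, GoodG z u →
          Dg V M E φ z (Matrix.diagonal K)
            (fun x => Complex.exp (K i * x) •
              ∑ t ∈ Finset.range (m i + 1), (x ^ (m i - t)) • v t) u = 0 := by
  obtain ⟨f0, hf0, hf0v⟩ := weight_lift π hs (fun a => ∑ j, EE V M E φ j a a)
    (fun a f => sum_EE V M E φ I π hπ a a f) m v0 ((mem_Wt V M E φ m v0).1 hv0)
  obtain ⟨p, hp1, hp2, hp3, hp4⟩ := poly_solution K hK (fun p : Σ i, I i => z p.1) i m f0 hf0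
  refine ⟨fun t => π fun w => (p w).coeff (m i - t), ?_, ?_, ?_⟩
  · intro t
    apply Wt_of_cont V M E φ I π hπ
    intro w hw
    simp [hp1 w hw]
  · simp only [Nat.sub_zero]
    rw [← hf0v]
    congr 1
    funext w
    exact hp3 w
  · intro u hu
    let U : Set ℂ := {u | GoodG z u}
    have hU : IsOpen U := by
      have : U = ⋂ j, {z j}ᶜ := by
        ext u
        simp [U, GoodG]
      rw [this]
      exact isOpen_iInter_of_finite fun j => isOpen_compl_singleton
    have hz : ∀ j, z j ∉ U := fun j h => h j rfl
    rw [Dg_transfer V M E φ I π z K hU hz hπ _ (fun w => Psi U (K i) (p w)) _ u hu]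
    · simp only [Dt_Psi hU (fun p : Σ i, I i => hz p.1) K (K i) p hp4]
      exact map_zero π
    · intro x hx
      simp only [Pr]
      simp only [Psi_apply _ _ hx]
      have h1 : (fun w => Complex.exp (K i * x) * (p w).eval x) = Complex.exp (K i * x) •
          ∑ t ∈ Finset.range (m i + 1), (x ^ (m i - t)) • (fun w => (p w).coeff (m i - t)) := by
        funext w
        rw [Pi.smul_apply, smul_eq_mul]
        congr 1
        rw [Finset.sum_apply, eval_eq_sum_range' (n := m i + 1), ← sum_range_reflect]
        · apply sum_congr rfl
          intro t ht
          rw [Pi.smul_apply, smul_eq_mul, mul_comm]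
          congr 2
        · rw [Nat.lt_succ_iff, natDegree_le_iff_coeff_eq_zero]
          intro t ht
          exact hp2 w t ht
      rw [h1, map_smul, map_sum]
      simp only [map_smul]

end PartE4
end GaudinAux


namespace GaudinAux
open Finset Polynomial Equiv GaudinModel

section PartF1
variable {U : Set ℂ} (hU : IsOpen U) (u0 : ℂ)

/-- evaluation -/
def evU (U : Set ℂ) (u0 : ℂ) : FU U →ₗ[ℂ] ℂ where
  toFun f := f.1 u0
  map_add' _ _ := rfl
  map_smul' _ _ := rfl

/-- functions vanishing to order `p` at `u0` -/
def VV : ℕ → Submodule ℂ (FU U)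
  | 0 => ⊤
  | p + 1 => LinearMap.ker (evU U u0) ⊓ (VV p).comap (dU hU)

lemma VV_succ (p : ℕ) (x : FU U) :
    x ∈ VV hU u0 (p + 1) ↔ x.1 u0 = 0 ∧ dU hU x ∈ VV hU u0 p := Iff.rfl

lemma VV_mono1 (p : ℕ) : VV hU u0 (p + 1) ≤ VV hU u0 p := by
  induction p with
  | zero => intro x _; trivial
  | succ p ih =>
    intro x hx
    rw [VV_succ] at hx ⊢
    exact ⟨hx.1, ih hx.2⟩

lemma VV_mono {p q : ℕ} (h : p ≤ q) : VV hU u0 q ≤ VV hU u0 p :=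
  antitone_nat_of_succ_le (VV_mono1 hU u0) h

lemma VV_pow (k p : ℕ) (x : FU U) (hx : x ∈ VV hU u0 (p + k)) :
    (dU hU ^ k) x ∈ VV hU u0 p := by
  induction k generalizing x with
  | zero => exact hx
  | succ k ih =>
    rw [pow_succ, Module.End.mul_apply]
    exact ih _ ((VV_succ hU u0 (p + k) x).1 hx).2

lemma VV_of_pow (k p : ℕ) (x : FU U) (hx : x ∈ VV hU u0 k)
    (h : (dU hU ^ k) x ∈ VV hU u0 p) : x ∈ VV hU u0 (k + p) := by
  induction k generalizing x with
  | zero => simpa using h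
  | succ k ih =>
    rw [pow_succ, Module.End.mul_apply] at h
    rw [VV_succ] at hx
    rw [show k + 1 + p = (k + p) + 1 by omega, VV_succ]
    exact ⟨hx.1, ih _ hx.2 h⟩

lemma VV_of_vals (k : ℕ) (x : FU U) (hx : ∀ q < k, ((dU hU ^ q) x).1 u0 = 0) :
    x ∈ VV hU u0 k := by
  induction k generalizing x with
  | zero => trivial
  | succ k ih =>
    rw [VV_succ]
    refine ⟨hx 0 (Nat.succ_pos k), ih _ fun q hq => ?_⟩
    have := hx (q + 1) (by omega)
    rwa [pow_succ, Module.End.mul_apply] at this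

lemma VV_vals (k : ℕ) (x : FU U) (h : x ∈ VV hU u0 (k + 1)) : ((dU hU ^ k) x).1 u0 = 0 :=
  ((VV_succ hU u0 0 _).1 (VV_pow hU u0 k (0 + 1) x (by rwa [zero_add, add_comm]))).1

variable {N : ℕ} {J : Type*} [Fintype J] [DecidableEq J]

lemma VV_b {z : J → ℂ} (hz : ∀ j, z j ∉ U) (j : J) (p : ℕ) (x : FU U) (hx : x ∈ VV hU u0 p) :
    bU hz j x ∈ VV hU u0 p := by
  induction p generalizing x with
  | zero => trivial
  | succ p ih =>
    have hx' := VV_mono1 hU u0 p hx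
    rw [VV_succ] at hx ⊢
    refine ⟨by rw [bU_apply, hx.1, mul_zero], ?_⟩
    rw [dU_bU]
    exact Submodule.sub_mem _ (ih _ hx.2) (ih _ (ih _ hx'))

lemma VV_Q {z : J → ℂ} (hz : ∀ j, z j ∉ U) (S : Finset J) (p : ℕ) (x : FU U)
    (hx : x ∈ VV hU u0 p) : QU hz S x ∈ VV hU u0 p := by
  induction S using Finset.induction_on with
  | empty => rwa [QU_empty]
  | insert j S hj ih =>
    rw [← QU_insert hz S j x hj]
    exact VV_b hU u0 hz j p _ ih

lemma VV_aeval (P : ℂ[X]) (d p : ℕ) (hP : P.natDegree ≤ d) (x : FU U)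
    (hx : x ∈ VV hU u0 (p + d)) : aeval (dU hU) P x ∈ VV hU u0 p := by
  rw [aeval_eq_sum_range, LinearMap.sum_apply]
  apply Submodule.sum_mem
  intro k hk
  rw [mem_range] at hk
  rw [LinearMap.smul_apply]
  apply Submodule.smul_mem
  apply VV_pow
  exact VV_mono hU u0 (by omega) hx

theorem uniqV (hN : 1 ≤ N) {z : J → ℂ} (hz : ∀ j, z j ∉ U) (K : Fin N → ℂ)
    (A : (J → Fin N) → (J → Fin N) → ℂ) (g : (J → Fin N) → FU U)
    (hA : ∀ w, g w = ∑ w', A w w' • g w')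
    (hD : ∀ w, ∑ w', A w w' • Dt (dU hU) K (QU hz) g w' = 0)
    (h0 : ∀ w, g w ∈ VV hU u0 N) (p : ℕ) : ∀ w, g w ∈ VV hU u0 (N + p) := by
  induction p with
  | zero => exact h0
  | succ p ih =>
    intro w
    set χ : ℂ[X] := ∏ b, (X - C (K b)) with hχ
    have hmon : χ.Monic := monic_prod_of_monic _ _ fun b _ => monic_X_sub_C _
    have hdeg : χ.natDegree = N := by
      rw [hχ, natDegree_prod_of_monic _ _ fun b _ => monic_X_sub_C _]
      simp
    let R : (J → Fin N) → FU U := fun w => ∑ S ∈ (univ : Finset (Finset J)).erase ∅,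
      (-1 : ℂ) ^ S.card • QU hz S (CS (dU hU) K S g w)
    have hR : ∀ w, R w ∈ VV hU u0 (p + 1) := by
      intro w
      apply Submodule.sum_mem
      intro S hS
      apply Submodule.smul_mem
      apply VV_Q
      unfold CS
      apply VV_aeval hU u0 _ (N - 1)
      · unfold chiS
        rw [natDegree_prod_of_monic _ _ fun b _ => monic_X_sub_C _]
        simp only [natDegree_X_sub_C, sum_const, smul_eq_mul, mul_one]
        rw [card_compl, Fintype.card_fin]
        have : 0 < (S.image w).card := by
          rw [card_pos]
          exact (nonempty_iff_ne_empty.2 (mem_erase.1 hS).1).image _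
        omega
      · apply asym_mem
        intro w
        exact VV_mono hU u0 (by omega) (ih w)
    have hDt : ∀ w, Dt (dU hU) K (QU hz) g w = aeval (dU hU) χ (g w) + R w := by
      intro w
      unfold Dt
      rw [← add_sum_erase univ _ (mem_univ (∅ : Finset J)), CS_empty, QU_empty]
      simp [R, hχ]
    have hχg : aeval (dU hU) χ (g w) ∈ VV hU u0 (p + 1) := by
      have h1 : aeval (dU hU) χ (g w) = - ∑ w', A w w' • R w' := by
        conv_lhs => rw [hA w]
        rw [map_sum, eq_neg_iff_add_eq_zero, ← hD w, ← sum_add_distrib]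
        apply sum_congr rfl
        intro w' _
        rw [hDt, smul_add, map_smul]
      rw [h1]
      apply Submodule.neg_mem
      exact Submodule.sum_mem _ fun w' _ => Submodule.smul_mem _ _ (hR w')
    apply VV_of_pow
    · exact h0 w
    · have h2 : (dU hU ^ N) (g w) = aeval (dU hU) χ (g w) - aeval (dU hU) (χ - X ^ N) (g w) := by
        rw [map_sub, LinearMap.sub_apply, map_pow, aeval_X]
        abel
      rw [h2]
      apply Submodule.sub_mem _ hχg
      apply VV_aeval hU u0 _ (N - 1)
      · have h3 : (χ - X ^ N).degree < χ.degree := by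
          apply degree_sub_lt_left
          · rw [degree_X_pow, degree_eq_natDegree hmon.ne_zero, hdeg]
          · exact hmon.ne_zero
          · rw [hmon.leadingCoeff]; simp
        rw [degree_eq_natDegree hmon.ne_zero, hdeg] at h3
        rw [natDegree_le_iff_coeff_eq_zero]
        intro t ht
        exact (degree_lt_iff_coeff_zero _ N).1 h3 t (by omega)
      · exact VV_mono hU u0 (by omega) (ih w)

lemma dU_iter (k : ℕ) (x : FU U) : ∀ u ∈ U, ((dU hU ^ k) x).1 u = iteratedDeriv k x.1 u := by
  induction k with
  | zero => intro u _; simp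
  | succ k ih =>
    intro u hu
    rw [pow_succ', Module.End.mul_apply, dU_apply hU _ hu, iteratedDeriv_succ]
    apply Filter.EventuallyEq.deriv_eq
    filter_upwards [hU.mem_nhds hu] with y hy using ih y hy

lemma VV_zero (hc : IsPreconnected U) (hu0 : u0 ∈ U) (x : FU U)
    (hx : ∀ k, ((dU hU ^ k) x).1 u0 = 0) : x = 0 := by
  apply FU_ext
  obtain ⟨r, hr, hb⟩ := Metric.isOpen_iff.1 hU u0 hu0
  have h0 : x.1 =ᶠ[nhds u0] fun _ => 0 := by
    filter_upwards [Metric.ball_mem_nhds u0 hr] with y hy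
    rw [← Complex.taylorSeries_eq_on_ball' hy (x.2.1.mono hb)]
    simp [← dU_iter hU _ x u0 hu0, hx]
  intro u hu
  exact (x.2.1.analyticOnNhd hU).eqOn_of_preconnected_of_eventuallyEq
    (analyticOnNhd_const) hc hu0 h0 hu

theorem uniqU (hc : IsPreconnected U) (hu0 : u0 ∈ U) (hN : 1 ≤ N) {z : J → ℂ}
    (hz : ∀ j, z j ∉ U) (K : Fin N → ℂ)
    (A : (J → Fin N) → (J → Fin N) → ℂ) (g : (J → Fin N) → FU U)
    (hA : ∀ w, g w = ∑ w', A w w' • g w')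
    (hD : ∀ w, ∑ w', A w w' • Dt (dU hU) K (QU hz) g w' = 0)
    (h0 : ∀ w, ∀ q < N, ((dU hU ^ q) (g w)).1 u0 = 0) : g = 0 := by
  funext w
  apply VV_zero hU u0 hc hu0
  intro k
  apply VV_vals
  have := uniqV hU u0 hN hz K A g hA hD (fun w => VV_of_vals hU u0 N _ (h0 w)) (k + 1) w
  exact VV_mono hU u0 (by omega) this

end PartF1

section PartF2
variable {U : Set ℂ} (hU : IsOpen U)

lemma Psi_inj (hU : IsOpen U) (hne : U.Nonempty) (κ : ℂ) (p : ℂ[X]) (h : Psi U κ p = 0) :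
    p = 0 := by
  apply Polynomial.eq_zero_of_infinite_isRoot
  obtain ⟨u0, hu0⟩ := hne
  apply Set.Infinite.mono _ (infinite_of_mem_nhds u0 (hU.mem_nhds hu0))
  intro u hu
  have h1 : (Psi U κ p).1 u = 0 := by rw [h]; rfl
  rw [Psi_apply _ _ hu] at h1
  exact (mul_eq_zero.1 h1).resolve_left (Complex.exp_ne_zero _)

lemma Psi_gen (hU : IsOpen U) (κ : ℂ) (p : ℂ[X]) :
    Psi U κ p ∈ (dU hU).maxGenEigenspace κ := by
  rw [Module.End.mem_maxGenEigenspace]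
  refine ⟨p.natDegree + 1, ?_⟩
  have h : ∀ k : ℕ, ∀ p : ℂ[X], ((dU hU - κ • 1) ^ k) (Psi U κ p) =
      Psi U κ (derivative^[k] p) := by
    intro k
    induction k with
    | zero => intro p; rfl
    | succ k ih =>
      intro p
      rw [pow_succ, Module.End.mul_apply, Function.iterate_succ_apply, ← ih]
      congr 1
      rw [LinearMap.sub_apply, ← Psi_pD, pD_apply, map_add, map_smul]
      simp
  rw [h, iterate_derivative_eq_zero (Nat.lt_succ_self _), map_zero]

lemma Psi_indep (hU : IsOpen U) (hne : U.Nonempty) {N : ℕ} (K : Fin N → ℂ)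
    (hK : ∀ i j, i ≠ j → K i ≠ K j) (p : Fin N → ℂ[X]) (h : ∑ i, Psi U (K i) (p i) = 0) (i : Fin N) :
    p i = 0 := by
  have hinj : Function.Injective K := fun i j hij => by
    by_contra hne
    exact hK i j hne hij
  have h1 := (dU hU).independent_maxGenEigenspace.comp hinj
  rw [iSupIndep_iff_finsetSum_eq_zero_imp_eq_zero] at h1
  exact Psi_inj hU hne _ _ (h1 univ (fun i => Psi U (K i) (p i))
    (fun i _ => Psi_gen hU (K i) (p i)) h i (mem_univ i))

end PartF2
end GaudinAux


namespace GaudinAux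
open Finset Polynomial Equiv GaudinModel

section PartF3
variable {U : Set ℂ} {N : ℕ} {J : Type*} [Fintype J] [DecidableEq J]

lemma Dt_smul {F : Type*} [AddCommGroup F] [Module ℂ F] (D : Module.End ℂ F) (K : Fin N → ℂ)
    (P : Finset J → F →ₗ[ℂ] F) (c : ℂ) (g : (J → Fin N) → F) (w : J → Fin N) :
    Dt D K P (c • g) w = c • Dt D K P g w := by
  have h : ∀ S : Finset J, asym S (c • g) w = c • asym S g w := by
    intro S
    simp only [asym, Pi.smul_apply, smul_sum]
    exact sum_congr rfl fun σ _ => smul_comm _ _ _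
  simp only [Dt, CS, h, map_smul]
  rw [smul_sum]
  exact sum_congr rfl fun S _ => smul_comm _ _ _

/-- the solution space on the level of words -/
def Sol (hU : IsOpen U) {z : J → ℂ} (hz : ∀ j, z j ∉ U) (K : Fin N → ℂ)
    (A : (J → Fin N) → (J → Fin N) → ℂ) : Submodule ℂ ((J → Fin N) → FU U) where
  carrier := {g | (∀ w, g w = ∑ w', A w w' • g w') ∧
    (∀ w, ∑ w', A w w' • Dt (dU hU) K (QU hz) g w' = 0)}
  add_mem' := by
    rintro f g ⟨hf, hf'⟩ ⟨hg, hg'⟩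
    refine ⟨fun w => ?_, fun w => ?_⟩
    · simp only [Pi.add_apply, smul_add, sum_add_distrib]
      rw [← hf, ← hg]
    · simp only [Dt_add, smul_add, sum_add_distrib]
      rw [hf', hg', add_zero]
  zero_mem' := by
    refine ⟨fun w => by simp, fun w => ?_⟩
    simp [Dt, CS, asym]
  smul_mem' := by
    rintro c f ⟨hf, hf'⟩
    refine ⟨fun w => ?_, fun w => ?_⟩
    · simp only [Pi.smul_apply]
      conv_lhs => rw [hf w]
      rw [smul_sum]
      exact sum_congr rfl fun w' _ => smul_comm _ _ _
    · have : ∑ w', A w w' • Dt (dU hU) K (QU hz) (c • f) w' =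
          c • ∑ w', A w w' • Dt (dU hU) K (QU hz) f w' := by
        rw [smul_sum]
        apply sum_congr rfl
        intro w' _
        rw [Dt_smul, smul_comm]
      rw [this, hf', smul_zero]

end PartF3

section PartF4
variable {N n : ℕ} (V : Fin n → Type*) [∀ i, AddCommGroup (V i)] [∀ i, Module ℂ (V i)]
    (M : Type*) [NormedAddCommGroup M] [NormedSpace ℂ M] [FiniteDimensional ℂ M]
    (E : ∀ i : Fin n, Fin N → Fin N → (V i →ₗ[ℂ] V i))
    (φ : M ≃ₗ[ℂ] PiTensorProduct ℂ V)
    (I : Fin n → Type) [∀ i, Fintype (I i)] [∀ i, DecidableEq (I i)]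
    (π : (((Σ i, I i) → Fin N) → ℂ) →ₗ[ℂ] M)
    (z : Fin n → ℂ) (K : Fin N → ℂ)
    {U : Set ℂ} (hU : IsOpen U) (hz : ∀ j, z j ∉ U)
    (B : M →ₗ[ℂ] (((Σ i, I i) → Fin N) → ℂ))

lemma lft_diff (h : ℂ → M) (hh : DifferentiableOn ℂ h U) (w) :
    DifferentiableOn ℂ (fun u => B (h u) w) U := by
  have h1 : DifferentiableOn ℂ (fun u => LinearMap.toContinuousLinearMap
      (LinearMap.proj (R := ℂ) (φ := fun _ => ℂ) w ∘ₗ B) (h u)) U :=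
    (ContinuousLinearMap.differentiable _).comp_differentiableOn hh
  exact h1

/-- lift of a vector function to words -/
def lft (h : ℂ → M) (hh : DifferentiableOn ℂ h U) : ((Σ i, I i) → Fin N) → FU U :=
  fun w => cut (fun u => B (h u) w) (lft_diff M I B h hh w)

lemma lft_apply (h : ℂ → M) (hh : DifferentiableOn ℂ h U) (w) {u : ℂ} (hu : u ∈ U) :
    (lft M I B h hh w).1 u = B (h u) w := cut_apply _ (lft_diff M I B h hh w) hu

/-- matrix of `B ∘ π` -/
def Amat (w w' : (Σ i, I i) → Fin N) : ℂ := B (π (Pi.single w' 1)) w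

lemma Amat_sum (f) (w) : ∑ w', Amat M I π B w w' * f w' = B (π f) w := by
  have : f = ∑ w', f w' • (Pi.single w' (1 : ℂ) : ((Σ i, I i) → Fin N) → ℂ) := by
    conv_lhs => rw [pi_eq_sum_univ' f]
  conv_rhs => rw [this]
  rw [map_sum, map_sum, Finset.sum_apply]
  apply sum_congr rfl
  intro w' _
  rw [map_smul, map_smul, Pi.smul_apply, smul_eq_mul, mul_comm, Amat]

lemma lft_Sol (hπ : ∀ j a b f, EE V M E φ j a b (π f) =
      π (∑ p : I j, eS (⟨j, p⟩ : Σ i, I i) a b f)) (W : Submodule ℂ M)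
    (hB : ∀ x ∈ W, π (B x) = x) (h : ℂ → M) (hh : DifferentiableOn ℂ h U)
    (hW : ∀ u ∈ U, h u ∈ W) (hD : ∀ u ∈ U, Dg V M E φ z (Matrix.diagonal K) h u = 0) :
    lft M I B h hh ∈ Sol hU (z := fun p : Σ i, I i => z p.1) (fun p => hz p.1) K
      (Amat M I π B) := by
  have hl : ∀ u ∈ U, (fun w => (lft M I B h hh w).1 u) = B (h u) := by
    intro u hu
    funext w
    exact lft_apply M I B h hh w hu
  refine ⟨fun w => ?_, fun w => ?_⟩
  · apply FU_ext
    intro u hu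
    rw [Submodule.coe_sum, Finset.sum_apply]
    have := Amat_sum M I π B (fun w => (lft M I B h hh w).1 u) w
    refine Eq.trans ?_ this.symm
    rw [hl u hu, hB _ (hW u hu), lft_apply M I B h hh w hu]
  · apply FU_ext
    intro u hu
    rw [Submodule.coe_sum, Finset.sum_apply]
    have := Amat_sum M I π B (fun w => (Dt (dU hU) K
      (QU (z := fun p : Σ i, I i => z p.1) fun p => hz p.1) (lft M I B h hh) w).1 u) w
    refine Eq.trans this ?_
    rw [← Dg_transfer V M E φ I π z K hU hz hπ h (lft M I B h hh) _ u hu, hD u hu, map_zero]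
    · rfl
    · intro u hu
      rw [Pr, hl u hu, hB _ (hW u hu)]

/-- polynomial part of a lifted quasi-exponential -/
def Pq (d : ℕ) (v : ℕ → M) (w : (Σ i, I i) → Fin N) : ℂ[X] :=
  ∑ s ∈ range (d + 1), monomial (d - s) (B (v s) w)

lemma Pq_coeff (d : ℕ) (v : ℕ → M) (w) : (Pq M I B d v w).coeff d = B (v 0) w := by
  rw [Pq, finsetSum_coeff, sum_eq_single 0]
  · simp
  · intro s hs h0
    rw [coeff_monomial, if_neg]
    rw [mem_range] at hs
    omega
  · simp

lemma qe_diffM (κ : ℂ) (d : ℕ) (v : ℕ → M) : DifferentiableOn ℂ (fun x => Complex.exp (κ * x) •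
      ∑ s ∈ Finset.range (d + 1), (x ^ (d - s)) • v s) U := by
  apply Differentiable.differentiableOn
  apply Differentiable.smul
  · fun_prop
  · apply Differentiable.fun_sum
    intro s _
    apply Differentiable.smul_const
    fun_prop

lemma lft_qe (κ : ℂ) (d : ℕ) (v : ℕ → M) (w) :
    lft M I B (U := U) _ (qe_diffM M κ d v) w = Psi U κ (Pq M I B d v w) := by
  apply FU_ext
  intro u hu
  rw [lft_apply M I B _ _ w hu, Psi_apply _ _ hu, map_smul, Pi.smul_apply, smul_eq_mul, map_sum,
    Finset.sum_apply, Pq, eval_finsetSum]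
  congr 1
  apply sum_congr rfl
  intro s _
  rw [map_smul, Pi.smul_apply, smul_eq_mul, eval_monomial, mul_comm]

theorem span_all (hU : IsOpen U) (hz : ∀ j, z j ∉ U) (hs : Function.Surjective π) (hπ : ∀ j a b f, EE V M E φ j a b (π f) =
      π (∑ p : I j, eS (⟨j, p⟩ : Σ i, I i) a b f)) (hK : ∀ i j, i ≠ j → K i ≠ K j)
    (hN : 1 ≤ N) (m : Fin N → ℕ) (hc : IsPreconnected U) (hne : U.Nonempty)
    (f : ℂ → M) (hf : DifferentiableOn ℂ f U)
    (hfW : ∀ u ∈ U, f u ∈ Wt V M E φ (fun b => (m b : ℤ)))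
    (hfD : ∀ u ∈ U, Dg V M E φ z (Matrix.diagonal K) f u = 0) :
    ∃ (r : ℕ) (c : Fin r → ℂ) (G : Fin r → ℂ → M),
          (∀ t, ∃ (i : Fin N) (v : ℕ → M),
            (∀ s, v s ∈ Wt V M E φ (fun b => (m b : ℤ))) ∧
            G t = fun x => Complex.exp (K i * x) •
              ∑ s ∈ Finset.range (m i + 1), (x ^ (m i - s)) • v s) ∧
          (∀ t, ∀ u : ℂ, GoodG z u → Dg V M E φ z (Matrix.diagonal K) (G t) u = 0) ∧
          (∀ u ∈ U, f u = ∑ t, c t • G t u) := by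
  set W := Wt V M E φ (fun b => (m b : ℤ)) with hWdef
  obtain ⟨s0, hs0⟩ := π.exists_rightInverse_of_surjective (LinearMap.range_eq_top.2 hs)
  obtain ⟨ρ, hρ⟩ := LinearMap.exists_leftInverse_of_injective W.subtype (Submodule.ker_subtype W)
  let B : M →ₗ[ℂ] (((Σ i, I i) → Fin N) → ℂ) := s0 ∘ₗ W.subtype ∘ₗ ρ
  have hB : ∀ x ∈ W, π (B x) = x := by
    intro x hx
    have h1 : ρ x = ⟨x, hx⟩ := LinearMap.congr_fun hρ ⟨x, hx⟩
    change π (s0 (ρ x : M)) = x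
    rw [h1]
    exact LinearMap.congr_fun hs0 x
  obtain ⟨u0, hu0⟩ := id hne
  have hgood : ∀ u ∈ U, GoodG z u := fun u hu j h => hz j (h ▸ hu)
  let d := Module.finrank ℂ W
  let b : Module.Basis (Fin d) ℂ W := Module.finBasis ℂ W
  choose v hv1 hv2 hv3 using fun (i : Fin N) (k : Fin d) =>
    qe_exists V M E φ I π z K hs hπ hK m i (b k : M) (b k).2
  let G : Fin N × Fin d → ℂ → M := fun ik x => Complex.exp (K ik.1 * x) •
              ∑ s ∈ Finset.range (m ik.1 + 1), (x ^ (m ik.1 - s)) • v ik.1 ik.2 s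
  let Gt : Fin N × Fin d → ((Σ i, I i) → Fin N) → FU U := fun ik =>
    lft M I B _ (qe_diffM M (K ik.1) (m ik.1) (v ik.1 ik.2))
  have hGW : ∀ ik, ∀ u, G ik u ∈ W := by
    intro ik u
    apply Submodule.smul_mem
    apply Submodule.sum_mem
    intro s _
    apply Submodule.smul_mem
    exact hv1 _ _ _
  let S := Sol hU (z := fun p : Σ i, I i => z p.1) (fun p => hz p.1) K (Amat M I π B)
  have hGS : ∀ ik, Gt ik ∈ S := fun ik =>
    lft_Sol V M E φ I π z K hU hz B hπ W hB _ _ (fun u _ => hGW ik u)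
      (fun u hu => hv3 ik.1 ik.2 u (hgood u hu))
  have hfS : lft M I B f hf ∈ S := lft_Sol V M E φ I π z K hU hz B hπ W hB f hf hfW hfD
  let evq : (((Σ i, I i) → Fin N) → FU U) →ₗ[ℂ] (Fin N → W) :=
    LinearMap.pi fun q => ρ ∘ₗ π ∘ₗ LinearMap.pi fun w =>
      evU U u0 ∘ₗ (dU hU ^ (q : ℕ)) ∘ₗ LinearMap.proj w
  have hev : ∀ g q, evq g q = ρ (π fun w => ((dU hU ^ (q : ℕ)) (g w)).1 u0) := fun _ _ => rfl
  have huniq : ∀ g ∈ S, evq g = 0 → g = 0 := by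
    intro g hg h0
    apply uniqU hU u0 hc hu0 hN (z := fun p : Σ i, I i => z p.1) (fun p => hz p.1) K
      (Amat M I π B) g hg.1 hg.2
    intro w q hq
    have h1 := congrFun h0 ⟨q, hq⟩
    rw [hev] at h1
    rw [hg.1 w, map_sum, Submodule.coe_sum, Finset.sum_apply]
    have := Amat_sum M I π B (fun w => ((dU hU ^ q) (g w)).1 u0) w
    refine Eq.trans ?_ (this.trans ?_)
    · apply sum_congr rfl
      intro w' _
      rw [map_smul]
      rfl
    · change s0 (ρ _ : M) w = 0
      rw [h1]
      simp
  let L : (Fin N × Fin d → ℂ) →ₗ[ℂ] (Fin N → W) := evq ∘ₗ Fintype.linearCombination ℂ Gt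
  have hLS : ∀ c, Fintype.linearCombination ℂ Gt c ∈ S := by
    intro c
    rw [Fintype.linearCombination_apply]
    exact Submodule.sum_mem _ fun ik _ => Submodule.smul_mem _ _ (hGS ik)
  have hLinj : Function.Injective L := by
    rw [injective_iff_map_eq_zero]
    intro c hc0
    have h1 := huniq _ (hLS c) hc0
    rw [Fintype.linearCombination_apply] at h1
    have h2 : ∀ w i, ∑ k, c (i, k) • Pq M I B (m i) (v i k) w = 0 := by
      intro w
      apply Psi_indep hU hne K hK
      have h3 := congrFun h1 w
      rw [Finset.sum_apply, Fintype.sum_prod_type] at h3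
      refine Eq.trans ?_ h3
      apply sum_congr rfl
      intro i _
      rw [map_sum]
      apply sum_congr rfl
      intro k _
      rw [map_smul, ← lft_qe]
      rfl
    funext ik
    obtain ⟨i, k⟩ := ik
    have h3 : ∑ k, c (i, k) • b k = 0 := by
      apply Subtype.ext
      have h4 : B ((∑ k, c (i, k) • b k : W) : M) = 0 := by
        funext w
        have h5 := congrArg (fun p : ℂ[X] => p.coeff (m i)) (h2 w i)
        simp only [finsetSum_coeff, coeff_smul, Pq_coeff, hv2, coeff_zero] at h5
        rw [Submodule.coe_sum, map_sum, Finset.sum_apply]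
        refine Eq.trans ?_ h5
        apply sum_congr rfl
        intro k _
        rw [Submodule.coe_smul, map_smul]
        rfl
      rw [← hB _ (∑ k, c (i, k) • b k : W).2, h4, map_zero]
      rfl
    exact Fintype.linearIndependent_iff.1 b.linearIndependent (fun k => c (i, k)) h3 k
  have hfin : Module.finrank ℂ (Fin N × Fin d → ℂ) = Module.finrank ℂ (Fin N → W) := by
    rw [Module.finrank_fintype_fun_eq_card, Module.finrank_pi_fintype]
    simp [d]
  obtain ⟨c, hc'⟩ := (LinearMap.injective_iff_surjective_of_finrank_eq_finrank hfin).1 hLinj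
    (evq (lft M I B f hf))
  have hfinal : lft M I B f hf = Fintype.linearCombination ℂ Gt c := by
    rw [← sub_eq_zero]
    apply huniq _ (Submodule.sub_mem _ hfS (hLS c))
    rw [map_sub, sub_eq_zero]
    exact hc'.symm
  let e := (Fintype.equivFin (Fin N × Fin d)).symm
  refine ⟨Fintype.card (Fin N × Fin d), fun t => c (e t), fun t => G (e t), ?_, ?_, ?_⟩
  · intro t
    exact ⟨(e t).1, v (e t).1 (e t).2, hv1 _ _, rfl⟩
  · intro t u hu
    exact hv3 _ _ u hu
  · intro u hu
    rw [Equiv.sum_comp e (fun ik => c ik • G ik u)]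
    have hWs : ∑ ik, c ik • G ik u ∈ W :=
      Submodule.sum_mem _ fun ik _ => Submodule.smul_mem _ _ (hGW ik u)
    rw [← hB _ (hfW u hu), ← hB _ hWs]
    congr 1
    funext w
    rw [← lft_apply M I B f hf w hu, hfinal, Fintype.linearCombination_apply, Finset.sum_apply,
      Submodule.coe_sum, Finset.sum_apply, map_sum, Finset.sum_apply]
    apply sum_congr rfl
    intro ik _
    rw [map_smul]
    change c ik * (Gt ik w).1 u = c ik * B (G ik u) w
    congr 1
    exact lft_apply M I B _ _ w hu

end PartF4
end GaudinAux


namespace GaudinModel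

/-- Assume `K = diag(K_1,…,K_N)` with pairwise distinct entries.  For
every `i` and every nonzero `v₀ ∈ M[m]` there is a quasi-exponential
`e^{K_i u}(v₀ u^{m_i} + v₁ u^{m_i−1} + … + v_{m_i})` with all `v_t ∈ M[m]` annihilated by
`D_{K,M}(u,∂)` away from `z_1,…,z_n`; moreover every holomorphic solution of
`D_{K,M} f = 0` with values in `M[m]` on a simply connected open subset of `ℂ∖{z_1,…,z_n}`
is a `ℂ`-linear combination of restrictions of such quasi-exponentials. -/
theorem statement_16
    {N n : ℕ} (hN : 2 ≤ N) (hn : 1 ≤ n)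
    (V : Fin n → Type*) [∀ i, AddCommGroup (V i)] [∀ i, Module ℂ (V i)]
    [∀ i, FiniteDimensional ℂ (V i)]
    (M : Type*) [NormedAddCommGroup M] [NormedSpace ℂ M] [FiniteDimensional ℂ M]
    (Λ : Fin n → Fin N → ℤ)
    (hdom : ∀ i, ∀ a b : Fin N, a ≤ b → Λ i b ≤ Λ i a)
    (hpoly : ∀ i a, 0 ≤ Λ i a)
    (hlast : ∀ i, Λ i ⟨N - 1, by omega⟩ = 0)
    (E : ∀ i : Fin n, Fin N → Fin N → (V i →ₗ[ℂ] V i))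
    (hrel : GlRel V E)
    (hhw : IsHW V E Λ)
    (φ : M ≃ₗ[ℂ] PiTensorProduct ℂ V)
    (z : Fin n → ℂ) (hz : Function.Injective z)
    (K : Fin N → ℂ) (hK : ∀ i j, i ≠ j → K i ≠ K j)
    (m : Fin N → ℕ) :
    -- for every `i` and nonzero `v₀ ∈ M[m]` there is a quasi-exponential solution
    -- `e^{K_i u}(v₀ u^{m_i} + … + v_{m_i})`
    (∀ i : Fin N, ∀ v0 ∈ Wt V M E φ (fun b => (m b : ℤ)), v0 ≠ 0 →
      ∃ v : ℕ → M, (∀ t, v t ∈ Wt V M E φ (fun b => (m b : ℤ))) ∧ v 0 = v0 ∧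
        ∀ u : ℂ, GoodG z u →
          Dg V M E φ z (Matrix.diagonal K)
            (fun x => Complex.exp (K i * x) •
              ∑ t ∈ Finset.range (m i + 1), (x ^ (m i - t)) • v t) u = 0) ∧
    -- every `M[m]`-valued holomorphic solution on a simply connected open subset of
    -- `ℂ∖{z_1,…,z_n}` is a `ℂ`-linear combination of such quasi-exponentials
    (∀ U : Set ℂ, IsOpen U → (∀ j, z j ∉ U) → SimplyConnectedSpace U →
      ∀ f : ℂ → M, DifferentiableOn ℂ f U → (∀ u ∈ U, f u ∈ Wt V M E φ (fun b => (m b : ℤ))) →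
        (∀ u ∈ U, Dg V M E φ z (Matrix.diagonal K) f u = 0) →
        ∃ (r : ℕ) (c : Fin r → ℂ) (G : Fin r → ℂ → M),
          (∀ t, ∃ (i : Fin N) (v : ℕ → M),
            (∀ s, v s ∈ Wt V M E φ (fun b => (m b : ℤ))) ∧
            G t = fun x => Complex.exp (K i * x) •
              ∑ s ∈ Finset.range (m i + 1), (x ^ (m i - s)) • v s) ∧
          (∀ t, ∀ u : ℂ, GoodG z u → Dg V M E φ z (Matrix.diagonal K) (G t) u = 0) ∧
          (∀ u ∈ U, f u = ∑ t, c t • G t u)) := by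
  obtain ⟨π, hs, hπ⟩ := GaudinAux.total_intertwiner V M E φ Λ hdom hpoly hrel hhw
  refine ⟨fun i v0 hv0 _ => GaudinAux.qe_exists V M E φ (fun i => GaudinAux.Jt (Λ i)) π z K hs hπ
    hK m i v0 hv0, ?_⟩
  intro U hU hzU hsc f hf hfW hfD
  have hc : IsPreconnected U := isPreconnected_iff_preconnectedSpace.2 inferInstance
  have hne : U.Nonempty := by
    obtain ⟨x⟩ : Nonempty U := inferInstance
    exact ⟨x, x.2⟩
  exact GaudinAux.span_all V M E φ (fun i => GaudinAux.Jt (Λ i)) π z K hU hzU hs hπ hK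
    (by omega) m hc hne f hf hfW hfD

end GaudinModel
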